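/- (Critical decay.) Let d ≥ 1 and let (S_z, J_z, h_z), z ∈ [z_c−δ, z_c), be a critical family with constants M, K, ζ. Let s ∈ [0,∞), with s > 0 if d ≤ 2. Then for any sequences z_n → z_c⁻ and nonzero x_n ∈ ℤ^d with ‖x_n‖₂ → ∞ and m_{z_n}|x_n|_{z_n} → s, one has S_{z_n}(x_n) σ_{z_n}² ‖x_n‖₂^{d−2}/d − 𝔾_s(e₁) ĥ_{z_n}(0) → 0; equivalently, S_z(x) = d σ_z^{−2} ‖x‖₂^{−(d−2)} 𝔾_s(x̂) [ĥ_z(0) + o(1)] in this joint limit (where 𝔾_s(x̂) = 𝔾_s(e₁) since 𝔾_s is radial). -/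

import Mathlib

open scoped BigOperators ENNReal Real Topology Pointwise
open MeasureTheory Matrix Filter

noncomputable section

namespace OZpaper

variable {d : ℕ}

/-- Dot product of a real vector with a lattice point. -/
def rdotZ (μ : Fin d → ℝ) (x : Fin d → ℤ) : ℝ := ∑ i, μ i * (x i : ℝ)

/-- Dot product of two real vectors. -/
def rdot (μ x : Fin d → ℝ) : ℝ := ∑ i, μ i * x i

/-- Euclidean norm of a lattice point. -/
def enormZ (x : Fin d → ℤ) : ℝ := Real.sqrt (∑ i, ((x i : ℝ)) ^ 2)

/-- Euclidean norm of a real vector. -/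
def enormR (x : Fin d → ℝ) : ℝ := Real.sqrt (∑ i, (x i) ^ 2)

/-- ℓ¹ norm of a real vector. -/
def l1R (x : Fin d → ℝ) : ℝ := ∑ i, |x i|

/-- ℓ∞ norm of a real vector. -/
def linftyR (x : Fin d → ℝ) : ℝ := ⨆ i, |x i|

/-- The vector `t • e₁`. -/
def e1R (d : ℕ) (t : ℝ) : Fin d → ℝ := fun i => if (i : ℕ) = 0 then t else 0

/-- The lattice point `n • e₁`. -/
def e1Z (d : ℕ) (n : ℤ) : Fin d → ℤ := fun i => if (i : ℕ) = 0 then n else 0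

/-- Cast of a lattice point to a real vector. -/
def toR (x : Fin d → ℤ) : Fin d → ℝ := fun i => (x i : ℝ)

/-- ℤ^d-symmetry: invariance under coordinate permutations and sign flips. -/
def ZdSymmetric (f : (Fin d → ℤ) → ℝ) : Prop :=
  (∀ (σ : Equiv.Perm (Fin d)) (x : Fin d → ℤ), f (fun i => x (σ i)) = f x) ∧
  (∀ (ε : Fin d → Bool) (x : Fin d → ℤ), f (fun i => if ε i then -(x i) else x i) = f x)

/-- Tilted susceptibility `χ^{(μ)}`, valued in `ℝ≥0∞`. -/
def chi (S : (Fin d → ℤ) → ℝ) (μ : Fin d → ℝ) : ℝ≥0∞ :=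
  ∑' x, ENNReal.ofReal (S x * Real.exp (rdotZ μ x))

/-- The set `Ω = {μ : χ^{(μ)} < ∞}`. -/
def Omega (S : (Fin d → ℤ) → ℝ) : Set (Fin d → ℝ) := {μ | chi S μ < ⊤}

/-- The mass `m_S`. -/
def mass (S : (Fin d → ℤ) → ℝ) : ℝ := sSup {t : ℝ | 0 ≤ t ∧ chi S (e1R d t) < ⊤}

/-- Assumption Ω. -/
structure AssumptionOmega (S : (Fin d → ℤ) → ℝ) : Prop where
  nonneg : ∀ x, 0 ≤ S x
  symm : ZdSymmetric S
  open_Omega : IsOpen (Omega S)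
  zero_mem : (0 : Fin d → ℝ) ∈ Omega S
  exists_not_mem : ∃ μ₁ : ℝ, 0 < μ₁ ∧ e1R d μ₁ ∉ Omega S

/-- Fourier transform `Q̂(k) = ∑_y Q(y) e^{-i k·y}`. -/
def fourierZ (Q : (Fin d → ℤ) → ℝ) (k : Fin d → ℝ) : ℂ :=
  ∑' y, (Q y : ℂ) * Complex.exp (-Complex.I * (rdotZ k y : ℂ))

/-- ℓ^p norm of a function on ℤ^d, valued in `ℝ≥0∞`. -/
def lpNorm (f : (Fin d → ℤ) → ℝ) (p : ℝ) : ℝ≥0∞ :=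
  (∑' y, ENNReal.ofReal (|f y| ^ p)) ^ (1 / p)

/-- The exponent `p_d`. -/
def pExp (d : ℕ) (ζ : ℝ) : ℝ := if d = 1 then 2 else (d : ℝ) / ((d : ℝ) - 2 + min ζ 2)

/-- The class 𝒬_{M,K,ζ} without the (d-1)-th moment bounds. -/
structure MemQweak (M K ζ : ℝ) (Q g : (Fin d → ℤ) → ℝ) : Prop where
  Q_l1 : lpNorm Q 1 ≤ ENNReal.ofReal M
  Q_moment : lpNorm (fun y => enormZ y ^ (2 + ζ) * Q y) 1 ≤ ENNReal.ofReal M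
  infrared : ∀ k : Fin d → ℝ, (∀ i, |k i| ≤ π) →
    K * enormR k ^ 2 ≤ (fourierZ Q 0 - fourierZ Q k).re
  g_l1 : lpNorm g 1 ≤ ENNReal.ofReal M
  g_zeta : lpNorm (fun y => enormZ y ^ ζ * g y) 1 ≤ ENNReal.ofReal M
  g_two : lpNorm (fun y => enormZ y ^ (2 : ℝ) * g y) (min (pExp d ζ) 2) ≤ ENNReal.ofReal M

/-- The class 𝒬_{M,K,ζ}. -/
structure MemQ (M K ζ : ℝ) (Q g : (Fin d → ℤ) → ℝ) : Prop where
  Q_l1 : lpNorm Q 1 ≤ ENNReal.ofReal M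
  Q_moment : lpNorm (fun y => enormZ y ^ (2 + ζ) * Q y) 1 ≤ ENNReal.ofReal M
  infrared : ∀ k : Fin d → ℝ, (∀ i, |k i| ≤ π) →
    K * enormR k ^ 2 ≤ (fourierZ Q 0 - fourierZ Q k).re
  g_l1 : lpNorm g 1 ≤ ENNReal.ofReal M
  g_zeta : lpNorm (fun y => enormZ y ^ ζ * g y) 1 ≤ ENNReal.ofReal M
  g_two : lpNorm (fun y => enormZ y ^ (2 : ℝ) * g y) (min (pExp d ζ) 2) ≤ ENNReal.ofReal M
  Q_dm1 : 4 ≤ d →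
    lpNorm (fun y => enormZ y ^ ((d : ℝ) - 1) * Q y) (min ((d : ℝ) / 3) 2) ≤ ENNReal.ofReal M
  g_dm1 : 4 ≤ d →
    lpNorm (fun y => enormZ y ^ ((d : ℝ) - 1) * g y) 2 ≤ ENNReal.ofReal M

/-- Convolution on ℤ^d. -/
def conv (f g : (Fin d → ℤ) → ℝ) (x : Fin d → ℤ) : ℝ := ∑' y, f (x - y) * g y

/-- Exponential tilt `f^{(μ)}`. -/
def tilt (f : (Fin d → ℤ) → ℝ) (μ : Fin d → ℝ) : (Fin d → ℤ) → ℝ :=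
  fun x => f x * Real.exp (rdotZ μ x)

/-- `∑_y f(y) e^{μ·y}`, i.e. `f̂^{(μ)}(0)`. -/
def tiltSum (f : (Fin d → ℤ) → ℝ) (μ : Fin d → ℝ) : ℝ := ∑' y, f y * Real.exp (rdotZ μ y)

/-- Assumption J. -/
structure AssumptionJ (S J h : (Fin d → ℤ) → ℝ) (M K ζ : ℝ) : Prop where
  M_pos : 0 < M
  K_pos : 0 < K
  zeta_pos : 0 < ζ
  J_symm : ZdSymmetric J
  h_symm : ZdSymmetric h
  J_summable : Summable fun x => |J x|
  h_summable : Summable fun x => |h x|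
  OZ_eq : ∀ x, S x = h x + conv J S x
  memQ : ∀ μ ∈ closure (Omega S), MemQ M K ζ (tilt J μ) (tilt h μ)
  hhat_pos : ∀ μ ∈ closure (Omega S), 0 < tiltSum h μ

/-- Assumption J, without the (d-1)-th moment bounds of the class 𝒬. -/
structure AssumptionJweak (S J h : (Fin d → ℤ) → ℝ) (M K ζ : ℝ) : Prop where
  M_pos : 0 < M
  K_pos : 0 < K
  zeta_pos : 0 < ζ
  J_symm : ZdSymmetric J
  h_symm : ZdSymmetric h
  J_summable : Summable fun x => |J x|
  h_summable : Summable fun x => |h x|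
  OZ_eq : ∀ x, S x = h x + conv J S x
  memQ : ∀ μ ∈ closure (Omega S), MemQweak M K ζ (tilt J μ) (tilt h μ)
  hhat_pos : ∀ μ ∈ closure (Omega S), 0 < tiltSum h μ

/-- `μ` is the optimal tilt `μ_x̂` for direction `x`. -/
def IsOptTilt (S : (Fin d → ℤ) → ℝ) (x μ : Fin d → ℝ) : Prop :=
  μ ∈ frontier (Omega S) ∧ ∀ ν ∈ closure (Omega S), rdot ν x ≤ rdot μ x

/-- The norm `|x|_S = (max_{μ ∈ Ω̄} μ·x)/m_S`. -/
def normS (S : (Fin d → ℤ) → ℝ) (x : Fin d → ℝ) : ℝ :=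
  sSup ((fun μ => rdot μ x) '' closure (Omega S)) / mass S

/-- The drift vector `η` of the tilted kernel. -/
def etaOf (J : (Fin d → ℤ) → ℝ) (μ : Fin d → ℝ) : Fin d → ℝ :=
  fun j => ∑' y, (y j : ℝ) * J y * Real.exp (rdotZ μ y)

/-- The covariance matrix `Λ` of the tilted kernel. -/
def LambdaOf (J : (Fin d → ℤ) → ℝ) (μ : Fin d → ℝ) : Matrix (Fin d) (Fin d) ℝ :=
  Matrix.of fun j l => ∑' y, (y j : ℝ) * (y l : ℝ) * J y * Real.exp (rdotZ μ y)

/-- The Brownian heat kernel `ρ_t(x; η, Λ)`. -/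
def heatKer (d : ℕ) (t : ℝ) (x η : Fin d → ℝ) (Λ : Matrix (Fin d) (Fin d) ℝ) : ℝ :=
  (1 / Real.sqrt Λ.det) * (1 / (2 * π * t) ^ ((d : ℝ) / 2)) *
    Real.exp (-(1 / (2 * t)) * rdot (x - t • η) (Λ⁻¹ *ᵥ (x - t • η)))

/-- The Brownian Green function `𝒞(x; η, Λ)`. -/
def greenC (d : ℕ) (x η : Fin d → ℝ) (Λ : Matrix (Fin d) (Fin d) ℝ) : ℝ :=
  ∫ t in Set.Ioi (0 : ℝ), heatKer d t x η Λ

/-- The massive continuum Green function `𝔾_a(x)`. -/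
def massiveG (d : ℕ) (a : ℝ) (x : Fin d → ℝ) : ℝ :=
  ∫ t in Set.Ioi (0 : ℝ),
    (1 / (2 * π * t) ^ ((d : ℝ) / 2)) * Real.exp (-enormR x ^ 2 / (2 * t)) *
      Real.exp (-(t * a ^ 2) / 2)

/-- The constant `A_φ = ∫_{ℝ^d} ‖y‖₂^φ 𝔾₁(y) dy`. -/
def Aconst (d : ℕ) (φ : ℝ) : ℝ := ∫ y : Fin d → ℝ, enormR y ^ φ * massiveG d 1 y

/-- The torus `[-π, π]^d`. -/
def torus (d : ℕ) : Set (Fin d → ℝ) := Set.univ.pi fun _ => Set.Icc (-π) π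

/-- The Fourier integral `I_t(x)`. -/
def It (Q g : (Fin d → ℤ) → ℝ) (t : ℝ) (x : Fin d → ℤ) : ℂ :=
  (((2 * π) ^ d : ℝ) : ℂ)⁻¹ *
    ∫ k in torus d, Complex.exp (Complex.I * (rdotZ k x : ℂ)) * fourierZ g k *
      Complex.exp (-(t : ℂ) * (fourierZ Q 0 - fourierZ Q k))

/-- The quantity `G_Q(x)`. -/
def GQ (Q g : (Fin d → ℤ) → ℝ) (x : Fin d → ℤ) : ℂ :=
  ∫ t in Set.Ioi (0 : ℝ), It Q g t x

/-- The Kronecker delta at the origin. -/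
def deltaZ (d : ℕ) : (Fin d → ℤ) → ℝ := fun x => if x = 0 then 1 else 0

/-- n-fold convolution power. -/
def convPow (D : (Fin d → ℤ) → ℝ) : ℕ → (Fin d → ℤ) → ℝ
  | 0 => deltaZ d
  | n + 1 => conv D (convPow D n)

/-- Random-walk Green function `S_z(x) = ∑_n z^n D^{*n}(x)`. -/
def rwG (D : (Fin d → ℤ) → ℝ) (z : ℝ) (x : Fin d → ℤ) : ℝ :=
  ∑' n : ℕ, z ^ n * convPow D n x

/-- `σ² = ∑_x ‖x‖₂² J(x)`. -/
def sigmaSq (J : (Fin d → ℤ) → ℝ) : ℝ := ∑' x, enormZ x ^ 2 * J x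

/-- Susceptibility `χ = ∑_x S(x)`. -/
def suscept (S : (Fin d → ℤ) → ℝ) : ℝ := ∑' x, S x

/-- `ĥ(0) = ∑_x h(x)`. -/
def h0 (h : (Fin d → ℤ) → ℝ) : ℝ := ∑' x, h x

/-- Correlation length of order φ. -/
def xiPhi (S : (Fin d → ℤ) → ℝ) (φ : ℝ) : ℝ :=
  ((∑' x, enormZ x ^ φ * S x) / suscept S) ^ (1 / φ)

/-- A critical family of OZ systems. -/
structure CriticalFamily (d : ℕ) (δ zc M K ζ : ℝ) (S J h : ℝ → (Fin d → ℤ) → ℝ) : Prop where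
  δ_pos : 0 < δ
  assumOmega : ∀ z ∈ Set.Ico (zc - δ) zc, AssumptionOmega (S z)
  assumJ : ∀ z ∈ Set.Ico (zc - δ) zc, AssumptionJ (S z) (J z) (h z) M K ζ
  mass_tendsto : Tendsto (fun z => mass (S z)) (𝓝[<] zc) (𝓝 0)

/-- Convolution on ℤ. -/
def convZ (f g : ℤ → ℝ) (x : ℤ) : ℝ := ∑' y, f (x - y) * g y

/-- n-fold convolution power on ℤ. -/
def convZPow (f : ℤ → ℝ) : ℕ → ℤ → ℝ
  | 0 => fun x => if x = 0 then 1 else 0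
  | n + 1 => convZ f (convZPow f n)

section LatticeBasics

lemma rdotZ_sub_right (μ : Fin d → ℝ) (x y : Fin d → ℤ) :
    rdotZ μ (x - y) = rdotZ μ x - rdotZ μ y := by
  simp [rdotZ, mul_sub, Finset.sum_sub_distrib]

lemma rdotZ_neg_right (μ : Fin d → ℝ) (x : Fin d → ℤ) : rdotZ μ (-x) = -rdotZ μ x := by
  simp [rdotZ]

lemma rdotZ_zero_left (x : Fin d → ℤ) : rdotZ 0 x = 0 := by
  simp [rdotZ]

lemma rdotZ_smul_left (c : ℝ) (μ : Fin d → ℝ) (x : Fin d → ℤ) :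
    rdotZ (c • μ) x = c * rdotZ μ x := by
  simp [rdotZ, Finset.mul_sum, mul_assoc]

lemma continuous_rdotZ_left (x : Fin d → ℤ) : Continuous fun μ : Fin d → ℝ => rdotZ μ x := by
  unfold rdotZ; fun_prop

lemma enormZ_nonneg (x : Fin d → ℤ) : 0 ≤ enormZ x := Real.sqrt_nonneg _

lemma enormR_nonneg (x : Fin d → ℝ) : 0 ≤ enormR x := Real.sqrt_nonneg _

lemma enormZ_sq (x : Fin d → ℤ) : enormZ x ^ 2 = ∑ i, (x i : ℝ) ^ 2 :=
  Real.sq_sqrt (Finset.sum_nonneg fun _ _ => sq_nonneg _)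

lemma enormR_sq (x : Fin d → ℝ) : enormR x ^ 2 = ∑ i, x i ^ 2 :=
  Real.sq_sqrt (Finset.sum_nonneg fun _ _ => sq_nonneg _)

lemma continuous_enormR : Continuous (enormR : (Fin d → ℝ) → ℝ) := by
  unfold enormR; fun_prop

lemma enormR_smul {c : ℝ} (hc : 0 ≤ c) (x : Fin d → ℝ) : enormR (c • x) = c * enormR x := by
  refine (sq_eq_sq₀ (enormR_nonneg _) (mul_nonneg hc (enormR_nonneg _))).1 ?_
  rw [mul_pow, enormR_sq, enormR_sq, Finset.mul_sum]
  simp [mul_pow]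

lemma enormR_toR (x : Fin d → ℤ) : enormR (toR x) = enormZ x := rfl

lemma abs_rdotZ_le (μ : Fin d → ℝ) (x : Fin d → ℤ) :
    |rdotZ μ x| ≤ enormR μ * enormZ x := by
  refine abs_le_of_sq_le_sq ?_ (mul_nonneg (enormR_nonneg _) (enormZ_nonneg _))
  rw [mul_pow, enormR_sq, enormZ_sq]
  exact Finset.sum_mul_sq_le_sq_mul_sq _ _ _

lemma one_le_enormZ {x : Fin d → ℤ} (hx : x ≠ 0) : 1 ≤ enormZ x := by
  obtain ⟨i, hi⟩ := Function.ne_iff.1 hx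
  refine Real.one_le_sqrt.2 ?_
  calc (1 : ℝ) ≤ (x i : ℝ) ^ 2 := by
        have h : (1 : ℤ) ≤ (x i) ^ 2 := (one_le_sq_iff_one_le_abs _).2 (Int.one_le_abs hi)
        exact_mod_cast h
    _ ≤ ∑ j, (x j : ℝ) ^ 2 :=
        Finset.single_le_sum (f := fun j => (x j : ℝ) ^ 2) (fun _ _ => sq_nonneg _)
          (Finset.mem_univ i)

lemma enormZ_neg (x : Fin d → ℤ) : enormZ (-x) = enormZ x := by
  simp [enormZ]

end LatticeBasics

section Fourier

lemma norm_character (k : Fin d → ℝ) (y : Fin d → ℤ) :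
    ‖Complex.exp (-Complex.I * (rdotZ k y : ℂ))‖ = 1 := by
  rw [show -Complex.I * (rdotZ k y : ℂ) = ((-rdotZ k y : ℝ) : ℂ) * Complex.I by push_cast; ring]
  exact Complex.norm_exp_ofReal_mul_I _

lemma norm_character_pos (k : Fin d → ℝ) (y : Fin d → ℤ) :
    ‖Complex.exp (Complex.I * (rdotZ k y : ℂ))‖ = 1 := by
  rw [mul_comm]
  exact Complex.norm_exp_ofReal_mul_I _

lemma norm_fourierZ_term (f : (Fin d → ℤ) → ℝ) (k : Fin d → ℝ) (y : Fin d → ℤ) :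
    ‖(f y : ℂ) * Complex.exp (-Complex.I * (rdotZ k y : ℂ))‖ = |f y| := by
  rw [norm_mul, norm_character, mul_one, Complex.norm_real, Real.norm_eq_abs]

lemma summable_fourierZ {f : (Fin d → ℤ) → ℝ} (hf : Summable fun y => |f y|) (k : Fin d → ℝ) :
    Summable fun y => (f y : ℂ) * Complex.exp (-Complex.I * (rdotZ k y : ℂ)) := by
  refine Summable.of_norm ?_
  simpa only [norm_fourierZ_term] using hf

lemma norm_fourierZ_le {f : (Fin d → ℤ) → ℝ} (hf : Summable fun y => |f y|) (k : Fin d → ℝ) :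
    ‖fourierZ f k‖ ≤ ∑' y, |f y| := by
  refine (norm_tsum_le_tsum_norm ?_).trans_eq ?_
  · simpa only [norm_fourierZ_term] using hf
  · simp only [norm_fourierZ_term]

lemma continuous_fourierZ {f : (Fin d → ℤ) → ℝ} (hf : Summable fun y => |f y|) :
    Continuous (fourierZ f) := by
  refine continuous_tsum (u := fun y => |f y|) (fun y => ?_) hf fun y k =>
    (norm_fourierZ_term f k y).le
  have := continuous_rdotZ_left y
  fun_prop

lemma fourierZ_zero_right (f : (Fin d → ℤ) → ℝ) : fourierZ f 0 = ((∑' y, f y : ℝ) : ℂ) := by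
  simp [fourierZ, rdotZ_zero_left, Complex.ofReal_tsum]

lemma fourierZ_add {f g : (Fin d → ℤ) → ℝ} (hf : Summable fun y => |f y|)
    (hg : Summable fun y => |g y|) (k : Fin d → ℝ) :
    fourierZ (fun y => f y + g y) k = fourierZ f k + fourierZ g k := by
  unfold fourierZ
  rw [← (summable_fourierZ hf k).tsum_add (summable_fourierZ hg k)]
  simp only [Complex.ofReal_add, add_mul]

lemma fourierZ_re {f : (Fin d → ℤ) → ℝ} (hf : Summable fun y => |f y|) (k : Fin d → ℝ) :
    (fourierZ f k).re = ∑' y, f y * Real.cos (rdotZ k y) := by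
  unfold fourierZ
  rw [Complex.re_tsum (summable_fourierZ hf k)]
  refine tsum_congr fun y => ?_
  rw [show -Complex.I * (rdotZ k y : ℂ) = ((-rdotZ k y : ℝ) : ℂ) * Complex.I by push_cast; ring,
    Complex.re_ofReal_mul, Complex.exp_ofReal_mul_I_re, Real.cos_neg]

lemma fourierZ_im {f : (Fin d → ℤ) → ℝ} (hf : Summable fun y => |f y|)
    (hsymm : ∀ y, f (-y) = f y) (k : Fin d → ℝ) : (fourierZ f k).im = 0 := by
  unfold fourierZ
  rw [Complex.im_tsum (summable_fourierZ hf k)]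
  have h : ∀ y, ((f y : ℂ) * Complex.exp (-Complex.I * (rdotZ k y : ℂ))).im
      = -(f y * Real.sin (rdotZ k y)) := fun y => by
    rw [show -Complex.I * (rdotZ k y : ℂ) = ((-rdotZ k y : ℝ) : ℂ) * Complex.I by push_cast; ring,
      Complex.im_ofReal_mul, Complex.exp_ofReal_mul_I_im, Real.sin_neg, mul_neg]
  simp only [h]
  have h2 := (Equiv.neg (Fin d → ℤ)).tsum_eq fun y => -(f y * Real.sin (rdotZ k y))
  simp only [Equiv.neg_apply, hsymm, rdotZ_neg_right, Real.sin_neg, mul_neg, neg_neg,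
    tsum_neg] at h2
  rw [tsum_neg]
  linarith

/-- The shear `(x, y) ↦ (x - y, y)` of `ℤ^d × ℤ^d`. -/
def shearEquiv (d : ℕ) : (Fin d → ℤ) × (Fin d → ℤ) ≃ (Fin d → ℤ) × (Fin d → ℤ) where
  toFun p := (p.1 - p.2, p.2)
  invFun p := (p.1 + p.2, p.2)
  left_inv p := by simp
  right_inv p := by simp

lemma summable_shear {f g : (Fin d → ℤ) → ℂ} (hf : Summable fun y => ‖f y‖)
    (hg : Summable fun y => ‖g y‖) :
    Summable fun p : (Fin d → ℤ) × (Fin d → ℤ) => ‖f (p.1 - p.2) * g p.2‖ := by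
  have h := (shearEquiv d).summable_iff.2 (hf.mul_norm hg)
  exact h

lemma summable_abs_conv {f g : (Fin d → ℤ) → ℝ} (hf : Summable fun y => |f y|)
    (hg : Summable fun y => |g y|) : Summable fun x => |conv f g x| := by
  have h := summable_shear (f := fun y => (f y : ℂ)) (g := fun y => (g y : ℂ))
    (by simpa using hf) (by simpa using hg)
  refine Summable.of_nonneg_of_le (fun _ => abs_nonneg _) (fun x => ?_) h.prod
  have hx := h.prod_factor x
  simp only [norm_mul, Complex.norm_real] at hx ⊢
  unfold conv
  rw [← Real.norm_eq_abs]
  refine (norm_tsum_le_tsum_norm ?_).trans_eq ?_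
  · simpa only [norm_mul] using hx
  · simp only [norm_mul]

lemma fourierZ_conv {f g : (Fin d → ℤ) → ℝ} (hf : Summable fun y => |f y|)
    (hg : Summable fun y => |g y|) (k : Fin d → ℝ) :
    fourierZ (conv f g) k = fourierZ f k * fourierZ g k := by
  set F : (Fin d → ℤ) → ℂ := fun y => (f y : ℂ) * Complex.exp (-Complex.I * (rdotZ k y : ℂ))
  set G : (Fin d → ℤ) → ℂ := fun y => (g y : ℂ) * Complex.exp (-Complex.I * (rdotZ k y : ℂ))
  have hF : Summable fun y => ‖F y‖ := (summable_fourierZ hf k).norm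
  have hG : Summable fun y => ‖G y‖ := (summable_fourierZ hg k).norm
  have h : fourierZ f k * fourierZ g k = ∑' x, ∑' y, F (x - y) * G y := by
    rw [← (summable_shear hF hG).of_norm.tsum_prod]
    change (∑' y, F y) * (∑' y, G y) = _
    rw [tsum_mul_tsum_of_summable_norm hF hG]
    exact ((shearEquiv d).tsum_eq fun p => F p.1 * G p.2).symm
  rw [h]
  refine tsum_congr fun x => ?_
  rw [conv, Complex.ofReal_tsum, ← tsum_mul_right]
  refine tsum_congr fun y => ?_
  simp only [F, G]
  rw [mul_mul_mul_comm, ← Complex.exp_add, rdotZ_sub_right]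
  push_cast
  ring_nf

lemma tilt_conv (f g : (Fin d → ℤ) → ℝ) (μ : Fin d → ℝ) :
    tilt (conv f g) μ = conv (tilt f μ) (tilt g μ) := by
  funext x
  simp only [tilt, conv]
  rw [← tsum_mul_right]
  refine tsum_congr fun y => ?_
  rw [mul_mul_mul_comm, ← Real.exp_add, rdotZ_sub_right, sub_add_cancel]

end Fourier

section Coefficients

/-- The Fourier coefficient `(2π)^{-d} ∫ e^{ik·x} Φ(k) dk` over the torus. -/
def fcoef (Φ : (Fin d → ℝ) → ℂ) (x : Fin d → ℤ) : ℂ :=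
  (((2 * π) ^ d : ℝ) : ℂ)⁻¹ * ∫ k in torus d, Complex.exp (Complex.I * (rdotZ k x : ℂ)) * Φ k

lemma torus_eq_Icc (d : ℕ) : torus d = Set.Icc (fun _ => -π) (fun _ => π) :=
  Set.pi_univ_Icc _ _

lemma measurableSet_torus (d : ℕ) : MeasurableSet (torus d) := by
  rw [torus_eq_Icc]; exact measurableSet_Icc

lemma isCompact_torus (d : ℕ) : IsCompact (torus d) := by
  rw [torus_eq_Icc]; exact isCompact_Icc

lemma mem_torus_iff {k : Fin d → ℝ} : k ∈ torus d ↔ ∀ i, |k i| ≤ π := by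
  simp only [torus, Set.mem_univ_pi, Set.mem_Icc, abs_le]

instance : IsFiniteMeasure (volume.restrict (torus d)) :=
  ⟨by simpa using (isCompact_torus d).measure_lt_top⟩

lemma two_pi_pow_pos (d : ℕ) : 0 < (2 * π) ^ d := by positivity

lemma norm_two_pi_pow_inv (d : ℕ) : ‖(((2 * π) ^ d : ℝ) : ℂ)⁻¹‖ = ((2 * π) ^ d)⁻¹ := by
  rw [norm_inv, Complex.norm_real, Real.norm_of_nonneg (two_pi_pow_pos d).le]

lemma integral_torus_one (d : ℕ) : ∫ _k in torus d, (1 : ℝ) = (2 * π) ^ d := by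
  rw [torus_eq_Icc, setIntegral_const, smul_eq_mul, mul_one, measureReal_def,
    Real.volume_Icc_pi_toReal (fun _ => by linarith [Real.pi_pos])]
  simp [two_mul]

lemma continuous_character (x : Fin d → ℤ) :
    Continuous fun k : Fin d → ℝ => Complex.exp (Complex.I * (rdotZ k x : ℂ)) := by
  have := continuous_rdotZ_left x
  fun_prop

lemma integrable_character_mul {Φ : (Fin d → ℝ) → ℂ} (hΦ : IntegrableOn Φ (torus d))
    (x : Fin d → ℤ) :
    IntegrableOn (fun k => Complex.exp (Complex.I * (rdotZ k x : ℂ)) * Φ k) (torus d) :=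
  Integrable.bdd_mul (c := 1) hΦ (continuous_character x).aestronglyMeasurable
    (Eventually.of_forall fun k => (norm_character_pos k x).le)

lemma norm_fcoef_le (Φ : (Fin d → ℝ) → ℂ) (x : Fin d → ℤ) :
    ‖fcoef Φ x‖ ≤ ((2 * π) ^ d)⁻¹ * ∫ k in torus d, ‖Φ k‖ := by
  rw [fcoef, norm_mul, norm_two_pi_pow_inv]
  have := two_pi_pow_pos d
  gcongr
  refine (norm_integral_le_integral_norm _).trans_eq ?_
  simp only [norm_mul, norm_character_pos, one_mul]

lemma integral_exp_intCast_mul (n : ℤ) :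
    ∫ t in Set.Icc (-π) π, Complex.exp (Complex.I * ((t * n : ℝ) : ℂ))
      = if n = 0 then ((2 * π : ℝ) : ℂ) else 0 := by
  rw [integral_Icc_eq_integral_Ioc,
    ← intervalIntegral.integral_of_le (by linarith [Real.pi_pos])]
  split_ifs with hn
  · subst hn
    simp
    ring
  · have hc : Complex.I * (n : ℂ) ≠ 0 :=
      mul_ne_zero Complex.I_ne_zero (by exact_mod_cast hn)
    have h1 : ∀ t : ℝ, Complex.I * ((t * n : ℝ) : ℂ) = Complex.I * n * t := fun t => by
      push_cast; ring
    simp only [h1]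
    rw [integral_exp_mul_complex hc]
    have h2 : Complex.exp (Complex.I * n * (π : ℝ)) =
        Complex.exp (Complex.I * n * ((-π : ℝ) : ℂ)) := by
      rw [Complex.exp_eq_exp_iff_exists_int]
      exact ⟨n, by push_cast; ring⟩
    rw [h2, sub_self, zero_div]

lemma integral_character (x : Fin d → ℤ) :
    ∫ k in torus d, Complex.exp (Complex.I * (rdotZ k x : ℂ))
      = if x = 0 then (((2 * π) ^ d : ℝ) : ℂ) else 0 := by
  have h : ∀ k : Fin d → ℝ, Complex.exp (Complex.I * (rdotZ k x : ℂ))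
      = ∏ i, Complex.exp (Complex.I * ((k i * x i : ℝ) : ℂ)) := fun k => by
    rw [← Complex.exp_sum, rdotZ, Complex.ofReal_sum, Finset.mul_sum]
  simp only [h]
  rw [torus, volume_pi, Measure.restrict_pi_pi,
    integral_fintype_prod_eq_prod (fun (i : Fin d) (t : ℝ) =>
      Complex.exp (Complex.I * ((t * x i : ℝ) : ℂ)))]
  simp only [integral_exp_intCast_mul]
  split_ifs with hx
  · subst hx
    simp
  · obtain ⟨i, hi⟩ := Function.ne_iff.1 hx
    exact Finset.prod_eq_zero (Finset.mem_univ i) (if_neg hi)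

lemma fcoef_character (x y : Fin d → ℤ) :
    fcoef (fun k => Complex.exp (-Complex.I * (rdotZ k y : ℂ))) x = if x = y then 1 else 0 := by
  unfold fcoef
  have h : ∀ k : Fin d → ℝ, Complex.exp (Complex.I * (rdotZ k x : ℂ)) *
      Complex.exp (-Complex.I * (rdotZ k y : ℂ)) =
        Complex.exp (Complex.I * (rdotZ k (x - y) : ℂ)) :=
    fun k => by
      rw [← Complex.exp_add, rdotZ_sub_right]; push_cast; ring_nf
  simp only [h]
  rw [integral_character]
  simp only [sub_eq_zero]
  split_ifs
  · exact inv_mul_cancel₀ (by exact_mod_cast (two_pi_pow_pos d).ne')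
  · simp

lemma fcoef_const_mul (c : ℂ) (Φ : (Fin d → ℝ) → ℂ) (x : Fin d → ℤ) :
    fcoef (fun k => c * Φ k) x = c * fcoef Φ x := by
  unfold fcoef
  simp only [mul_left_comm _ c]
  rw [integral_const_mul, mul_left_comm]

lemma fcoef_add {Φ Ψ : (Fin d → ℝ) → ℂ} (hΦ : IntegrableOn Φ (torus d))
    (hΨ : IntegrableOn Ψ (torus d)) (x : Fin d → ℤ) :
    fcoef (fun k => Φ k + Ψ k) x = fcoef Φ x + fcoef Ψ x := by
  unfold fcoef
  simp only [mul_add]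
  rw [integral_add (integrable_character_mul hΦ x) (integrable_character_mul hΨ x), mul_add]

lemma hasSum_fcoef {ι : Type*} [Countable ι] {Φ : ι → (Fin d → ℝ) → ℂ} {u : ι → ℝ}
    (hΦ : ∀ j, IntegrableOn (Φ j) (torus d)) (hu : Summable u)
    (hle : ∀ j, ∫ k in torus d, ‖Φ j k‖ ≤ u j) (x : Fin d → ℤ) :
    HasSum (fun j => fcoef (Φ j) x) (fcoef (fun k => ∑' j, Φ j k) x) := by
  have h := hasSum_integral_of_summable_integral_norm
    (fun j => integrable_character_mul (hΦ j) x) (by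
      simp only [norm_mul, norm_character_pos, one_mul]
      exact Summable.of_nonneg_of_le (fun j => integral_nonneg fun _ => norm_nonneg _) hle hu)
  simp only [tsum_mul_left] at h
  exact h.mul_left _

lemma hasSum_fcoef_fourierZ_mul {b : (Fin d → ℤ) → ℝ} (hb : Summable fun y => |b y|)
    {Φ : (Fin d → ℝ) → ℂ} (hΦ : IntegrableOn Φ (torus d)) (x : Fin d → ℤ) :
    HasSum (fun y => (b y : ℂ) * fcoef Φ (x - y)) (fcoef (fun k => fourierZ b k * Φ k) x) := by
  have hint : ∀ y, IntegrableOn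
      (fun k => (b y : ℂ) * Complex.exp (-Complex.I * (rdotZ k y : ℂ)) * Φ k) (torus d) := fun y =>
    Integrable.bdd_mul (c := |b y|) hΦ
      (by have := continuous_rdotZ_left y; fun_prop)
      (Eventually.of_forall fun k => (norm_fourierZ_term b k y).le)
  have h := hasSum_fcoef (u := fun y => |b y| * ∫ k in torus d, ‖Φ k‖) hint
    (hb.mul_right _) (fun y => by
      simp only [norm_mul _ (Φ _), norm_fourierZ_term]
      rw [integral_const_mul]) x
  simp only [tsum_mul_right] at h
  refine h.congr_fun fun y => ?_
  simp only [mul_assoc]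
  rw [fcoef_const_mul]
  congr 1
  unfold fcoef
  congr 2
  funext k
  rw [← mul_assoc, ← Complex.exp_add, rdotZ_sub_right]
  push_cast
  ring_nf

lemma fcoef_fourierZ {f : (Fin d → ℤ) → ℝ} (hf : Summable fun y => |f y|) (x : Fin d → ℤ) :
    fcoef (fourierZ f) x = f x := by
  have h := hasSum_fcoef_fourierZ_mul hf (Φ := fun _ => 1) (integrable_const _) x
  simp only [mul_one] at h
  refine h.unique ?_
  have h1 : ∀ y : Fin d → ℤ, fcoef (fun _ => (1 : ℂ)) y = if y = 0 then 1 else 0 := fun y => by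
    have := fcoef_character y 0
    simpa [rdotZ] using this
  simp only [h1, sub_eq_zero]
  convert hasSum_ite_eq x ((f x : ℂ)) using 2 with y
  split_ifs with h2 h3 h3
  · rw [h2, mul_one]
  · exact absurd h2.symm h3
  · exact absurd h3.symm h2
  · simp

lemma integral_mul_conj_trigPoly {Ψ : (Fin d → ℝ) → ℂ} (hΨ : IntegrableOn Ψ (torus d))
    (s : Finset (Fin d → ℤ)) (c : (Fin d → ℤ) → ℂ) :
    ∫ k in torus d, Ψ k *
        (starRingEnd ℂ) (∑ y ∈ s, c y * Complex.exp (-Complex.I * (rdotZ k y : ℂ)))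
      = (((2 * π) ^ d : ℝ) : ℂ) * ∑ y ∈ s, (starRingEnd ℂ) (c y) * fcoef Ψ y := by
  have h : ∀ k : Fin d → ℝ, Ψ k *
        (starRingEnd ℂ) (∑ y ∈ s, c y * Complex.exp (-Complex.I * (rdotZ k y : ℂ)))
      = ∑ y ∈ s, (starRingEnd ℂ) (c y) * (Complex.exp (Complex.I * (rdotZ k y : ℂ)) * Ψ k) :=
    fun k => by
      rw [map_sum, Finset.mul_sum]
      refine Finset.sum_congr rfl fun y _ => ?_
      rw [map_mul, ← Complex.exp_conj]
      simp only [map_mul, map_neg, Complex.conj_I, Complex.conj_ofReal, neg_neg]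
      ring
  simp only [h]
  rw [integral_finsetSum _ fun y _ => (integrable_character_mul hΨ y).const_mul _, Finset.mul_sum]
  refine Finset.sum_congr rfl fun y _ => ?_
  rw [integral_const_mul, fcoef, mul_left_comm (((2 * π) ^ d : ℝ) : ℂ), mul_inv_cancel_left₀]
  exact_mod_cast (two_pi_pow_pos d).ne'

/-- Bessel's inequality on the torus. -/
lemma sum_sq_norm_fcoef_le {Φ : (Fin d → ℝ) → ℂ}
    (hm : AEStronglyMeasurable Φ (volume.restrict (torus d))) {C : ℝ} (hC : ∀ k, ‖Φ k‖ ≤ C)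
    (s : Finset (Fin d → ℤ)) :
    ∑ y ∈ s, ‖fcoef Φ y‖ ^ 2 ≤ ((2 * π) ^ d)⁻¹ * ∫ k in torus d, ‖Φ k‖ ^ 2 := by
  set c := fcoef Φ with hc
  set T : (Fin d → ℝ) → ℂ := fun k =>
    ∑ y ∈ s, c y * Complex.exp (-Complex.I * (rdotZ k y : ℂ)) with hT
  have hTc : Continuous T := by
    refine continuous_finsetSum _ fun y _ => ?_
    have := continuous_rdotZ_left y
    fun_prop
  have hΦi : IntegrableOn Φ (torus d) := Integrable.of_bound hm C (Eventually.of_forall hC)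
  have hTi : IntegrableOn T (torus d) := hTc.continuousOn.integrableOn_compact (isCompact_torus d)
  have hTy : ∀ y ∈ s, fcoef T y = c y := fun y hy => by
    have : fcoef T y =
        ∑ j ∈ s, fcoef (fun k => c j * Complex.exp (-Complex.I * (rdotZ k j : ℂ))) y := by
      simp only [fcoef, hT, Finset.mul_sum]
      rw [integral_finsetSum, Finset.mul_sum]
      intro j _
      refine (integrable_character_mul ?_ y)
      refine ContinuousOn.integrableOn_compact (isCompact_torus d) (Continuous.continuousOn ?_)
      have := continuous_rdotZ_left j
      fun_prop
    rw [this]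
    simp only [fcoef_const_mul, fcoef_character]
    simp [hy]
  have h1 := integral_mul_conj_trigPoly hΦi s c
  have h2 := integral_mul_conj_trigPoly hTi s c
  have h3 : ∑ y ∈ s, (starRingEnd ℂ) (c y) * fcoef T y = ((∑ y ∈ s, ‖c y‖ ^ 2 : ℝ) : ℂ) := by
    rw [Complex.ofReal_sum]
    refine Finset.sum_congr rfl fun y hy => ?_
    rw [hTy y hy, Complex.conj_mul']
    push_cast; rfl
  have h4 : ∑ y ∈ s, (starRingEnd ℂ) (c y) * fcoef Φ y = ((∑ y ∈ s, ‖c y‖ ^ 2 : ℝ) : ℂ) := by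
    rw [Complex.ofReal_sum]
    refine Finset.sum_congr rfl fun y hy => ?_
    rw [← hc, Complex.conj_mul']
    push_cast; rfl
  rw [h3] at h2
  rw [h4] at h1
  change ∫ k in torus d, Φ k * (starRingEnd ℂ) (T k) = _ at h1
  change ∫ k in torus d, T k * (starRingEnd ℂ) (T k) = _ at h2
  have hTb : ∃ B, ∀ k ∈ torus d, ‖T k‖ ≤ B :=
    (isCompact_torus d).exists_bound_of_continuousOn hTc.continuousOn
  have hi1 : IntegrableOn (fun k => Φ k * (starRingEnd ℂ) (T k)) (torus d) := by
    obtain ⟨B, hB⟩ := hTb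
    refine Integrable.mul_bdd (c := B) hΦi (by fun_prop) ?_
    filter_upwards [ae_restrict_mem (measurableSet_torus d)] with k hk
    simpa using hB k hk
  have hi2 : IntegrableOn (fun k => T k * (starRingEnd ℂ) (T k)) (torus d) :=
    (show Continuous fun k => T k * (starRingEnd ℂ) (T k) by fun_prop).continuousOn
      |>.integrableOn_compact (isCompact_torus d)
  have hi0 : IntegrableOn (fun k => ‖Φ k‖ ^ 2) (torus d) := by
    refine Integrable.of_bound (hm.norm.pow 2) (C ^ 2) (Eventually.of_forall fun k => ?_)
    rw [Real.norm_of_nonneg (by positivity)]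
    exact pow_le_pow_left₀ (norm_nonneg _) (hC k) 2
  have hpt : ∀ k, 2 * (Φ k * (starRingEnd ℂ) (T k)).re - (T k * (starRingEnd ℂ) (T k)).re
      ≤ ‖Φ k‖ ^ 2 := fun k => by
    have := sq_nonneg ‖Φ k - T k‖
    rw [← Complex.normSq_eq_norm_sq, Complex.normSq_sub] at this
    rw [← Complex.normSq_eq_norm_sq, Complex.mul_conj (T k), Complex.ofReal_re]
    linarith
  have hr1 : IntegrableOn (fun k => 2 * (Φ k * (starRingEnd ℂ) (T k)).re) (torus d) :=
    hi1.re.const_mul 2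
  have hr2 : IntegrableOn (fun k => (T k * (starRingEnd ℂ) (T k)).re) (torus d) := hi2.re
  have hmono := integral_mono (μ := volume.restrict (torus d)) (hr1.sub hr2) hi0 hpt
  have e1 := integral_re hi1
  have e2 := integral_re hi2
  simp only [RCLike.re_to_complex] at e1 e2
  simp only [Pi.sub_apply] at hmono
  rw [integral_sub hr1 hr2, integral_const_mul, e1, e2, h1, h2, ← Complex.ofReal_mul,
    Complex.ofReal_re] at hmono
  rw [inv_mul_eq_div, le_div_iff₀ (two_pi_pow_pos d)]
  linarith

end Coefficients

section WeightedBounds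

/-- The normalised Gaussian integral `(2π)^{-d} ∫ e^{-a‖k‖²} dk` over the torus. -/
def gaussAvg (d : ℕ) (a : ℝ) : ℝ :=
  ((2 * π) ^ d)⁻¹ * ∫ k in torus d, Real.exp (-a * enormR k ^ 2)

lemma continuous_gauss (a : ℝ) : Continuous fun k : Fin d → ℝ => Real.exp (-a * enormR k ^ 2) := by
  have := continuous_enormR (d := d)
  fun_prop

lemma integrableOn_gauss (a : ℝ) :
    IntegrableOn (fun k : Fin d → ℝ => Real.exp (-a * enormR k ^ 2)) (torus d) :=
  (continuous_gauss a).continuousOn.integrableOn_compact (isCompact_torus d)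

lemma gauss_le_one {a : ℝ} (ha : 0 ≤ a) (k : Fin d → ℝ) : Real.exp (-a * enormR k ^ 2) ≤ 1 :=
  Real.exp_le_one_iff.2 (by nlinarith [sq_nonneg (enormR k)])

lemma gaussAvg_nonneg (d : ℕ) (a : ℝ) : 0 ≤ gaussAvg d a :=
  mul_nonneg (inv_nonneg.2 (two_pi_pow_pos d).le) (integral_nonneg fun _ => (Real.exp_pos _).le)

lemma gaussAvg_le_one {a : ℝ} (ha : 0 ≤ a) : gaussAvg d a ≤ 1 := by
  rw [gaussAvg, inv_mul_le_iff₀ (two_pi_pow_pos d), mul_one, ← integral_torus_one d]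
  exact integral_mono (integrableOn_gauss a) (integrable_const _) fun k => gauss_le_one ha k

lemma gauss_eq_prod (a : ℝ) (k : Fin d → ℝ) :
    Real.exp (-a * enormR k ^ 2) = ∏ i, Real.exp (-a * k i ^ 2) := by
  rw [← Real.exp_sum, enormR_sq, Finset.mul_sum]

lemma integrable_gauss {a : ℝ} (ha : 0 < a) :
    Integrable fun k : Fin d → ℝ => Real.exp (-a * enormR k ^ 2) := by
  simp only [gauss_eq_prod]
  exact Integrable.fintype_prod fun _ => integrable_exp_neg_mul_sq ha

lemma integral_gauss {a : ℝ} :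
    ∫ k : Fin d → ℝ, Real.exp (-a * enormR k ^ 2) = √(π / a) ^ d := by
  simp only [gauss_eq_prod]
  rw [integral_fintype_prod_volume_eq_pow (fun t : ℝ => Real.exp (-a * t ^ 2)), integral_gaussian,
    Fintype.card_fin]

lemma gaussAvg_le {a : ℝ} (ha : 0 < a) : gaussAvg d a ≤ a ^ (-((d : ℝ) / 2)) := by
  have h1 : ∫ k in torus d, Real.exp (-a * enormR k ^ 2) ≤ √(π / a) ^ d := by
    rw [← integral_gauss]
    exact setIntegral_le_integral (integrable_gauss ha)
      (Eventually.of_forall fun k => (Real.exp_pos _).le)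
  have h2 : √(π / a) ≤ 2 * π * a ^ (-(1 / 2 : ℝ)) := by
    rw [Real.sqrt_div' _ ha.le, Real.rpow_neg ha.le, ← Real.sqrt_eq_rpow, div_eq_mul_inv]
    gcongr
    rw [Real.sqrt_le_left (by positivity)]
    nlinarith [Real.pi_gt_three]
  have h3 : a ^ (-((d : ℝ) / 2)) = (a ^ (-(1 / 2 : ℝ))) ^ d := by
    rw [← Real.rpow_natCast, ← Real.rpow_mul ha.le]
    congr 1
    ring
  rw [gaussAvg, inv_mul_le_iff₀ (two_pi_pow_pos d), h3, ← mul_pow]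
  exact h1.trans (pow_le_pow_left₀ (Real.sqrt_nonneg _) h2 d)

lemma gaussAvg_le_rpow {a e : ℝ} (ha : 0 < a) (he0 : 0 ≤ e) (he : e ≤ d / 2) :
    gaussAvg d a ≤ a ^ (-e) := by
  rcases le_total 1 a with h | h
  · exact (gaussAvg_le ha).trans (Real.rpow_le_rpow_of_exponent_le h (neg_le_neg he))
  · exact (gaussAvg_le_one ha.le).trans
      (Real.one_le_rpow_of_pos_of_le_one_of_nonpos ha h (neg_nonpos.2 he0))

lemma norm_fcoef_le_gaussAvg {Φ : (Fin d → ℝ) → ℂ} {C a : ℝ}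
    (hle : ∀ k ∈ torus d, ‖Φ k‖ ≤ C * Real.exp (-a * enormR k ^ 2)) (x : Fin d → ℤ) :
    ‖fcoef Φ x‖ ≤ C * gaussAvg d a := by
  refine (norm_fcoef_le Φ x).trans ?_
  rw [gaussAvg, mul_left_comm]
  have := two_pi_pow_pos d
  gcongr
  rw [← integral_const_mul]
  refine integral_mono_of_nonneg (Eventually.of_forall fun k => norm_nonneg _)
    ((integrableOn_gauss a).const_mul C) ?_
  filter_upwards [ae_restrict_mem (measurableSet_torus d)] with k hk using hle k hk

lemma sum_sq_norm_fcoef_le_gaussAvg {Φ : (Fin d → ℝ) → ℂ}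
    (hm : AEStronglyMeasurable Φ (volume.restrict (torus d))) {C a : ℝ} (hC : 0 ≤ C) (ha : 0 ≤ a)
    (hle : ∀ k ∈ torus d, ‖Φ k‖ ≤ C * Real.exp (-a * enormR k ^ 2)) (s : Finset (Fin d → ℤ)) :
    ∑ y ∈ s, ‖fcoef Φ y‖ ^ 2 ≤ C ^ 2 * gaussAvg d a := by
  have hind : ∀ y, fcoef ((torus d).indicator Φ) y = fcoef Φ y := fun y => by
    unfold fcoef
    congr 1
    refine setIntegral_congr_fun (measurableSet_torus d) fun k hk => ?_
    simp only [Set.indicator_of_mem hk]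
  have h := sum_sq_norm_fcoef_le (Φ := (torus d).indicator Φ) (C := C) ?_ ?_ s
  · simp only [hind] at h
    refine h.trans ?_
    rw [gaussAvg, mul_left_comm]
    have := two_pi_pow_pos d
    gcongr
    rw [← integral_const_mul]
    refine integral_mono_of_nonneg (Eventually.of_forall fun k => sq_nonneg _)
      ((integrableOn_gauss a).const_mul _) ?_
    filter_upwards [ae_restrict_mem (measurableSet_torus d)] with k hk
    simp only [Set.indicator_of_mem hk]
    refine (pow_le_pow_left₀ (norm_nonneg _) (hle k hk) 2).trans ?_
    rw [mul_pow]
    gcongr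
    have := gauss_le_one ha k
    have := Real.exp_pos (-a * enormR k ^ 2)
    nlinarith
  · rw [aestronglyMeasurable_indicator_iff (measurableSet_torus d),
      Measure.restrict_restrict (measurableSet_torus d), Set.inter_self]
    exact hm
  · intro k
    by_cases hk : k ∈ torus d
    · rw [Set.indicator_of_mem hk]
      exact (hle k hk).trans (mul_le_of_le_one_right hC (gauss_le_one ha k))
    · rw [Set.indicator_of_notMem hk, norm_zero]
      exact hC

/-- A Hölder bound for the Fourier coefficients of `b̂ Φ`, for `b ∈ ℓ^p` with `1 ≤ p ≤ 2` and `Φ`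
dominated by a Gaussian. -/
lemma norm_fcoef_fourierZ_mul_le {b : (Fin d → ℤ) → ℝ} (hb : Summable fun y => |b y|)
    {p B : ℝ} (hp1 : 1 ≤ p) (hp2 : p ≤ 2) (hB : 0 ≤ B) (hbp : Summable fun y => |b y| ^ p)
    (hbB : ∑' y, |b y| ^ p ≤ B ^ p) {Φ : (Fin d → ℝ) → ℂ}
    (hm : AEStronglyMeasurable Φ (volume.restrict (torus d))) {C a : ℝ} (hC : 0 ≤ C) (ha : 0 ≤ a)
    (hle : ∀ k ∈ torus d, ‖Φ k‖ ≤ C * Real.exp (-a * enormR k ^ 2)) (x : Fin d → ℤ) :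
    ‖fcoef (fun k => fourierZ b k * Φ k) x‖ ≤ B * (C * gaussAvg d a ^ (1 / p)) := by
  have hG := gaussAvg_nonneg d a
  set G := gaussAvg d a with hGdef
  have hΦi : IntegrableOn Φ (torus d) :=
    Integrable.mono' ((integrableOn_gauss a).const_mul C) hm (by
      filter_upwards [ae_restrict_mem (measurableSet_torus d)] with k hk using hle k hk)
  have hsum := hasSum_fcoef_fourierZ_mul hb hΦi x
  have hc : ∀ y, ‖fcoef Φ y‖ ≤ C * G := norm_fcoef_le_gaussAvg hle
  have hbound : ∀ y, ‖(b y : ℂ) * fcoef Φ (x - y)‖ = |b y| * ‖fcoef Φ (x - y)‖ := fun y => by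
    rw [norm_mul, Complex.norm_real, Real.norm_eq_abs]
  have habs : Summable fun y => |b y| * ‖fcoef Φ (x - y)‖ :=
    Summable.of_nonneg_of_le (fun y => by positivity)
      (fun y => mul_le_mul_of_nonneg_left (hc _) (abs_nonneg _)) (hb.mul_right (C * G))
  have h1 : ‖fcoef (fun k => fourierZ b k * Φ k) x‖ ≤ ∑' y, |b y| * ‖fcoef Φ (x - y)‖ := by
    rw [← hsum.tsum_eq]
    refine (norm_tsum_le_tsum_norm ?_).trans_eq ?_
    · simpa only [hbound] using habs
    · simp only [hbound]
  refine h1.trans ?_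
  rcases hp1.eq_or_lt with rfl | hp
  · simp only [Real.rpow_one, div_one] at hbB ⊢
    calc ∑' y, |b y| * ‖fcoef Φ (x - y)‖ ≤ ∑' y, |b y| * (C * G) :=
          habs.tsum_le_tsum (fun y => mul_le_mul_of_nonneg_left (hc _) (abs_nonneg _))
            (hb.mul_right _)
      _ = (∑' y, |b y|) * (C * G) := tsum_mul_right
      _ ≤ B * (C * G) := by gcongr
  · set q := p / (p - 1) with hq
    have hpq : p.HolderConjugate q := Real.HolderConjugate.conjExponent hp
    have hq2 : 2 ≤ q := by rw [hq, le_div_iff₀ (by linarith)]; linarith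
    set D := (C * G) ^ (q - 2) * (C ^ 2 * G) with hD
    have hfin : ∀ s : Finset (Fin d → ℤ), ∑ y ∈ s, ‖fcoef Φ (x - y)‖ ^ q ≤ D := fun s => by
      have h2 : ∀ y, ‖fcoef Φ (x - y)‖ ^ q
          ≤ (C * G) ^ (q - 2) * ‖fcoef Φ (x - y)‖ ^ 2 := fun y => by
        have : ‖fcoef Φ (x - y)‖ ^ q = ‖fcoef Φ (x - y)‖ ^ (q - 2) * ‖fcoef Φ (x - y)‖ ^ 2 := by
          rw [← Real.rpow_natCast ‖fcoef Φ (x - y)‖ 2,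
            ← Real.rpow_add_of_nonneg (norm_nonneg _) (by linarith) (by norm_num)]
          congr 1
          push_cast
          ring
        rw [this]
        refine mul_le_mul_of_nonneg_right ?_ (by positivity)
        exact Real.rpow_le_rpow (norm_nonneg _) (hc _) (by linarith)
      refine (Finset.sum_le_sum fun y _ => h2 y).trans ?_
      rw [← Finset.mul_sum, hD]
      gcongr
      have h3 := sum_sq_norm_fcoef_le_gaussAvg hm hC ha hle (s.map (Equiv.subLeft x).toEmbedding)
      rw [Finset.sum_map] at h3
      simpa using h3
    have hnn : ∀ y, 0 ≤ ‖fcoef Φ (x - y)‖ ^ q := fun y => by positivity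
    have hs := summable_of_sum_le hnn hfin
    have hH := Real.inner_le_Lp_mul_Lq_tsum_of_nonneg hpq (fun y => abs_nonneg (b y))
      (fun y => norm_nonneg (fcoef Φ (x - y))) hbp hs
    refine hH.trans ?_
    have hp0 : 0 < p := by linarith
    have hq0 : 0 < q := by linarith
    have e1 : (∑' y, |b y| ^ p) ^ (1 / p) ≤ B := by
      calc (∑' y, |b y| ^ p) ^ (1 / p) ≤ (B ^ p) ^ (1 / p) := by
            refine Real.rpow_le_rpow (tsum_nonneg fun y => by positivity) hbB (by positivity)
        _ = B := by rw [← Real.rpow_mul hB, mul_one_div_cancel hp0.ne', Real.rpow_one]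
    have e2 : (∑' y, ‖fcoef Φ (x - y)‖ ^ q) ^ (1 / q) ≤ C * G ^ (1 / p) := by
      calc (∑' y, ‖fcoef Φ (x - y)‖ ^ q) ^ (1 / q) ≤ D ^ (1 / q) :=
            Real.rpow_le_rpow (tsum_nonneg hnn) (Real.tsum_le_of_sum_le hnn hfin) (by positivity)
        _ = (C ^ q * G ^ (q - 1)) ^ (1 / q) := by
            congr 1
            rw [hD, Real.mul_rpow hC hG, mul_mul_mul_comm, ← Real.rpow_natCast C 2,
              ← Real.rpow_add_of_nonneg hC (by linarith) (by norm_num)]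
            congr 1
            · congr 1; push_cast; ring
            · nth_rewrite 2 [← Real.rpow_one G]
              rw [← Real.rpow_add_of_nonneg hG (by linarith) (by norm_num)]
              congr 1; ring
        _ = C * G ^ (1 / p) := by
            rw [Real.mul_rpow (by positivity) (by positivity), ← Real.rpow_mul hC,
              mul_one_div_cancel hq0.ne', Real.rpow_one, ← Real.rpow_mul hG]
            congr 2
            have := hpq.inv_add_inv_eq_one
            field_simp at this ⊢
            linarith
    exact mul_le_mul e1 e2 (Real.rpow_nonneg (tsum_nonneg hnn) _) hB

end WeightedBounds

section Tilting

/-- The iterated convolution `f * (f * ⋯ (f * g))`. -/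
def convIter (f g : (Fin d → ℤ) → ℝ) : ℕ → (Fin d → ℤ) → ℝ
  | 0 => g
  | n + 1 => conv f (convIter f g n)

variable {f g : (Fin d → ℤ) → ℝ}

lemma summable_abs_convIter (hf : Summable fun y => |f y|) (hg : Summable fun y => |g y|) (n : ℕ) :
    Summable fun y => |convIter f g n y| := by
  induction n with
  | zero => exact hg
  | succ n ih => exact summable_abs_conv hf ih

lemma fourierZ_convIter (hf : Summable fun y => |f y|) (hg : Summable fun y => |g y|) (n : ℕ)
    (k : Fin d → ℝ) : fourierZ (convIter f g n) k = fourierZ g k * fourierZ f k ^ n := by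
  induction n with
  | zero => simp [convIter]
  | succ n ih =>
    rw [convIter, fourierZ_conv hf (summable_abs_convIter hf hg n), ih]
    ring

lemma tilt_convIter (f g : (Fin d → ℤ) → ℝ) (μ : Fin d → ℝ) (n : ℕ) :
    tilt (convIter f g n) μ = convIter (tilt f μ) (tilt g μ) n := by
  induction n with
  | zero => rfl
  | succ n ih => rw [convIter, tilt_conv, ih, convIter]

lemma hasSum_fcoef_mul_exp (hf : Summable fun y => |f y|) (hg : Summable fun y => |g y|)
    (x : Fin d → ℤ) :
    HasSum (fun n : ℕ => (((n.factorial : ℝ)⁻¹ * convIter f g n x : ℝ) : ℂ))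
      (fcoef (fun k => fourierZ g k * Complex.exp (fourierZ f k)) x) := by
  have hfc := continuous_fourierZ hf
  have hgc := continuous_fourierZ hg
  have h := hasSum_fcoef (Φ := fun (n : ℕ) k =>
      ((n.factorial : ℂ)⁻¹ * fourierZ (convIter f g n) k))
    (u := fun n => (2 * π) ^ d * (∑' y, |g y|) * ((∑' y, |f y|) ^ n / n.factorial)) (fun n =>
      (Continuous.continuousOn
        ((continuous_fourierZ (summable_abs_convIter hf hg n)).const_mul _)).integrableOn_compact
        (isCompact_torus d))
    ((Real.summable_pow_div_factorial _).mul_left _) (fun n => by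
      have hle : ∀ k : Fin d → ℝ, ‖((n.factorial : ℂ)⁻¹ * fourierZ (convIter f g n) k)‖
          ≤ (∑' y, |g y|) * ((∑' y, |f y|) ^ n / n.factorial) := fun k => by
        rw [fourierZ_convIter hf hg, norm_mul, norm_mul, norm_pow, norm_inv, Complex.norm_natCast]
        have h1 := norm_fourierZ_le hf k
        have h2 := norm_fourierZ_le hg k
        calc _ ≤ (n.factorial : ℝ)⁻¹ * ((∑' y, |g y|) * (∑' y, |f y|) ^ n) := by gcongr
          _ = _ := by ring
      calc _ ≤ ∫ _k in torus d, (∑' y, |g y|) * ((∑' y, |f y|) ^ n / n.factorial) * (1 : ℝ) := by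
            refine integral_mono ?_ (integrable_const _) fun k => by
              simpa using hle k
            exact (Continuous.continuousOn (((continuous_fourierZ
              (summable_abs_convIter hf hg n)).const_mul _).norm)).integrableOn_compact
              (isCompact_torus d)
        _ = _ := by rw [integral_const_mul, integral_torus_one]; ring) x
  have e : (fun k => fourierZ g k * Complex.exp (fourierZ f k))
      = fun k => ∑' n : ℕ, ((n.factorial : ℂ)⁻¹ * fourierZ (convIter f g n) k) := by
    funext k
    rw [Complex.exp_eq_exp_ℂ, NormedSpace.exp_eq_tsum_div, ← tsum_mul_left]
    refine tsum_congr fun n => ?_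
    rw [fourierZ_convIter hf hg]
    ring
  rw [e]
  refine h.congr_fun fun n => ?_
  rw [fcoef_const_mul, fcoef_fourierZ (summable_abs_convIter hf hg n)]
  push_cast
  rfl

lemma fcoef_mul_exp_tilt (hf : Summable fun y => |f y|) (hg : Summable fun y => |g y|)
    {μ : Fin d → ℝ} (hfμ : Summable fun y => |tilt f μ y|) (hgμ : Summable fun y => |tilt g μ y|)
    (x : Fin d → ℤ) :
    fcoef (fun k => fourierZ g k * Complex.exp (fourierZ f k)) x * (Real.exp (rdotZ μ x) : ℂ)
      = fcoef (fun k => fourierZ (tilt g μ) k * Complex.exp (fourierZ (tilt f μ) k)) x := by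
  refine ((hasSum_fcoef_mul_exp hf hg x).mul_right _).unique ?_
  refine (hasSum_fcoef_mul_exp hfμ hgμ x).congr_fun fun n => ?_
  rw [← tilt_convIter, tilt]
  push_cast
  ring

end Tilting

section KernelBounds

lemma summable_rpow_of_lpNorm_le {f : (Fin d → ℤ) → ℝ} {p M : ℝ} (hp : 0 < p) (hM : 0 ≤ M)
    (h : lpNorm f p ≤ ENNReal.ofReal M) :
    (Summable fun y => |f y| ^ p) ∧ ∑' y, |f y| ^ p ≤ M ^ p := by
  have h1 : ∑' y, ENNReal.ofReal (|f y| ^ p) ≤ ENNReal.ofReal (M ^ p) := by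
    rw [← ENNReal.ofReal_rpow_of_nonneg hM hp.le]
    rw [lpNorm, one_div] at h
    exact (ENNReal.rpow_inv_le_iff hp).1 h
  have h2 : Summable fun y => |f y| ^ p := by
    have := ENNReal.summable_toReal (ne_top_of_le_ne_top ENNReal.ofReal_ne_top h1)
    refine this.congr fun y => ENNReal.toReal_ofReal (by positivity)
  refine ⟨h2, ?_⟩
  rwa [← ENNReal.ofReal_tsum_of_nonneg (fun y => by positivity) h2,
    ENNReal.ofReal_le_ofReal_iff (by positivity)] at h1

lemma summable_abs_of_lpNorm_one_le {f : (Fin d → ℤ) → ℝ} {M : ℝ} (hM : 0 ≤ M)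
    (h : lpNorm f 1 ≤ ENNReal.ofReal M) : (Summable fun y => |f y|) ∧ ∑' y, |f y| ≤ M := by
  simpa using summable_rpow_of_lpNorm_le one_pos hM h

lemma summable_and_tsum_le_of_le {ι : Type*} {f g : ι → ℝ} {B : ℝ} (hf : ∀ i, 0 ≤ f i)
    (hfg : ∀ i, f i ≤ g i) (hg : Summable g ∧ ∑' i, g i ≤ B) : Summable f ∧ ∑' i, f i ≤ B := by
  have := Summable.of_nonneg_of_le hf hfg hg.1
  exact ⟨this, (this.tsum_le_tsum hfg hg.1).trans hg.2⟩

/-- Powers of the norm of a lattice point increase with a positive exponent. -/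
lemma enormZ_rpow_le_rpow {a b : ℝ} (ha : 0 < a) (hab : a ≤ b) (y : Fin d → ℤ) :
    enormZ y ^ a ≤ enormZ y ^ b := by
  by_cases hy : y = 0
  · subst hy
    simp [enormZ, Real.zero_rpow ha.ne', Real.zero_rpow (ha.trans_le hab).ne']
  · exact Real.rpow_le_rpow_of_exponent_le (one_le_enormZ hy) hab

lemma summable_sq_of_summable_rpow {f : (Fin d → ℤ) → ℝ} {p M : ℝ} (hp : 0 < p) (hp2 : p ≤ 2)
    (hM : 0 ≤ M) (h : (Summable fun y => |f y| ^ p) ∧ ∑' y, |f y| ^ p ≤ M ^ p) :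
    (Summable fun y => f y ^ 2) ∧ ∑' y, f y ^ 2 ≤ M ^ 2 := by
  have hle : ∀ y, |f y| ≤ M := fun y => by
    have h1 : |f y| ^ p ≤ M ^ p :=
      (h.1.le_tsum y fun j _ => by positivity).trans h.2
    exact (Real.rpow_le_rpow_iff (abs_nonneg _) hM hp).1 h1
  refine summable_and_tsum_le_of_le (g := fun y => M ^ (2 - p) * |f y| ^ p)
    (fun y => sq_nonneg _) (fun y => ?_) ⟨h.1.mul_left _, ?_⟩
  · rw [← sq_abs, ← Real.rpow_natCast |f y| 2,
      show ((2 : ℕ) : ℝ) = (2 - p) + p by push_cast; ring,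
      Real.rpow_add_of_nonneg (abs_nonneg _) (by linarith) hp.le]
    exact mul_le_mul_of_nonneg_right (Real.rpow_le_rpow (abs_nonneg _) (hle y) (by linarith))
      (by positivity)
  · rw [tsum_mul_left]
    calc M ^ (2 - p) * ∑' y, |f y| ^ p ≤ M ^ (2 - p) * M ^ p := by
          gcongr; exact h.2
      _ = M ^ 2 := by
          rw [← Real.rpow_natCast M 2, ← Real.rpow_add_of_nonneg hM (by linarith) hp.le]
          congr 1; push_cast; ring

/-- The consequences of membership in `𝒬_{M,K,ζ}` used below, with `θ ≤ ζ`. -/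
structure KernelBounds (M K θ : ℝ) (Q g : (Fin d → ℤ) → ℝ) : Prop where
  Q_one : (Summable fun y => |Q y|) ∧ ∑' y, |Q y| ≤ M
  Q_two : (Summable fun y => enormZ y ^ 2 * |Q y|) ∧ ∑' y, enormZ y ^ 2 * |Q y| ≤ M
  Q_theta : (Summable fun y => enormZ y ^ (2 + θ) * |Q y|) ∧ ∑' y, enormZ y ^ (2 + θ) * |Q y| ≤ M
  infrared : ∀ k ∈ torus d, K * enormR k ^ 2 ≤ (fourierZ Q 0 - fourierZ Q k).re
  g_one : (Summable fun y => |g y|) ∧ ∑' y, |g y| ≤ M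
  g_theta : (Summable fun y => enormZ y ^ θ * |g y|) ∧ ∑' y, enormZ y ^ θ * |g y| ≤ M
  g_sq : 2 ≤ d → (Summable fun y => (enormZ y ^ (d - 1) * g y) ^ 2) ∧
    ∑' y, (enormZ y ^ (d - 1) * g y) ^ 2 ≤ M ^ 2
  Q_pow : 3 ≤ d → (Summable fun y => (enormZ y ^ (d - 1) * |Q y|) ^ (min ((d : ℝ) / 3) 2)) ∧
    ∑' y, (enormZ y ^ (d - 1) * |Q y|) ^ (min ((d : ℝ) / 3) 2) ≤ M ^ (min ((d : ℝ) / 3) 2)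

lemma enormZ_rpow_natCast_sub_one (hd : 1 ≤ d) (y : Fin d → ℤ) :
    enormZ y ^ ((d : ℝ) - 1) = enormZ y ^ (d - 1) := by
  rw [← Real.rpow_natCast, Nat.cast_sub hd, Nat.cast_one]

lemma pow_le_sq_of_le_two {y : Fin d → ℤ} {n : ℕ} (hn : n ≠ 0) (hn2 : n ≤ 2) :
    enormZ y ^ n ≤ enormZ y ^ 2 := by
  by_cases hy : y = 0
  · subst hy
    simp [enormZ, hn]
  · exact pow_le_pow_right₀ (one_le_enormZ hy) hn2

lemma MemQ.kernelBounds {M K ζ θ : ℝ} {Q g : (Fin d → ℤ) → ℝ} (hd : 1 ≤ d) (hM : 0 ≤ M)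
    (hθ : 0 < θ) (hθζ : θ ≤ ζ) (hQ : MemQ M K ζ Q g) : KernelBounds M K θ Q g := by
  have habs : ∀ (e : ℝ) (f : (Fin d → ℤ) → ℝ) y, |enormZ y ^ e * f y| = enormZ y ^ e * |f y| :=
    fun e f y => by rw [abs_mul, abs_of_nonneg (Real.rpow_nonneg (enormZ_nonneg y) e)]
  have hQm := summable_abs_of_lpNorm_one_le hM hQ.Q_moment
  have hgm := summable_abs_of_lpNorm_one_le hM hQ.g_zeta
  simp only [habs] at hQm hgm
  have hQ2 : (Summable fun y => enormZ y ^ 2 * |Q y|) ∧ ∑' y, enormZ y ^ 2 * |Q y| ≤ M := by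
    refine summable_and_tsum_le_of_le
      (fun y => mul_nonneg (sq_nonneg _) (abs_nonneg _)) (fun y => ?_) hQm
    rw [← Real.rpow_natCast]
    exact mul_le_mul_of_nonneg_right
      (enormZ_rpow_le_rpow (by norm_num) (by push_cast; linarith) y) (abs_nonneg _)
  refine ⟨summable_abs_of_lpNorm_one_le hM hQ.Q_l1, hQ2, ?_,
    fun k hk => hQ.infrared k (mem_torus_iff.1 hk), summable_abs_of_lpNorm_one_le hM hQ.g_l1,
    ?_, fun hd2 => ?_, fun hd3 => ?_⟩
  · refine summable_and_tsum_le_of_le (fun y => mul_nonneg (Real.rpow_nonneg (enormZ_nonneg y) _)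
      (abs_nonneg _)) (fun y => ?_) hQm
    exact mul_le_mul_of_nonneg_right
      (enormZ_rpow_le_rpow (by linarith) (by linarith) y) (abs_nonneg _)
  · refine summable_and_tsum_le_of_le (fun y => mul_nonneg (Real.rpow_nonneg (enormZ_nonneg y) _)
      (abs_nonneg _)) (fun y => ?_) hgm
    exact mul_le_mul_of_nonneg_right (enormZ_rpow_le_rpow hθ hθζ y) (abs_nonneg _)
  · by_cases hd4 : 4 ≤ d
    · have := summable_rpow_of_lpNorm_le two_pos hM (hQ.g_dm1 hd4)
      simpa only [enormZ_rpow_natCast_sub_one hd, Real.rpow_ofNat, sq_abs] using this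
    · have hmin : 0 < min ζ 2 := lt_min (hθ.trans_le hθζ) two_pos
      have hp : 0 < pExp d ζ := by
        have : (2 : ℝ) ≤ d := by exact_mod_cast hd2
        rw [pExp, if_neg (by omega)]
        refine div_pos (by linarith) (by linarith)
      have h := summable_sq_of_summable_rpow (lt_min hp two_pos) (min_le_right _ _) hM
        (summable_rpow_of_lpNorm_le (lt_min hp two_pos) hM hQ.g_two)
      refine summable_and_tsum_le_of_le (fun y => sq_nonneg _) (fun y => ?_) h
      rw [mul_pow, mul_pow, Real.rpow_ofNat]
      refine mul_le_mul_of_nonneg_right ?_ (sq_nonneg _)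
      exact pow_le_pow_left₀ (pow_nonneg (enormZ_nonneg y) _)
        (pow_le_sq_of_le_two (by omega) (by omega)) 2
  · by_cases hd4 : 4 ≤ d
    · have hp : 0 < min ((d : ℝ) / 3) 2 := lt_min (by positivity) two_pos
      have := summable_rpow_of_lpNorm_le hp hM (hQ.Q_dm1 hd4)
      simpa only [enormZ_rpow_natCast_sub_one hd, abs_mul, abs_pow,
        abs_of_nonneg (enormZ_nonneg _)] using this
    · obtain rfl : d = 3 := by omega
      have : min (((3 : ℕ) : ℝ) / 3) 2 = 1 := by norm_num
      simpa only [this, Real.rpow_one] using hQ2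

end KernelBounds

section Truncation

/-- The part of `f` supported in the ball of radius `R`. -/
def headPart (R : ℝ) (f : (Fin d → ℤ) → ℝ) (y : Fin d → ℤ) : ℝ := if enormZ y ≤ R then f y else 0

/-- The part of `f` supported outside the ball of radius `R`. -/
def tailPart (R : ℝ) (f : (Fin d → ℤ) → ℝ) (y : Fin d → ℤ) : ℝ := if enormZ y ≤ R then 0 else f y

lemma headPart_add_tailPart (R : ℝ) (f : (Fin d → ℤ) → ℝ) (y : Fin d → ℤ) :
    headPart R f y + tailPart R f y = f y := by
  unfold headPart tailPart; split_ifs <;> simp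

lemma abs_headPart_le (R : ℝ) (f : (Fin d → ℤ) → ℝ) (y : Fin d → ℤ) :
    |headPart R f y| ≤ |f y| := by
  unfold headPart; split_ifs <;> simp

lemma abs_tailPart_le (R : ℝ) (f : (Fin d → ℤ) → ℝ) (y : Fin d → ℤ) :
    |tailPart R f y| ≤ |f y| := by
  unfold tailPart; split_ifs <;> simp

lemma headPart_neg {R : ℝ} {f : (Fin d → ℤ) → ℝ} (hf : ∀ y, f (-y) = f y) (y : Fin d → ℤ) :
    headPart R f (-y) = headPart R f y := by
  simp [headPart, enormZ_neg, hf]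

lemma summable_abs_headPart {f : (Fin d → ℤ) → ℝ} (hf : Summable fun y => |f y|) (R : ℝ) :
    Summable fun y => |headPart R f y| :=
  Summable.of_nonneg_of_le (fun _ => abs_nonneg _) (abs_headPart_le R f) hf

lemma summable_abs_tailPart {f : (Fin d → ℤ) → ℝ} (hf : Summable fun y => |f y|) (R : ℝ) :
    Summable fun y => |tailPart R f y| :=
  Summable.of_nonneg_of_le (fun _ => abs_nonneg _) (abs_tailPart_le R f) hf

lemma fourierZ_headPart_add_tailPart {f : (Fin d → ℤ) → ℝ} (hf : Summable fun y => |f y|) (R : ℝ)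
    (k : Fin d → ℝ) :
    fourierZ (headPart R f) k + fourierZ (tailPart R f) k = fourierZ f k := by
  rw [← fourierZ_add (summable_abs_headPart hf R) (summable_abs_tailPart hf R)]
  simp only [headPart_add_tailPart]

/-- Chebyshev's inequality for weighted `ℓ^p` norms. -/
lemma tailPart_rpow_le {f : (Fin d → ℤ) → ℝ} {R p M : ℝ} {m : ℕ} (hR : 0 < R) (hp : 0 < p)
    (hM : 0 ≤ M)
    (h : (Summable fun y => (enormZ y ^ m * |f y|) ^ p) ∧
      ∑' y, (enormZ y ^ m * |f y|) ^ p ≤ M ^ p) :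
    (Summable fun y => |tailPart R f y| ^ p) ∧ ∑' y, |tailPart R f y| ^ p ≤ (M / R ^ m) ^ p := by
  have hRm : 0 < (R ^ m) ^ p := Real.rpow_pos_of_pos (pow_pos hR m) p
  refine summable_and_tsum_le_of_le (g := fun y => (enormZ y ^ m * |f y|) ^ p / (R ^ m) ^ p)
    (fun y => by positivity) (fun y => ?_) ⟨h.1.div_const _, ?_⟩
  · have hy := enormZ_nonneg y
    rw [le_div_iff₀ hRm, ← Real.mul_rpow (abs_nonneg _) (by positivity)]
    refine Real.rpow_le_rpow (by positivity) ?_ hp.le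
    unfold tailPart
    split_ifs with hle
    · simpa using by positivity
    · rw [mul_comm]
      gcongr
      exact (not_le.1 hle).le
  · rw [tsum_div_const, Real.div_rpow hM (by positivity)]
    gcongr
    exact h.2

end Truncation

section HeatKernel

lemma It_eq_fcoef (Q g : (Fin d → ℤ) → ℝ) (t : ℝ) (x : Fin d → ℤ) :
    It Q g t x =
      fcoef (fun k => fourierZ g k * Complex.exp (-(t : ℂ) * (fourierZ Q 0 - fourierZ Q k))) x := by
  simp only [It, fcoef, mul_assoc]

lemma norm_exp_neg_mul_le {t c : ℝ} {w : ℂ} (ht : 0 ≤ t) (h : c ≤ w.re) :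
    ‖Complex.exp (-(t : ℂ) * w)‖ ≤ Real.exp (-(t * c)) := by
  rw [Complex.norm_exp]
  gcongr
  simp only [neg_mul, Complex.neg_re, Complex.re_ofReal_mul]
  exact neg_le_neg (mul_le_mul_of_nonneg_left h ht)

lemma norm_exp_sub_one_div_le {t b : ℝ} {w : ℂ} (ht : 0 ≤ t) (h : ‖w‖ ≤ b) :
    ‖(Complex.exp (t * w) - 1) / w‖ ≤ t * Real.exp (t * b) := by
  rcases eq_or_ne w 0 with rfl | hw
  · simpa using by positivity
  have h2 : ‖Complex.exp (t * w) - 1‖ ≤ ‖(t * w : ℂ)‖ * Real.exp ‖(t * w : ℂ)‖ := by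
    have := Complex.norm_exp_sub_sum_le_norm_mul_exp (t * w) 1
    simpa using this
  have hn : ‖(t * w : ℂ)‖ = t * ‖w‖ := by
    rw [norm_mul, Complex.norm_real, Real.norm_of_nonneg ht]
  rw [norm_div, div_le_iff₀ (norm_pos_iff.2 hw)]
  calc _ ≤ t * ‖w‖ * Real.exp (t * ‖w‖) := by rwa [hn] at h2
    _ ≤ t * ‖w‖ * Real.exp (t * b) := by gcongr
    _ = _ := by ring

variable {M K θ : ℝ} {Q g : (Fin d → ℤ) → ℝ}

lemma KernelBounds.norm_exp_le (hQ : KernelBounds M K θ Q g) {t : ℝ} (ht : 0 ≤ t) {k : Fin d → ℝ}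
    (hk : k ∈ torus d) :
    ‖Complex.exp (-(t : ℂ) * (fourierZ Q 0 - fourierZ Q k))‖
      ≤ Real.exp (-(K * t) * enormR k ^ 2) := by
  refine (norm_exp_neg_mul_le ht (hQ.infrared k hk)).trans_eq ?_
  congr 1; ring

lemma KernelBounds.M_nonneg (hQ : KernelBounds M K θ Q g) : 0 ≤ M :=
  (tsum_nonneg fun _ => abs_nonneg _).trans hQ.Q_one.2

lemma KernelBounds.norm_It_le (hQ : KernelBounds M K θ Q g) {t : ℝ} (ht : 0 ≤ t)
    (x : Fin d → ℤ) : ‖It Q g t x‖ ≤ M * gaussAvg d (K * t) := by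
  rw [It_eq_fcoef]
  refine norm_fcoef_le_gaussAvg (fun k hk => ?_) x
  rw [norm_mul]
  have := hQ.M_nonneg
  gcongr
  · exact (norm_fourierZ_le hQ.g_one.1 k).trans hQ.g_one.2
  · exact hQ.norm_exp_le ht hk

lemma KernelBounds.infrared_headPart (hQ : KernelBounds M K θ Q g) {R b : ℝ}
    (hb : ∑' y, |tailPart R Q y| ≤ b) {k : Fin d → ℝ} (hk : k ∈ torus d) :
    K * enormR k ^ 2 - b ≤ (fourierZ Q 0 - fourierZ (headPart R Q) k).re := by
  have h1 := hQ.infrared k hk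
  have h2 : |(fourierZ (tailPart R Q) k).re| ≤ b := (Complex.abs_re_le_norm _).trans
    ((norm_fourierZ_le (summable_abs_tailPart hQ.Q_one.1 R) k).trans hb)
  rw [← fourierZ_headPart_add_tailPart hQ.Q_one.1 R k] at h1
  simp only [Complex.sub_re, Complex.add_re] at h1 ⊢
  linarith [neg_abs_le (fourierZ (tailPart R Q) k).re]

/-- Contribution of large jumps of `g`. -/
lemma KernelBounds.norm_fcoef_tailPart_le (hd : 2 ≤ d) (hQ : KernelBounds M K θ Q g) {R t : ℝ}
    (hR : 0 < R) (hK : 0 < K) (ht : 0 < t) (x : Fin d → ℤ) :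
    ‖fcoef (fun k => fourierZ (tailPart R g) k *
      Complex.exp (-(t : ℂ) * (fourierZ Q 0 - fourierZ Q k))) x‖
      ≤ M / R ^ (d - 1) * (√(K * t))⁻¹ := by
  have hM := hQ.M_nonneg
  have hQc := continuous_fourierZ hQ.Q_one.1
  have h2 := tailPart_rpow_le (f := g) (m := d - 1) (p := 2) (M := M) hR two_pos hM
    (by
      have := hQ.g_sq hd
      simpa only [Real.rpow_ofNat, mul_pow, sq_abs] using this)
  refine (norm_fcoef_fourierZ_mul_le (summable_abs_tailPart hQ.g_one.1 R) one_le_two le_rfl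
    (by positivity) h2.1 h2.2 (C := 1) (a := K * t) (by fun_prop) zero_le_one (by positivity)
    (fun k hk => by rw [one_mul]; exact hQ.norm_exp_le ht.le hk) x).trans ?_
  have hKt : 0 < K * t := by positivity
  rw [one_mul]
  gcongr
  rw [← Real.sqrt_eq_rpow, ← Real.sqrt_inv]
  refine Real.sqrt_le_sqrt ?_
  have hd' : (2 : ℝ) ≤ d := by exact_mod_cast hd
  simpa [Real.rpow_neg_one] using gaussAvg_le_rpow (d := d) hKt zero_le_one (by linarith)

end HeatKernel

section Jumps

variable {M K θ : ℝ} {Q g : (Fin d → ℤ) → ℝ}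

/-- The factor of the Fourier integrand created by the large jumps of `Q`. -/
def jumpFactor (Q : (Fin d → ℤ) → ℝ) (R t : ℝ) (k : Fin d → ℝ) : ℂ :=
  Complex.exp (-(t : ℂ) * (fourierZ Q 0 - fourierZ (headPart R Q) k)) *
    ((Complex.exp (t * fourierZ (tailPart R Q) k) - 1) / fourierZ (tailPart R Q) k)

lemma tailPart_mul_jumpFactor (hQ : Summable fun y => |Q y|) (R t : ℝ) (k : Fin d → ℝ) :
    fourierZ (tailPart R Q) k * jumpFactor Q R t k =
      Complex.exp (-(t : ℂ) * (fourierZ Q 0 - fourierZ Q k)) -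
        Complex.exp (-(t : ℂ) * (fourierZ Q 0 - fourierZ (headPart R Q) k)) := by
  have h : -(t : ℂ) * (fourierZ Q 0 - fourierZ Q k) =
      -(t : ℂ) * (fourierZ Q 0 - fourierZ (headPart R Q) k) + t * fourierZ (tailPart R Q) k := by
    rw [← fourierZ_headPart_add_tailPart hQ R k]; ring
  rw [h, Complex.exp_add, jumpFactor]
  rcases eq_or_ne (fourierZ (tailPart R Q) k) 0 with h0 | h0
  · simp [h0]
  · field_simp

lemma measurable_jumpFactor (hQ : Summable fun y => |Q y|) (R t : ℝ) :
    Measurable (jumpFactor Q R t) := by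
  have h1 := (continuous_fourierZ (summable_abs_headPart hQ R)).measurable
  have h2 := (continuous_fourierZ (summable_abs_tailPart hQ R)).measurable
  unfold jumpFactor
  fun_prop

lemma KernelBounds.norm_jumpFactor_le (hQ : KernelBounds M K θ Q g) {R b t : ℝ} (ht : 0 ≤ t)
    (hb : ∑' y, |tailPart R Q y| ≤ b) {k : Fin d → ℝ} (hk : k ∈ torus d) :
    ‖jumpFactor Q R t k‖ ≤ t * Real.exp (2 * (t * b)) * Real.exp (-(K * t) * enormR k ^ 2) := by
  rw [jumpFactor, norm_mul]
  have h1 := norm_exp_neg_mul_le ht (hQ.infrared_headPart hb hk)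
  have h2 := norm_exp_sub_one_div_le ht
    ((norm_fourierZ_le (summable_abs_tailPart hQ.Q_one.1 R) k).trans hb)
  calc _ ≤ Real.exp (-(t * (K * enormR k ^ 2 - b))) * (t * Real.exp (t * b)) := by gcongr
    _ = t * (Real.exp (-(t * (K * enormR k ^ 2 - b))) * Real.exp (t * b)) := by ring
    _ = t * (Real.exp (2 * (t * b)) * Real.exp (-(K * t) * enormR k ^ 2)) := by
        rw [← Real.exp_add, ← Real.exp_add]; congr 2; ring
    _ = _ := by ring

lemma norm_fcoef_fourierZ_mul_le_of_forall {f : (Fin d → ℤ) → ℝ} (hf : Summable fun y => |f y|)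
    {A B : ℝ} (hA : ∑' y, |f y| ≤ A) {Φ : (Fin d → ℝ) → ℂ} (hΦ : IntegrableOn Φ (torus d))
    (hB : ∀ x, ‖fcoef Φ x‖ ≤ B) (x : Fin d → ℤ) :
    ‖fcoef (fun k => fourierZ f k * Φ k) x‖ ≤ A * B := by
  have hs := hasSum_fcoef_fourierZ_mul hf hΦ x
  have hle : ∀ y, ‖(f y : ℂ) * fcoef Φ (x - y)‖ ≤ |f y| * B := fun y => by
    rw [norm_mul, Complex.norm_real, Real.norm_eq_abs]
    gcongr
    exact hB _
  rw [← hs.tsum_eq]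
  refine (tsum_of_norm_bounded (hf.mul_right B).hasSum hle).trans ?_
  rw [tsum_mul_right]
  have : 0 ≤ B := (norm_nonneg _).trans (hB 0)
  gcongr

lemma integrableOn_of_norm_le_gauss {Φ : (Fin d → ℝ) → ℂ} (hm : Measurable Φ) {C a : ℝ}
    (hle : ∀ k ∈ torus d, ‖Φ k‖ ≤ C * Real.exp (-a * enormR k ^ 2)) :
    IntegrableOn Φ (torus d) := by
  refine Integrable.mono' ((integrableOn_gauss a).const_mul C) hm.aestronglyMeasurable ?_
  filter_upwards [ae_restrict_mem (measurableSet_torus d)] with k hk using hle k hk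

lemma KernelBounds.tailPart_Q_le (hQ : KernelBounds M K θ Q g) {R : ℝ} (hR : 0 < R) :
    ∑' y, |tailPart R Q y| ≤ M / R ^ 2 := by
  have := (tailPart_rpow_le (f := Q) (m := 2) (p := 1) (M := M) hR one_pos hQ.M_nonneg
    (by simpa using hQ.Q_two)).2
  simpa using this

/-- Contribution of the large jumps of `Q`, in dimension at least three. -/
lemma KernelBounds.norm_fcoef_jump_le_of_three_le (hd : 3 ≤ d) (hQ : KernelBounds M K θ Q g)
    {R t : ℝ} (hR : 0 < R) (hK : 0 < K) (ht : 0 < t) (x : Fin d → ℤ) :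
    ‖fcoef (fun k => fourierZ (tailPart R Q) k * jumpFactor Q R t k) x‖
      ≤ M / R ^ (d - 1) * (t * Real.exp (2 * (t * (M / R ^ 2))) * ((K * t) * √(K * t))⁻¹) := by
  have hM := hQ.M_nonneg
  have hKt : 0 < K * t := by positivity
  have hd' : (3 : ℝ) ≤ d := by exact_mod_cast hd
  set p := min ((d : ℝ) / 3) 2 with hp
  have hp1 : 1 ≤ p := le_min (by linarith) one_le_two
  have hp0 : 0 < p := by linarith
  have hpd : p ≤ d / 3 := min_le_left _ _
  have h2 := tailPart_rpow_le (f := Q) (m := d - 1) (p := p) (M := M) hR hp0 hM (hQ.Q_pow hd)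
  refine (norm_fcoef_fourierZ_mul_le (summable_abs_tailPart hQ.Q_one.1 R) hp1 (min_le_right _ _)
    (by positivity) h2.1 h2.2 (C := t * Real.exp (2 * (t * (M / R ^ 2)))) (a := K * t)
    (measurable_jumpFactor hQ.Q_one.1 R t).aestronglyMeasurable (by positivity) hKt.le
    (fun k hk => hQ.norm_jumpFactor_le ht.le (hQ.tailPart_Q_le hR) hk) x).trans ?_
  gcongr
  calc gaussAvg d (K * t) ^ (1 / p) ≤ ((K * t) ^ (-(3 * p / 2))) ^ (1 / p) := by
        refine Real.rpow_le_rpow (gaussAvg_nonneg _ _) (gaussAvg_le_rpow hKt ?_ ?_) ?_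
        · positivity
        · linarith
        · positivity
    _ = (K * t) ^ (-(1 + 1 / 2) : ℝ) := by
        rw [← Real.rpow_mul hKt.le]; congr 1; field_simp; norm_num
    _ = _ := by
        rw [Real.rpow_neg hKt.le, Real.rpow_add hKt, Real.rpow_one, Real.sqrt_eq_rpow]

/-- Contribution of the large jumps of `Q`, in dimension at least two. -/
lemma KernelBounds.norm_fcoef_jump_le_of_two_le (hd : 2 ≤ d) (hQ : KernelBounds M K θ Q g)
    {R t : ℝ} (hR : 0 < R) (hK : 0 < K) (ht : 0 < t) (x : Fin d → ℤ) :
    ‖fcoef (fun k => fourierZ (tailPart R Q) k * jumpFactor Q R t k) x‖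
      ≤ M / R ^ 2 * (t * Real.exp (2 * (t * (M / R ^ 2))) * (K * t)⁻¹) := by
  have hM := hQ.M_nonneg
  have hKt : 0 < K * t := by positivity
  have hd' : (2 : ℝ) ≤ d := by exact_mod_cast hd
  have hbd := fun k (hk : k ∈ torus d) => hQ.norm_jumpFactor_le ht.le (hQ.tailPart_Q_le hR) hk
  refine norm_fcoef_fourierZ_mul_le_of_forall (summable_abs_tailPart hQ.Q_one.1 R)
    (hQ.tailPart_Q_le hR) (integrableOn_of_norm_le_gauss (measurable_jumpFactor hQ.Q_one.1 R t) hbd)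
    (fun y => (norm_fcoef_le_gaussAvg hbd y).trans ?_) x
  gcongr
  simpa [Real.rpow_neg_one] using gaussAvg_le_rpow (d := d) hKt zero_le_one (by linarith)

end Jumps

section TiltedHead

variable {M K θ : ℝ} {Q g : (Fin d → ℤ) → ℝ}

lemma tsum_eq_zero_of_odd {f : (Fin d → ℤ) → ℝ} (hf : ∀ y, f (-y) = -f y) : ∑' y, f y = 0 := by
  have h := (Equiv.neg (Fin d → ℤ)).tsum_eq f
  simp only [Equiv.neg_apply, hf, tsum_neg] at h
  linarith

lemma cosh_eq_one_add_two_mul_sinh_sq (w : ℝ) :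
    Real.cosh w = 1 + 2 * Real.sinh (w / 2) ^ 2 := by
  have := Real.cosh_two_mul (w / 2)
  rw [mul_div_cancel₀ w two_ne_zero] at this
  linarith [Real.cosh_sq (w / 2)]

lemma sinh_sq_le (w : ℝ) : Real.sinh w ^ 2 ≤ w ^ 2 * Real.cosh w ^ 2 := by
  wlog hw : 0 ≤ w generalizing w
  · have := this (-w) (by linarith)
    simpa using this
  have hmono : MonotoneOn (fun u => u * Real.cosh u - Real.sinh u) (Set.Ici 0) := by
    refine monotoneOn_of_deriv_nonneg (convex_Ici 0) (by fun_prop) (by fun_prop) fun u hu => ?_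
    rw [interior_Ici] at hu
    have hder : HasDerivAt (fun u => u * Real.cosh u - Real.sinh u)
        (1 * Real.cosh u + u * Real.sinh u - Real.cosh u) u :=
      ((hasDerivAt_id u).mul (Real.hasDerivAt_cosh u)).sub (Real.hasDerivAt_sinh u)
    rw [hder.deriv]
    have := mul_nonneg (le_of_lt hu) (Real.sinh_nonneg_iff.2 (le_of_lt hu))
    linarith
  have := hmono (Set.mem_Ici.2 le_rfl) (Set.mem_Ici.2 hw) hw
  simp only [Real.sinh_zero, zero_mul, sub_zero] at this
  rw [← mul_pow]
  exact pow_le_pow_left₀ (Real.sinh_nonneg_iff.2 hw) (by linarith) 2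

lemma cosh_half_sq_le (w : ℝ) : Real.cosh (w / 2) ^ 2 ≤ Real.cosh w := by
  rw [Real.cosh_sq, cosh_eq_one_add_two_mul_sinh_sq w]; nlinarith [sq_nonneg (Real.sinh (w / 2))]

lemma cosh_sub_one_le (w : ℝ) : Real.cosh w - 1 ≤ w ^ 2 * Real.cosh w := by
  have h1 := cosh_eq_one_add_two_mul_sinh_sq w
  have h3 := sinh_sq_le (w / 2)
  have h5 := mul_le_mul_of_nonneg_left (cosh_half_sq_le w) (sq_nonneg (w / 2))
  have h6 := mul_nonneg (sq_nonneg w) (Real.cosh_pos w).le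
  nlinarith

lemma cosh_le_exp_abs (w : ℝ) : Real.cosh w ≤ Real.exp |w| := by
  rw [← Real.cosh_abs, Real.cosh_eq]
  have : Real.exp (-|w|) ≤ Real.exp |w| := Real.exp_le_exp.2 (by linarith [abs_nonneg w])
  linarith

lemma abs_tilt_headPart_le {R e : ℝ} {μ : Fin d → ℝ} (f : (Fin d → ℤ) → ℝ)
    (hμ : ∀ y, enormZ y ≤ R → |rdotZ μ y| ≤ e) (y : Fin d → ℤ) :
    |tilt (headPart R f) μ y| ≤ Real.exp e * |f y| := by
  unfold tilt headPart
  split_ifs with h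
  · rw [abs_mul, Real.abs_exp, mul_comm]
    gcongr
    exact (le_abs_self _).trans (hμ y h)
  · simpa using by positivity

lemma KernelBounds.re_fourierZ_tilt_headPart_le (hQ : KernelBounds M K θ Q g)
    (hsym : ∀ y, Q (-y) = Q y) {R e b : ℝ} {μ : Fin d → ℝ}
    (hμ : ∀ y, enormZ y ≤ R → |rdotZ μ y| ≤ e)
    (hb : ∑' y, |tailPart R Q y| ≤ b) {k : Fin d → ℝ} (hk : k ∈ torus d) :
    K * enormR k ^ 2 - b - enormR μ ^ 2 * M * Real.exp e ≤
      (fourierZ Q 0 - fourierZ (tilt (headPart R Q) μ) k).re := by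
  have h1 := hQ.infrared_headPart hb hk
  have hs := hQ.Q_one.1
  have hst : Summable fun y => |tilt (headPart R Q) μ y| :=
    Summable.of_nonneg_of_le (fun _ => abs_nonneg _) (abs_tilt_headPart_le Q hμ) (hs.mul_left _)
  have hterm : ∀ y, |headPart R Q y * (Real.cosh (rdotZ μ y) - 1) * Real.cos (rdotZ k y)| ≤
      enormR μ ^ 2 * Real.exp e * (enormZ y ^ 2 * |Q y|) := fun y => by
    unfold headPart
    split_ifs with h
    · have h2 : 0 ≤ Real.cosh (rdotZ μ y) - 1 := by linarith [Real.one_le_cosh (rdotZ μ y)]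
      have h3 : Real.cosh (rdotZ μ y) - 1 ≤ (enormR μ * enormZ y) ^ 2 * Real.exp e := by
        refine (cosh_sub_one_le _).trans ?_
        rw [← sq_abs]
        gcongr
        · exact abs_rdotZ_le μ y
        · exact (cosh_le_exp_abs _).trans (Real.exp_le_exp.2 (hμ y h))
      rw [abs_mul, abs_mul, abs_of_nonneg h2]
      calc _ ≤ |Q y| * ((enormR μ * enormZ y) ^ 2 * Real.exp e) * 1 := by
            gcongr; exact Real.abs_cos_le_one _
        _ = _ := by ring
    · simpa using by positivity
  have hS := hQ.Q_two.1.mul_left (enormR μ ^ 2 * Real.exp e)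
  have hsum1 : Summable fun y =>
      headPart R Q y * (Real.cosh (rdotZ μ y) - 1) * Real.cos (rdotZ k y) :=
    Summable.of_norm_bounded hS hterm
  have hsum2 : Summable fun y => headPart R Q y * Real.cos (rdotZ k y) := by
    refine Summable.of_norm_bounded hs fun y => ?_
    rw [norm_mul, Real.norm_eq_abs, Real.norm_eq_abs]
    have := mul_le_mul (abs_headPart_le R Q y) (Real.abs_cos_le_one (rdotZ k y)) (abs_nonneg _)
      (abs_nonneg _)
    simpa using this
  have hsum3 : Summable fun y => headPart R Q y * Real.sinh (rdotZ μ y) * Real.cos (rdotZ k y) := by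
    have hst' : Summable fun y => tilt (headPart R Q) μ y * Real.cos (rdotZ k y) := by
      refine Summable.of_norm_bounded hst fun y => ?_
      rw [norm_mul, Real.norm_eq_abs, Real.norm_eq_abs]
      exact mul_le_of_le_one_right (abs_nonneg _) (Real.abs_cos_le_one _)
    refine ((hst'.sub hsum1).sub hsum2).congr fun y => ?_
    rw [tilt, ← Real.cosh_add_sinh]; ring
  have hodd : ∑' y, headPart R Q y * Real.sinh (rdotZ μ y) * Real.cos (rdotZ k y) = 0 :=
    tsum_eq_zero_of_odd fun y => by
      rw [headPart_neg hsym, rdotZ_neg_right, rdotZ_neg_right, Real.sinh_neg, Real.cos_neg]; ring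
  have heq : (fourierZ (tilt (headPart R Q) μ) k).re = (fourierZ (headPart R Q) k).re +
      ∑' y, headPart R Q y * (Real.cosh (rdotZ μ y) - 1) * Real.cos (rdotZ k y) := by
    rw [fourierZ_re hst, fourierZ_re (summable_abs_headPart hs R)]
    rw [← add_zero (_ + _), ← hodd, ← hsum2.tsum_add hsum1, ← (hsum2.add hsum1).tsum_add hsum3]
    refine tsum_congr fun y => ?_
    rw [tilt, ← Real.cosh_add_sinh]; ring
  have hbd : ∑' y, headPart R Q y * (Real.cosh (rdotZ μ y) - 1) * Real.cos (rdotZ k y) ≤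
      enormR μ ^ 2 * M * Real.exp e := by
    refine (hsum1.tsum_le_tsum (fun y => (le_abs_self _).trans (hterm y)) hS).trans ?_
    rw [tsum_mul_left, mul_right_comm]
    gcongr
    exact hQ.Q_two.2
  simp only [Complex.sub_re] at h1 ⊢
  rw [heq]
  linarith

lemma KernelBounds.norm_fcoef_head_le (hQ : KernelBounds M K θ Q g) (hsym : ∀ y, Q (-y) = Q y)
    {R e b t : ℝ} {μ : Fin d → ℝ} (ht : 0 ≤ t) (hμ : ∀ y, enormZ y ≤ R → |rdotZ μ y| ≤ e)
    (hb : ∑' y, |tailPart R Q y| ≤ b) (x : Fin d → ℤ) :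
    ‖fcoef (fun k => fourierZ (headPart R g) k *
        Complex.exp (-(t : ℂ) * (fourierZ Q 0 - fourierZ (headPart R Q) k))) x‖ ≤
      Real.exp (-rdotZ μ x) * (Real.exp e * M *
        Real.exp (t * b + t * (enormR μ ^ 2 * M * Real.exp e)) * gaussAvg d (K * t)) := by
  have hs := hQ.Q_one.1
  have hM := hQ.M_nonneg
  have htilt : ∀ f : (Fin d → ℤ) → ℝ, (Summable fun y => |f y|) →
      Summable fun y => |tilt (headPart R f) μ y| := fun f hf =>
    Summable.of_nonneg_of_le (fun _ => abs_nonneg _) (abs_tilt_headPart_le f hμ) (hf.mul_left _)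
  have hfour : ∀ (f : (Fin d → ℤ) → ℝ) k, fourierZ (fun y => t * f y) k = t * fourierZ f k :=
    fun f k => by
      simp only [fourierZ, ← tsum_mul_left]
      exact tsum_congr fun y => by push_cast; ring
  have habs : ∀ f : (Fin d → ℤ) → ℝ, (Summable fun y => |f y|) →
      Summable fun y => |t * f y| := fun f hf => by
    simpa only [abs_mul] using hf.mul_left |t|
  have htl : tilt (fun y => t * headPart R Q y) μ = fun y => t * tilt (headPart R Q) μ y :=
    funext fun y => by simp only [tilt, mul_assoc]
  have key := fcoef_mul_exp_tilt (f := fun y => t * headPart R Q y) (g := headPart R g) (μ := μ)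
    (habs _ (summable_abs_headPart hs R)) (summable_abs_headPart hQ.g_one.1 R)
    (by rw [htl]; exact habs _ (htilt Q hs)) (htilt g hQ.g_one.1) x
  rw [htl] at key
  simp only [hfour] at key
  have h0 : ∀ (Ψ Ξ : (Fin d → ℝ) → ℂ),
      fcoef (fun k => Ψ k * Complex.exp (-(t : ℂ) * (fourierZ Q 0 - Ξ k))) x =
        Complex.exp (-(t * fourierZ Q 0)) * fcoef (fun k => Ψ k * Complex.exp (t * Ξ k)) x :=
    fun Ψ Ξ => by
      rw [← fcoef_const_mul]
      congr 1
      funext k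
      rw [mul_left_comm, ← Complex.exp_add]
      congr 2; ring
  have key2 : fcoef (fun k => fourierZ (headPart R g) k *
        Complex.exp (-(t : ℂ) * (fourierZ Q 0 - fourierZ (headPart R Q) k))) x *
          (Real.exp (rdotZ μ x) : ℂ) = fcoef (fun k => fourierZ (tilt (headPart R g) μ) k *
        Complex.exp (-(t : ℂ) * (fourierZ Q 0 - fourierZ (tilt (headPart R Q) μ) k))) x := by
    rw [h0, h0, mul_assoc, key]
  have hbound : ‖fcoef (fun k => fourierZ (tilt (headPart R g) μ) k *
        Complex.exp (-(t : ℂ) * (fourierZ Q 0 - fourierZ (tilt (headPart R Q) μ) k))) x‖ ≤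
      Real.exp e * M *
        Real.exp (t * b + t * (enormR μ ^ 2 * M * Real.exp e)) * gaussAvg d (K * t) := by
    refine norm_fcoef_le_gaussAvg (fun k hk => ?_) x
    rw [norm_mul, mul_assoc (Real.exp e * M)]
    refine mul_le_mul ?_ ?_ (norm_nonneg _) (by positivity)
    · refine (norm_fourierZ_le (htilt g hQ.g_one.1) k).trans ?_
      refine ((htilt g hQ.g_one.1).tsum_le_tsum (abs_tilt_headPart_le g hμ)
        (hQ.g_one.1.mul_left _)).trans ?_
      rw [tsum_mul_left]
      gcongr
      exact hQ.g_one.2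
    · refine (norm_exp_neg_mul_le ht (hQ.re_fourierZ_tilt_headPart_le hsym hμ hb hk)).trans_eq ?_
      rw [← Real.exp_add]
      congr 1; ring
  rw [← key2, norm_mul, Complex.norm_real, Real.norm_of_nonneg (Real.exp_pos _).le] at hbound
  rw [Real.exp_neg, inv_mul_eq_div, le_div_iff₀ (Real.exp_pos _)]
  exact hbound

end TiltedHead

section UniformBound

variable {M K θ : ℝ} {Q g : (Fin d → ℤ) → ℝ}

lemma sq_mul_exp_neg_le {u : ℝ} (hu : 0 ≤ u) : u ^ 2 * Real.exp (-u + u / 4) ≤ 4 := by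
  have h1 : -u + u / 4 = -(3 * u / 4) := by ring
  rw [h1, Real.exp_neg, ← div_eq_mul_inv, div_le_iff₀ (Real.exp_pos _)]
  have := Real.quadratic_le_exp_of_nonneg (x := 3 * u / 4) (by positivity)
  nlinarith

lemma enormZ_pos {x : Fin d → ℤ} (hx : x ≠ 0) : 0 < enormZ x :=
  zero_lt_one.trans_le (one_le_enormZ hx)

lemma rdotZ_toR_self (x : Fin d → ℤ) : rdotZ (toR x) x = enormZ x ^ 2 := by
  rw [enormZ_sq, rdotZ]; exact Finset.sum_congr rfl fun i _ => (sq _).symm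

/-- Contribution of the small jumps, by exponential tilting. -/
lemma KernelBounds.norm_fcoef_head_le_of_le_sq (hd : 1 ≤ d) (hQ : KernelBounds M K θ Q g)
    (hsym : ∀ y, Q (-y) = Q y) (hK : 0 < K) {x : Fin d → ℤ} (hx : x ≠ 0) {t : ℝ} (ht : 0 < t)
    (htx : t ≤ enormZ x ^ 2) :
    enormZ x ^ d * ‖fcoef (fun k => fourierZ (headPart (enormZ x / (4 * d)) g) k *
        Complex.exp (-(t : ℂ) * (fourierZ Q 0 - fourierZ (headPart (enormZ x / (4 * d)) Q) k))) x‖ ≤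
      M * K ^ (-((d : ℝ) / 2)) * Real.exp (20 * d ^ 2 * M) := by
  have hM := hQ.M_nonneg
  have hr := enormZ_pos hx
  set r := enormZ x with hrdef
  have hD : (1 : ℝ) ≤ d := by exact_mod_cast hd
  have hD0 : (0 : ℝ) < d := by linarith
  have hst : 0 < √t := Real.sqrt_pos.2 ht
  have hstr : √t ≤ r := (Real.sqrt_le_left hr.le).2 htx
  obtain ⟨l, hl⟩ : ∃ l, l = 2 * Real.log (r / √t) := ⟨_, rfl⟩
  have hl0 : 0 ≤ l := by
    rw [hl]; exact mul_nonneg two_pos.le (Real.log_nonneg ((one_le_div hst).2 hstr))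
  have hexp : r / √t = Real.exp (l / 2) := by
    rw [hl, mul_div_cancel_left₀ _ two_ne_zero, Real.exp_log (by positivity)]
  have htr : t / r ^ 2 = Real.exp (-l) := by
    rw [Real.exp_neg, ← Real.sq_sqrt ht.le, ← div_pow, ← inv_div, hexp, ← Real.exp_neg,
      ← Real.exp_nat_mul, ← Real.exp_neg]
    congr 1; push_cast; ring
  have hμx : rdotZ ((d * l / r ^ 2) • toR x) x = d * l := by
    rw [rdotZ_smul_left, rdotZ_toR_self, div_mul_cancel₀ _ (by positivity)]
  have hμn : enormR ((d * l / r ^ 2) • toR x) = d * l / r := by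
    rw [enormR_smul (by positivity), enormR_toR, ← hrdef]; field_simp
  have hμy : ∀ y : Fin d → ℤ, enormZ y ≤ r / (4 * d) →
      |rdotZ ((d * l / r ^ 2) • toR x) y| ≤ l / 4 := fun y hy => by
    refine (abs_rdotZ_le _ y).trans ?_
    rw [hμn]
    calc d * l / r * enormZ y ≤ d * l / r * (r / (4 * d)) := by gcongr
      _ = l / 4 := by field_simp
  have hR : 0 < r / (4 * d) := by positivity
  have h := hQ.norm_fcoef_head_le hsym ht.le hμy (hQ.tailPart_Q_le hR) x
  rw [hμx, hμn] at h
  have hb : t * (M / (r / (4 * d)) ^ 2) ≤ 16 * d ^ 2 * M := by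
    have : t * (M / (r / (4 * d)) ^ 2) = 16 * d ^ 2 * M * (t / r ^ 2) := by
      field_simp; norm_num
    rw [this]
    exact mul_le_of_le_one_right (by positivity) ((div_le_one (by positivity)).2 htx)
  have hc : t * ((d * l / r) ^ 2 * M * Real.exp (l / 4)) ≤ 4 * d ^ 2 * M := by
    have : t * ((d * l / r) ^ 2 * M * Real.exp (l / 4)) =
        d ^ 2 * M * (l ^ 2 * (t / r ^ 2 * Real.exp (l / 4))) := by field_simp
    rw [this, htr, ← Real.exp_add]
    calc _ ≤ d ^ 2 * M * 4 := by gcongr; exact sq_mul_exp_neg_le hl0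
      _ = _ := by ring
  have hG : gaussAvg d (K * t) ≤ K ^ (-((d : ℝ) / 2)) * (Real.exp (d * l / 2) / r ^ d) := by
    refine (gaussAvg_le (by positivity)).trans_eq ?_
    rw [Real.mul_rpow hK.le ht.le]
    congr 1
    rw [Real.rpow_neg ht.le, show (d : ℝ) / 2 = (1 / 2) * d by ring, Real.rpow_mul ht.le,
      ← Real.sqrt_eq_rpow, Real.rpow_natCast, eq_div_iff (by positivity), inv_mul_eq_div,
      ← div_pow, hexp, ← Real.exp_nat_mul]
    congr 1; ring
  calc r ^ d * _ ≤ r ^ d * (Real.exp (-(d * l)) * (Real.exp (l / 4) * M *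
        Real.exp (20 * d ^ 2 * M) *
          (K ^ (-((d : ℝ) / 2)) * (Real.exp (d * l / 2) / r ^ d)))) := by
        refine mul_le_mul_of_nonneg_left (h.trans ?_) (by positivity)
        gcongr
        · exact gaussAvg_nonneg _ _
        · linarith
    _ = M * K ^ (-((d : ℝ) / 2)) * Real.exp (20 * d ^ 2 * M) *
        (Real.exp (-(d * l)) * Real.exp (l / 4) * Real.exp (d * l / 2)) := by field_simp
    _ ≤ M * K ^ (-((d : ℝ) / 2)) * Real.exp (20 * d ^ 2 * M) * 1 := by
        gcongr
        rw [← Real.exp_add, ← Real.exp_add]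
        refine Real.exp_le_one_iff.2 ?_
        nlinarith [mul_le_mul_of_nonneg_right hD hl0]
    _ = _ := mul_one _

lemma integrableOn_torus_of_continuous {Φ : (Fin d → ℝ) → ℂ} (h : Continuous Φ) :
    IntegrableOn Φ (torus d) :=
  h.continuousOn.integrableOn_compact (isCompact_torus d)

lemma KernelBounds.It_split (hQ : KernelBounds M K θ Q g) (t R : ℝ) (x : Fin d → ℤ) :
    It Q g t x =
      fcoef (fun k => fourierZ (tailPart R g) k *
        Complex.exp (-(t : ℂ) * (fourierZ Q 0 - fourierZ Q k))) x +
      fcoef (fun k => fourierZ (headPart R g) k *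
        (fourierZ (tailPart R Q) k * jumpFactor Q R t k)) x +
      fcoef (fun k => fourierZ (headPart R g) k *
        Complex.exp (-(t : ℂ) * (fourierZ Q 0 - fourierZ (headPart R Q) k))) x := by
  have c1 := continuous_fourierZ hQ.Q_one.1
  have c2 := continuous_fourierZ (summable_abs_headPart hQ.Q_one.1 R)
  have c3 := continuous_fourierZ (summable_abs_headPart hQ.g_one.1 R)
  have c4 := continuous_fourierZ (summable_abs_tailPart hQ.g_one.1 R)
  simp only [tailPart_mul_jumpFactor hQ.Q_one.1]
  have i1 : IntegrableOn (fun k => fourierZ (tailPart R g) k *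
      Complex.exp (-(t : ℂ) * (fourierZ Q 0 - fourierZ Q k))) (torus d) :=
    integrableOn_torus_of_continuous (by fun_prop)
  have i2 : IntegrableOn (fun k => fourierZ (headPart R g) k *
      (Complex.exp (-(t : ℂ) * (fourierZ Q 0 - fourierZ Q k)) -
        Complex.exp (-(t : ℂ) * (fourierZ Q 0 - fourierZ (headPart R Q) k)))) (torus d) :=
    integrableOn_torus_of_continuous (by fun_prop)
  have i3 : IntegrableOn (fun k => fourierZ (headPart R g) k *
      Complex.exp (-(t : ℂ) * (fourierZ Q 0 - fourierZ (headPart R Q) k))) (torus d) :=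
    integrableOn_torus_of_continuous (by fun_prop)
  have i12 : IntegrableOn (fun k => fourierZ (tailPart R g) k *
      Complex.exp (-(t : ℂ) * (fourierZ Q 0 - fourierZ Q k)) + fourierZ (headPart R g) k *
      (Complex.exp (-(t : ℂ) * (fourierZ Q 0 - fourierZ Q k)) -
        Complex.exp (-(t : ℂ) * (fourierZ Q 0 - fourierZ (headPart R Q) k)))) (torus d) :=
    integrableOn_torus_of_continuous (by fun_prop)
  rw [← fcoef_add i1 i2, ← fcoef_add i12 i3, It_eq_fcoef]
  congr 1
  funext k
  rw [← fourierZ_headPart_add_tailPart hQ.g_one.1 R k]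
  ring

/-- Large jumps of `Q`, at the natural truncation radius. -/
lemma KernelBounds.norm_fcoef_jump_le (hd : 2 ≤ d) (hQ : KernelBounds M K θ Q g)
    (hK : 0 < K) {r t : ℝ} (hr : 0 < r) (ht : 0 < t) (htr : t ≤ r ^ 2) (x : Fin d → ℤ) :
    r ^ d * ‖fcoef (fun k => fourierZ (tailPart (r / (4 * d)) Q) k *
        jumpFactor Q (r / (4 * d)) t k) x‖ ≤
      M * (4 * d) ^ d * Real.exp (32 * d ^ 2 * M) * (K⁻¹ + (K * √K)⁻¹) * (r / √t) := by
  have hM := hQ.M_nonneg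
  have hD : (2 : ℝ) ≤ d := by exact_mod_cast hd
  have hR : 0 < r / (4 * d) := by positivity
  have hst : 0 < √t := Real.sqrt_pos.2 ht
  have hsK : 0 < √K := Real.sqrt_pos.2 hK
  have hrt : 1 ≤ r / √t := (one_le_div hst).2 ((Real.sqrt_le_left hr.le).2 htr)
  have hb : 2 * (t * (M / (r / (4 * d)) ^ 2)) ≤ 32 * d ^ 2 * M := by
    have : 2 * (t * (M / (r / (4 * d)) ^ 2)) = 32 * d ^ 2 * M * (t / r ^ 2) := by
      field_simp; ring
    rw [this]
    exact mul_le_of_le_one_right (by positivity) ((div_le_one (by positivity)).2 htr)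
  rcases eq_or_lt_of_le hd with h2 | h3
  · have h := hQ.norm_fcoef_jump_le_of_two_le hd hR hK ht x
    calc r ^ d * _ ≤ r ^ d * (M / (r / (4 * d)) ^ 2 *
          (t * Real.exp (32 * d ^ 2 * M) * (K * t)⁻¹)) := by
          refine mul_le_mul_of_nonneg_left (h.trans ?_) (by positivity)
          gcongr
      _ = M * (4 * d) ^ d * Real.exp (32 * d ^ 2 * M) * K⁻¹ * 1 := by
          subst h2; field_simp
      _ ≤ _ := by
          gcongr
          exact le_add_of_nonneg_right (by positivity)
  · have h := hQ.norm_fcoef_jump_le_of_three_le h3 hR hK ht x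
    calc r ^ d * _ ≤ r ^ d * (M / (r / (4 * d)) ^ (d - 1) *
          (t * Real.exp (32 * d ^ 2 * M) * ((K * t) * √(K * t))⁻¹)) := by
          refine mul_le_mul_of_nonneg_left (h.trans ?_) (by positivity)
          gcongr
      _ = M * (4 * d) ^ (d - 1) * Real.exp (32 * d ^ 2 * M) * (K * √K)⁻¹ * (r / √t) := by
          obtain ⟨e, rfl⟩ : ∃ e, d = e + 1 := ⟨d - 1, by omega⟩
          rw [Nat.add_sub_cancel, Real.sqrt_mul hK.le, pow_succ r, div_pow]
          field_simp
      _ ≤ _ := by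
          gcongr
          · linarith
          · omega
          · exact le_add_of_nonneg_left (by positivity)

/-- Uniform bound on the heat kernel below the diffusive time scale. -/
theorem exists_norm_It_le (hd : 1 ≤ d) (hM : 0 ≤ M) (hK : 0 < K) :
    ∃ C, 0 ≤ C ∧ ∀ Q g : (Fin d → ℤ) → ℝ, KernelBounds M K θ Q g → (∀ y, Q (-y) = Q y) →
      ∀ x ≠ 0, ∀ t, 0 < t → t ≤ enormZ x ^ 2 →
        enormZ x ^ d * ‖It Q g t x‖ ≤ C * (enormZ x / √t) := by
  rcases eq_or_lt_of_le hd with h1 | h2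
  · refine ⟨M * (√K)⁻¹, by positivity, fun Q g hQ _ x hx t ht _ => ?_⟩
    subst h1
    have hr := enormZ_nonneg x
    have h := gaussAvg_le (d := 1) (mul_pos hK ht)
    rw [Nat.cast_one, Real.rpow_neg (by positivity), ← Real.sqrt_eq_rpow, Real.sqrt_mul hK.le] at h
    calc enormZ x ^ 1 * _ ≤ enormZ x ^ 1 * (M * (√K * √t)⁻¹) := by
          gcongr
          refine (hQ.norm_It_le ht.le x).trans ?_
          gcongr
      _ = _ := by rw [mul_inv]; ring
  · refine ⟨M * (4 * d) ^ (d - 1) * (√K)⁻¹ + M * (M * (4 * d) ^ d * Real.exp (32 * d ^ 2 * M) *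
        (K⁻¹ + (K * √K)⁻¹)) + M * K ^ (-((d : ℝ) / 2)) * Real.exp (20 * d ^ 2 * M), by positivity,
        fun Q g hQ hsym x hx t ht htx => ?_⟩
    have hr := enormZ_pos hx
    set r := enormZ x with hrdef
    have hD : (2 : ℝ) ≤ d := by exact_mod_cast h2
    have hst : 0 < √t := Real.sqrt_pos.2 ht
    have hsK : 0 < √K := Real.sqrt_pos.2 hK
    have hR : 0 < r / (4 * d) := by positivity
    have hrt : 1 ≤ r / √t := (one_le_div hst).2 ((Real.sqrt_le_left hr.le).2 htx)
    have t1 : r ^ d * ‖fcoef (fun k => fourierZ (tailPart (r / (4 * d)) g) k *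
        Complex.exp (-(t : ℂ) * (fourierZ Q 0 - fourierZ Q k))) x‖ ≤
          M * (4 * d) ^ (d - 1) * (√K)⁻¹ * (r / √t) := by
      have h := hQ.norm_fcoef_tailPart_le h2 hR hK ht x
      refine (mul_le_mul_of_nonneg_left h (by positivity)).trans_eq ?_
      obtain ⟨e, rfl⟩ : ∃ e, d = e + 1 := ⟨d - 1, by omega⟩
      rw [Nat.add_sub_cancel, Real.sqrt_mul hK.le, pow_succ r, div_pow]
      field_simp
    have t2 : r ^ d * ‖fcoef (fun k => fourierZ (headPart (r / (4 * d)) g) k *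
        (fourierZ (tailPart (r / (4 * d)) Q) k * jumpFactor Q (r / (4 * d)) t k)) x‖ ≤
          M * (M * (4 * d) ^ d * Real.exp (32 * d ^ 2 * M) * (K⁻¹ + (K * √K)⁻¹)) * (r / √t) := by
      have hm : IntegrableOn (fun k => fourierZ (tailPart (r / (4 * d)) Q) k *
          jumpFactor Q (r / (4 * d)) t k) (torus d) := by
        have c1 := continuous_fourierZ hQ.Q_one.1
        have c2 := continuous_fourierZ (summable_abs_headPart hQ.Q_one.1 (r / (4 * d)))
        simp only [tailPart_mul_jumpFactor hQ.Q_one.1]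
        exact integrableOn_torus_of_continuous (by fun_prop)
      have h := norm_fcoef_fourierZ_mul_le_of_forall
        (summable_abs_headPart hQ.g_one.1 (r / (4 * d)))
        ((Summable.tsum_le_tsum (abs_headPart_le _ g) (summable_abs_headPart hQ.g_one.1 _)
          hQ.g_one.1).trans hQ.g_one.2) hm
        (fun y => (le_div_iff₀' (pow_pos hr d)).2 (hQ.norm_fcoef_jump_le h2 hK hr ht htx y)) x
      refine (mul_le_mul_of_nonneg_left h (by positivity)).trans_eq ?_
      field_simp
    have t3 := hQ.norm_fcoef_head_le_of_le_sq hd hsym hK hx ht htx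
    rw [hQ.It_split t (r / (4 * d)) x]
    have t3' : M * K ^ (-((d : ℝ) / 2)) * Real.exp (20 * d ^ 2 * M) ≤
        M * K ^ (-((d : ℝ) / 2)) * Real.exp (20 * d ^ 2 * M) * (r / √t) :=
      le_mul_of_one_le_right (by positivity) hrt
    refine (mul_le_mul_of_nonneg_left norm_add₃_le (by positivity)).trans ?_
    rw [mul_add, mul_add, add_mul, add_mul]
    exact add_le_add (add_le_add t1 t2) (t3.trans t3')

end UniformBound

section Representation

variable {M K ζ : ℝ} {S J h : (Fin d → ℤ) → ℝ}

lemma ZdSymmetric.map_neg {f : (Fin d → ℤ) → ℝ} (hf : ZdSymmetric f) (y : Fin d → ℤ) :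
    f (-y) = f y := by
  exact hf.2 (fun _ => true) y

lemma tilt_zero (f : (Fin d → ℤ) → ℝ) : tilt f 0 = f := by
  funext x; simp [tilt, rdotZ_zero_left]

lemma tiltSum_eq (f : (Fin d → ℤ) → ℝ) (μ : Fin d → ℝ) : tiltSum f μ = ∑' y, tilt f μ y := rfl

lemma mem_Omega_iff (hS : ∀ x, 0 ≤ S x) {μ : Fin d → ℝ} :
    μ ∈ Omega S ↔ Summable (tilt S μ) := by
  have h0 : ∀ x, 0 ≤ S x * Real.exp (rdotZ μ x) := fun x => mul_nonneg (hS x) (Real.exp_pos _).le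
  constructor
  · intro hμ
    refine (ENNReal.summable_toReal (ne_of_lt hμ)).congr fun x => ENNReal.toReal_ofReal (h0 x)
  · intro hμ
    change chi S μ < ⊤
    rw [chi, ← ENNReal.ofReal_tsum_of_nonneg h0 hμ]
    exact ENNReal.ofReal_lt_top

lemma AssumptionOmega.summable_abs_tilt (hS : AssumptionOmega S) {μ : Fin d → ℝ}
    (hμ : μ ∈ Omega S) : Summable fun y => |tilt S μ y| :=
  ((mem_Omega_iff hS.nonneg).1 hμ).abs

lemma AssumptionJ.tilt_eq (hJ : AssumptionJ S J h M K ζ) (μ : Fin d → ℝ) (x : Fin d → ℤ) :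
    tilt S μ x = tilt h μ x + conv (tilt J μ) (tilt S μ) x := by
  rw [← tilt_conv, tilt, hJ.OZ_eq, add_mul]; rfl

lemma AssumptionJ.kernelBounds (hd : 1 ≤ d) (hJ : AssumptionJ S J h M K ζ) {μ : Fin d → ℝ}
    (hμ : μ ∈ closure (Omega S)) :
    KernelBounds M K (min ζ 1) (tilt J μ) (tilt h μ) :=
  (hJ.memQ μ hμ).kernelBounds hd hJ.M_pos.le (lt_min hJ.zeta_pos one_pos) (min_le_left _ _)

lemma AssumptionJ.fourierZ_eq (hd : 1 ≤ d) (hS : AssumptionOmega S)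
    (hJ : AssumptionJ S J h M K ζ) {μ : Fin d → ℝ} (hμ : μ ∈ Omega S) (k : Fin d → ℝ) :
    fourierZ (tilt S μ) k =
      fourierZ (tilt h μ) k + fourierZ (tilt J μ) k * fourierZ (tilt S μ) k := by
  have hQ := hJ.kernelBounds hd (subset_closure hμ)
  rw [← fourierZ_conv hQ.Q_one.1 (hS.summable_abs_tilt hμ), ← fourierZ_add hQ.g_one.1
    (summable_abs_conv hQ.Q_one.1 (hS.summable_abs_tilt hμ))]
  congr 1
  funext x
  exact hJ.tilt_eq μ x

lemma AssumptionJ.tiltSum_mul (hd : 1 ≤ d) (hS : AssumptionOmega S)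
    (hJ : AssumptionJ S J h M K ζ) {μ : Fin d → ℝ} (hμ : μ ∈ Omega S) :
    tiltSum S μ * (1 - tiltSum J μ) = tiltSum h μ := by
  have := hJ.fourierZ_eq hd hS hμ 0
  simp only [fourierZ_zero_right, ← tiltSum_eq] at this
  norm_cast at this
  linarith

lemma AssumptionJ.tiltSum_pos (hd : 1 ≤ d) (hS : AssumptionOmega S)
    (hJ : AssumptionJ S J h M K ζ) {μ : Fin d → ℝ} (hμ : μ ∈ Omega S) :
    0 < tiltSum S μ ∧ 0 < 1 - tiltSum J μ := by
  have h1 := hJ.tiltSum_mul hd hS hμ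
  have h2 := hJ.hhat_pos μ (subset_closure hμ)
  have h3 : 0 ≤ tiltSum S μ :=
    tsum_nonneg fun x => mul_nonneg (hS.nonneg x) (Real.exp_pos _).le
  rw [← h1] at h2
  rcases h3.eq_or_lt with h | h
  · rw [← h, zero_mul] at h2; exact absurd h2 (lt_irrefl _)
  · exact ⟨h, pos_of_mul_pos_right h2 h3⟩

lemma integral_exp_neg_mul_Ioi {w : ℂ} (hw : 0 < w.re) :
    ∫ t in Set.Ioi (0 : ℝ), Complex.exp (-(t : ℂ) * w) = w⁻¹ := by
  have := integral_exp_mul_complex_Ioi (a := -w) (by simpa using hw) 0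
  simp only [Complex.ofReal_zero, mul_zero, Complex.exp_zero, neg_div_neg_eq, one_div] at this
  rw [← this]
  refine integral_congr_ae (Eventually.of_forall fun t => ?_)
  simp only
  congr 1; ring

/-- Solutions of the Ornstein–Zernike equation are Laplace transforms of the heat kernel. -/
lemma AssumptionJ.integral_It (hd : 1 ≤ d) (hS : AssumptionOmega S)
    (hJ : AssumptionJ S J h M K ζ) (x : Fin d → ℤ) :
    IntegrableOn (fun t : ℝ => (Real.exp (-(t * (1 - tiltSum J 0))) : ℂ) * It J h t x)
      (Set.Ioi 0) ∧
    ∫ t in Set.Ioi (0 : ℝ), (Real.exp (-(t * (1 - tiltSum J 0))) : ℂ) * It J h t x = S x := by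
  have hQ := hJ.kernelBounds hd (subset_closure hS.zero_mem)
  have hSs := hS.summable_abs_tilt hS.zero_mem
  have hF := hJ.fourierZ_eq hd hS hS.zero_mem
  have hκ := (hJ.tiltSum_pos hd hS hS.zero_mem).2
  have hJ0 : fourierZ J 0 = (tiltSum J 0 : ℂ) := by
    rw [fourierZ_zero_right, tiltSum_eq, tilt_zero]
  simp only [tilt_zero] at hQ hSs hF
  have hM := hQ.M_nonneg
  set κ := 1 - tiltSum J 0 with hκdef
  have cJ := continuous_fourierZ hQ.Q_one.1
  have ch := continuous_fourierZ hQ.g_one.1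
  have cx := continuous_rdotZ_left x
  let Ψ : (Fin d → ℝ) × ℝ → ℂ := fun p => Complex.exp (Complex.I * (rdotZ p.1 x : ℂ)) *
    (fourierZ h p.1 * Complex.exp (-(p.2 : ℂ) * (κ + (fourierZ J 0 - fourierZ J p.1))))
  have hre : ∀ k ∈ torus d, κ ≤ (κ + (fourierZ J 0 - fourierZ J k)).re := fun k hk => by
    have := hQ.infrared k hk
    rw [Complex.add_re, Complex.ofReal_re]
    have h2 := mul_nonneg hJ.K_pos.le (sq_nonneg (enormR k))
    linarith
  have hΨ : Integrable Ψ
      ((volume.restrict (torus d)).prod (volume.restrict (Set.Ioi (0 : ℝ)))) := by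
    have hb : Integrable (fun p : (Fin d → ℝ) × ℝ => M * Real.exp (-κ * p.2))
        ((volume.restrict (torus d)).prod (volume.restrict (Set.Ioi (0 : ℝ)))) :=
      (integrable_const M).mul_prod (exp_neg_integrableOn_Ioi 0 hκ)
    refine hb.mono' (Continuous.aestronglyMeasurable (by fun_prop)) ?_
    rw [Measure.prod_restrict]
    filter_upwards [ae_restrict_mem ((measurableSet_torus d).prod measurableSet_Ioi)] with p hp
    rw [norm_mul, norm_character_pos, one_mul, norm_mul]
    gcongr
    · exact (norm_fourierZ_le hQ.g_one.1 _).trans hQ.g_one.2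
    · refine (norm_exp_neg_mul_le (le_of_lt hp.2) (hre _ hp.1)).trans_eq ?_
      congr 1; ring
  have hIt : ∀ t : ℝ, (Real.exp (-(t * κ)) : ℂ) * It J h t x =
      (((2 * π) ^ d : ℝ) : ℂ)⁻¹ * ∫ k in torus d, Ψ (k, t) := fun t => by
    rw [It_eq_fcoef, ← fcoef_const_mul, fcoef]
    congr 1
    refine integral_congr_ae (Eventually.of_forall fun k => ?_)
    simp only [Ψ]
    rw [mul_add, Complex.exp_add, Complex.ofReal_exp]
    push_cast
    rw [show -((t : ℂ) * κ) = -(t : ℂ) * κ by ring]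
    ring
  simp only [hIt]
  refine ⟨hΨ.integral_prod_right.const_mul _, ?_⟩
  rw [integral_const_mul, ← integral_integral_swap (f := fun k t => Ψ (k, t)) hΨ,
    ← fcoef_fourierZ hSs x, fcoef]
  congr 1
  refine setIntegral_congr_fun (measurableSet_torus d) fun k hk => ?_
  have hw : 0 < (κ + (fourierZ J 0 - fourierZ J k)).re := hκ.trans_le (hre k hk)
  simp only [Ψ]
  rw [integral_const_mul, integral_const_mul, integral_exp_neg_mul_Ioi hw]
  congr 1
  have hne : (κ : ℂ) + (fourierZ J 0 - fourierZ J k) ≠ 0 := fun h0 => by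
    rw [h0] at hw; simp at hw
  rw [mul_inv_eq_iff_eq_mul₀ hne, hJ0, hκdef]
  push_cast
  linear_combination -hF k

lemma sigma_scaling {r σ : ℝ} (hd : 1 ≤ d) (hr : 0 < r) (hσ : 0 < σ) :
    σ * r ^ ((d : ℝ) - 2) / d * (d * r ^ 2 / σ) = r ^ d := by
  have : (0 : ℝ) < d := by exact_mod_cast hd
  have h2 : r ^ ((d : ℝ) - 2) * r ^ 2 = r ^ d := by
    rw [← Real.rpow_natCast r 2, ← Real.rpow_add hr, ← Real.rpow_natCast]
    congr 1; push_cast; ring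
  rw [← h2]
  field_simp

/-- The diffusively rescaled representation of the two-point function. -/
lemma AssumptionJ.integral_It_scaled (hd : 1 ≤ d) (hS : AssumptionOmega S)
    (hJ : AssumptionJ S J h M K ζ) {x : Fin d → ℤ} (hx : x ≠ 0) {σ : ℝ} (hσ : 0 < σ) :
    IntegrableOn (fun τ : ℝ =>
      (Real.exp (-(d * enormZ x ^ 2 / σ * (1 - tiltSum J 0) * τ)) : ℂ) *
        ((enormZ x ^ d : ℝ) * It J h (d * enormZ x ^ 2 / σ * τ) x)) (Set.Ioi 0) ∧
    ∫ τ in Set.Ioi (0 : ℝ), (Real.exp (-(d * enormZ x ^ 2 / σ * (1 - tiltSum J 0) * τ)) : ℂ) *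
        ((enormZ x ^ d : ℝ) * It J h (d * enormZ x ^ 2 / σ * τ) x) =
      ((S x * σ * enormZ x ^ ((d : ℝ) - 2) / d : ℝ) : ℂ) := by
  obtain ⟨h1, h2⟩ := hJ.integral_It hd hS x
  have hr := enormZ_pos hx
  have hd0 : (0 : ℝ) < d := by exact_mod_cast hd
  have hl : 0 < d * enormZ x ^ 2 / σ := by positivity
  have hsc := sigma_scaling hd hr hσ
  set l := d * enormZ x ^ 2 / σ with hldef
  have heq : (fun τ : ℝ => (Real.exp (-(l * (1 - tiltSum J 0) * τ)) : ℂ) *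
      ((enormZ x ^ d : ℝ) * It J h (l * τ) x)) = fun τ : ℝ => ((enormZ x ^ d : ℝ) : ℂ) *
        ((Real.exp (-((l * τ) * (1 - tiltSum J 0))) : ℂ) * It J h (l * τ) x) := by
    funext τ
    rw [show l * (1 - tiltSum J 0) * τ = (l * τ) * (1 - tiltSum J 0) by ring]
    ring
  rw [heq]
  constructor
  · refine Integrable.const_mul ?_ _
    have := (integrableOn_Ioi_comp_mul_left_iff (fun t : ℝ =>
      (Real.exp (-(t * (1 - tiltSum J 0))) : ℂ) * It J h t x) 0 hl).2 (by simpa using h1)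
    exact this
  · rw [integral_const_mul, integral_comp_mul_left_Ioi (fun t : ℝ =>
      (Real.exp (-(t * (1 - tiltSum J 0))) : ℂ) * It J h t x) 0 hl, mul_zero, h2, ← hsc,
      Complex.real_smul, ← mul_assoc, ← Complex.ofReal_mul, mul_inv_cancel_right₀ hl.ne',
      ← Complex.ofReal_mul]
    congr 1
    ring

end Representation

section Taylor

lemma rpow_le_abs_rpow_two_add {w θ : ℝ} (hθ : 0 < θ) (hw : 1 ≤ |w|) : w ^ 2 ≤ |w| ^ (2 + θ) := by
  rw [← sq_abs, ← Real.rpow_natCast]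
  exact Real.rpow_le_rpow_of_exponent_le hw (by push_cast; linarith)

lemma pow_four_le_abs_rpow_two_add {w θ : ℝ} (hθ : 0 < θ) (hθ1 : θ ≤ 1) (hw : |w| ≤ 1) :
    |w| ^ 4 ≤ |w| ^ (2 + θ) := by
  rw [← Real.rpow_natCast]
  exact Real.rpow_le_rpow_of_exponent_ge' (abs_nonneg _) hw (by linarith) (by push_cast; linarith)

lemma abs_one_sub_cos_sub_le {θ : ℝ} (hθ : 0 < θ) (hθ1 : θ ≤ 1) (w : ℝ) :
    |1 - Real.cos w - w ^ 2 / 2| ≤ |w| ^ (2 + θ) := by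
  rcases le_total |w| 1 with hw | hw
  · have h1 := Real.cos_bound hw
    rw [show 1 - Real.cos w - w ^ 2 / 2 = -(Real.cos w - (1 - w ^ 2 / 2)) by ring, abs_neg]
    have h2 := pow_four_le_abs_rpow_two_add hθ hθ1 hw
    have h3 : 0 ≤ |w| ^ 4 := by positivity
    linarith
  · have h1 := Real.one_sub_sq_div_two_le_cos (x := w)
    have h2 := rpow_le_abs_rpow_two_add hθ hw
    have h3 := Real.cos_le_one w
    rw [abs_le]
    constructor <;> nlinarith [sq_nonneg w]

lemma one_add_sq_div_two_le_cosh (w : ℝ) : 1 + w ^ 2 / 2 ≤ Real.cosh w := by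
  have h1 := cosh_eq_one_add_two_mul_sinh_sq w
  have h2 : (w / 2) ^ 2 ≤ Real.sinh (w / 2) ^ 2 := by
    rw [← sq_abs, ← sq_abs (Real.sinh _), Real.abs_sinh]
    gcongr
    exact Real.self_le_sinh_iff.2 (abs_nonneg _)
  nlinarith

lemma abs_cosh_sub_one_sub_le {θ : ℝ} (hθ : 0 < θ) (hθ1 : θ ≤ 1) (w : ℝ) :
    |Real.cosh w - 1 - w ^ 2 / 2| ≤ |w| ^ (2 + θ) * Real.cosh w := by
  have h0 := one_add_sq_div_two_le_cosh w
  have hc := Real.cosh_pos w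
  rw [abs_of_nonneg (by linarith)]
  rcases le_total |w| 1 with hw | hw
  · have h1 := cosh_eq_one_add_two_mul_sinh_sq w
    have h2 := sinh_sq_le (w / 2)
    have h3 := Real.cosh_sq (w / 2)
    have h4 := cosh_half_sq_le w
    have h5 := mul_le_mul_of_nonneg_right (pow_four_le_abs_rpow_two_add hθ hθ1 hw) hc.le
    have h6 : |w| ^ 4 = w ^ 4 := by rw [← abs_pow, abs_of_nonneg (by positivity)]
    have h7 := mul_le_mul_of_nonneg_left h2 (sq_nonneg (w / 2))
    have h8 := mul_le_mul_of_nonneg_left h4 (show (0 : ℝ) ≤ w ^ 4 by positivity)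
    have h9 : 0 ≤ w ^ 4 * Real.cosh w := by positivity
    rw [h6] at h5
    rw [h3] at h2
    nlinarith
  · have h1 := cosh_sub_one_le w
    have h2 := mul_le_mul_of_nonneg_right (rpow_le_abs_rpow_two_add hθ hw) hc.le
    nlinarith [sq_nonneg w]

variable {J : (Fin d → ℤ) → ℝ}

lemma abs_coord_le_enormZ (y : Fin d → ℤ) (i : Fin d) : |(y i : ℝ)| ≤ enormZ y := by
  refine Real.abs_le_sqrt ?_
  exact Finset.single_le_sum (f := fun i => (y i : ℝ) ^ 2) (fun j _ => sq_nonneg _)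
    (Finset.mem_univ i)

lemma summable_second_moment (hJ2 : Summable fun y => enormZ y ^ 2 * |J y|) (i j : Fin d) :
    Summable fun y : Fin d → ℤ => J y * ((y i : ℝ) * y j) := by
  refine Summable.of_norm_bounded hJ2 fun y => ?_
  rw [Real.norm_eq_abs, abs_mul, abs_mul, mul_comm, sq]
  gcongr
  · exact enormZ_nonneg y
  · exact abs_coord_le_enormZ y i
  · exact abs_coord_le_enormZ y j

/-- The equivalence of the lattice permuting coordinates. -/
def permEquiv (σ : Equiv.Perm (Fin d)) : (Fin d → ℤ) ≃ (Fin d → ℤ) where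
  toFun x i := x (σ i)
  invFun x i := x (σ.symm i)
  left_inv x := by simp
  right_inv x := by simp

/-- The equivalence of the lattice flipping the sign of some coordinates. -/
def flipEquiv (ε : Fin d → Bool) : (Fin d → ℤ) ≃ (Fin d → ℤ) :=
  Function.Involutive.toPerm (fun x i => if ε i then -(x i) else x i) fun x => by
    funext i
    by_cases h : ε i <;> simp [h]

lemma second_moment_off_diag (hJ : ZdSymmetric J) {i j : Fin d} (hij : i ≠ j) :
    ∑' y : Fin d → ℤ, J y * ((y i : ℝ) * y j) = 0 := by
  have h := (flipEquiv (fun l => decide (l = i))).tsum_eq fun y => J y * ((y i : ℝ) * y j)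
  have h2 : ∀ y : Fin d → ℤ, J (flipEquiv (fun l => decide (l = i)) y) *
      (((flipEquiv (fun l => decide (l = i)) y) i : ℝ) *
        (flipEquiv (fun l => decide (l = i)) y) j) = -(J y * ((y i : ℝ) * y j)) := fun y => by
    have h3 : J (flipEquiv (fun l => decide (l = i)) y) = J y := hJ.2 _ y
    rw [h3]
    simp [flipEquiv, hij.symm]
  simp only [h2, tsum_neg] at h
  linarith

lemma second_moment_diag (hJ : ZdSymmetric J) (i j : Fin d) :
    ∑' y : Fin d → ℤ, J y * ((y i : ℝ) * y i) = ∑' y : Fin d → ℤ, J y * ((y j : ℝ) * y j) := by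
  have h := (permEquiv (Equiv.swap i j)).tsum_eq fun y => J y * ((y i : ℝ) * y i)
  rw [← h]
  refine tsum_congr fun y => ?_
  have h3 : J (permEquiv (Equiv.swap i j) y) = J y := hJ.1 _ y
  rw [h3]
  simp [permEquiv]

lemma second_moment_diag_eq (hJ : ZdSymmetric J)
    (hJ2 : Summable fun y => enormZ y ^ 2 * |J y|) (i : Fin d) :
    ∑' y : Fin d → ℤ, J y * ((y i : ℝ) * y i) = sigmaSq J / d := by
  have hd : (d : ℝ) ≠ 0 := by
    have := i.pos
    positivity
  rw [eq_div_iff hd]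
  have : sigmaSq J = ∑ j : Fin d, ∑' y : Fin d → ℤ, J y * ((y j : ℝ) * y j) := by
    rw [← Summable.tsum_finsetSum fun j _ => summable_second_moment hJ2 j j, sigmaSq]
    refine tsum_congr fun y => ?_
    rw [enormZ_sq, mul_comm, Finset.mul_sum]
    exact Finset.sum_congr rfl fun j _ => by ring
  rw [this, Finset.sum_congr rfl fun j _ => second_moment_diag hJ j i]
  simp [mul_comm]

/-- Isotropy of the covariance of a symmetric kernel. -/
lemma hasSum_mul_rdotZ_sq (hJ : ZdSymmetric J)
    (hJ2 : Summable fun y => enormZ y ^ 2 * |J y|) (k : Fin d → ℝ) :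
    HasSum (fun y => J y * rdotZ k y ^ 2) (enormR k ^ 2 * (sigmaSq J / d)) := by
  have hterm : ∀ y : Fin d → ℤ, J y * rdotZ k y ^ 2 =
      ∑ i, ∑ j, (k i * k j) * (J y * ((y i : ℝ) * y j)) := fun y => by
    rw [rdotZ, sq, Finset.sum_mul_sum, Finset.mul_sum]
    refine Finset.sum_congr rfl fun i _ => ?_
    rw [Finset.mul_sum]
    exact Finset.sum_congr rfl fun j _ => by ring
  have hval : enormR k ^ 2 * (sigmaSq J / d) =
      ∑ i, ∑ j, (k i * k j) * ∑' y : Fin d → ℤ, J y * ((y i : ℝ) * y j) := by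
    rw [enormR_sq, Finset.sum_mul]
    refine Finset.sum_congr rfl fun i _ => ?_
    rw [Finset.sum_eq_single i, second_moment_diag_eq hJ hJ2, sq]
    · intro j _ hj
      rw [second_moment_off_diag hJ hj.symm, mul_zero]
    · simp
  rw [hval]
  refine HasSum.congr_fun ?_ hterm
  exact hasSum_sum fun i _ => hasSum_sum fun j _ =>
    ((summable_second_moment hJ2 i j).hasSum).mul_left _

variable {M K θ : ℝ} {g : (Fin d → ℤ) → ℝ}

lemma abs_rdotZ_rpow_le {e : ℝ} (he : 0 ≤ e) (k : Fin d → ℝ) (y : Fin d → ℤ) :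
    |rdotZ k y| ^ e ≤ enormR k ^ e * enormZ y ^ e := by
  rw [← Real.mul_rpow (enormR_nonneg k) (enormZ_nonneg y)]
  exact Real.rpow_le_rpow (abs_nonneg _) (abs_rdotZ_le k y) he

lemma KernelBounds.norm_fourierZ_sub_sub_le (hQ : KernelBounds M K θ J g) (hJ : ZdSymmetric J)
    (hθ : 0 < θ) (hθ1 : θ ≤ 1) (k : Fin d → ℝ) :
    ‖fourierZ J 0 - fourierZ J k - ((enormR k ^ 2 * (sigmaSq J / d) / 2 : ℝ) : ℂ)‖ ≤
      M * enormR k ^ (2 + θ) := by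
  have hs := hQ.Q_one.1
  have hcos : Summable fun y => J y * Real.cos (rdotZ k y) := by
    refine Summable.of_norm_bounded hs fun y => ?_
    rw [norm_mul, Real.norm_eq_abs, Real.norm_eq_abs]
    exact mul_le_of_le_one_right (abs_nonneg _) (Real.abs_cos_le_one _)
  have hk : fourierZ J k = ((∑' y, J y * Real.cos (rdotZ k y) : ℝ) : ℂ) := by
    apply Complex.ext
    · rw [fourierZ_re hs, Complex.ofReal_re]
    · rw [fourierZ_im hs hJ.map_neg, Complex.ofReal_im]
  have h2 := hasSum_mul_rdotZ_sq hJ hQ.Q_two.1 k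
  have hsum := ((hs.of_abs.hasSum.sub hcos.hasSum).sub (h2.div_const 2))
  have hterm : ∀ y, ‖J y - J y * Real.cos (rdotZ k y) - J y * rdotZ k y ^ 2 / 2‖ ≤
      enormR k ^ (2 + θ) * (enormZ y ^ (2 + θ) * |J y|) := fun y => by
    rw [show J y - J y * Real.cos (rdotZ k y) - J y * rdotZ k y ^ 2 / 2 =
      J y * (1 - Real.cos (rdotZ k y) - rdotZ k y ^ 2 / 2) by ring, norm_mul, Real.norm_eq_abs,
      Real.norm_eq_abs, ← mul_assoc, mul_comm]
    gcongr
    exact (abs_one_sub_cos_sub_le hθ hθ1 _).trans (abs_rdotZ_rpow_le (by linarith) k y)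
  have hb := tsum_of_norm_bounded (hQ.Q_theta.1.mul_left (enormR k ^ (2 + θ))).hasSum hterm
  rw [hsum.tsum_eq, tsum_mul_left, Real.norm_eq_abs] at hb
  rw [fourierZ_zero_right, hk, ← Complex.ofReal_sub, ← Complex.ofReal_sub, Complex.norm_real,
    Real.norm_eq_abs]
  refine hb.trans ?_
  rw [mul_comm]
  gcongr
  · exact Real.rpow_nonneg (enormR_nonneg k) _
  · exact hQ.Q_theta.2

lemma KernelBounds.abs_tiltSum_sub_sub_le {g' : (Fin d → ℤ) → ℝ} (hQ : KernelBounds M K θ J g)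
    (hJ : ZdSymmetric J) (hθ : 0 < θ) (hθ1 : θ ≤ 1) {μ : Fin d → ℝ}
    (hQμ : KernelBounds M K θ (tilt J μ) g') :
    |tiltSum J μ - tiltSum J 0 - enormR μ ^ 2 * (sigmaSq J / d) / 2| ≤
      M * enormR μ ^ (2 + θ) := by
  have hs := hQ.Q_one.1
  have hneg : ∀ f : (Fin d → ℤ) → ℝ, Summable f → HasSum (fun y => f (-y)) (∑' y, f y) :=
    fun f hf => (Equiv.neg (Fin d → ℤ)).hasSum_iff.2 hf.hasSum
  have h1 := hQμ.Q_one.1.of_abs.hasSum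
  have h1' := hneg _ hQμ.Q_one.1.of_abs
  have h2 := hasSum_mul_rdotZ_sq hJ hQ.Q_two.1 μ
  have hcosh : ∀ y, (tilt J μ y + tilt J μ (-y)) / 2 = J y * Real.cosh (rdotZ μ y) := fun y => by
    rw [tilt, tilt, rdotZ_neg_right, hJ.map_neg, Real.cosh_eq]; ring
  have hc : HasSum (fun y => J y * Real.cosh (rdotZ μ y)) (tiltSum J μ) := by
    have := (h1.add h1').div_const 2
    simp only [hcosh] at this
    rwa [add_self_div_two] at this
  have hsum := (hc.sub hs.of_abs.hasSum).sub (h2.div_const 2)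
  have hW := hQμ.Q_theta.1.hasSum
  have hW' := hneg _ hQμ.Q_theta.1
  have hWc : HasSum (fun y => enormZ y ^ (2 + θ) * (|J y| * Real.cosh (rdotZ μ y)))
      (∑' y, enormZ y ^ (2 + θ) * |tilt J μ y|) := by
    have := (hW.add hW').div_const 2
    rw [add_self_div_two] at this
    refine this.congr_fun fun y => ?_
    rw [tilt, tilt, rdotZ_neg_right, hJ.map_neg, Real.cosh_eq, enormZ_neg, abs_mul, abs_mul,
      Real.abs_exp, Real.abs_exp]
    ring
  have hterm : ∀ y, ‖J y * Real.cosh (rdotZ μ y) - J y - J y * rdotZ μ y ^ 2 / 2‖ ≤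
      enormR μ ^ (2 + θ) * (enormZ y ^ (2 + θ) * (|J y| * Real.cosh (rdotZ μ y))) := fun y => by
    rw [show J y * Real.cosh (rdotZ μ y) - J y - J y * rdotZ μ y ^ 2 / 2 =
      J y * (Real.cosh (rdotZ μ y) - 1 - rdotZ μ y ^ 2 / 2) by ring, norm_mul, Real.norm_eq_abs,
      Real.norm_eq_abs]
    have hcp := Real.cosh_pos (rdotZ μ y)
    calc _ ≤ |J y| * ((enormR μ ^ (2 + θ) * enormZ y ^ (2 + θ)) * Real.cosh (rdotZ μ y)) := by
          gcongr
          refine (abs_cosh_sub_one_sub_le hθ hθ1 _).trans ?_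
          gcongr
          exact abs_rdotZ_rpow_le (by linarith) μ y
      _ = _ := by ring
  have hb := tsum_of_norm_bounded (hWc.mul_left (enormR μ ^ (2 + θ))) hterm
  rw [hsum.tsum_eq, Real.norm_eq_abs] at hb
  have h0 : tiltSum J 0 = ∑' y, J y := by rw [tiltSum_eq, tilt_zero]
  rw [h0]
  refine hb.trans ?_
  rw [mul_comm]
  gcongr
  · exact Real.rpow_nonneg (enormR_nonneg μ) _
  · exact hQμ.Q_theta.2

end Taylor

section Variance

variable {M K θ : ℝ} {J g : (Fin d → ℤ) → ℝ}

lemma KernelBounds.sigmaSq_le (hQ : KernelBounds M K θ J g) : sigmaSq J ≤ M := by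
  refine le_trans ?_ hQ.Q_two.2
  refine Summable.tsum_le_tsum (fun y => ?_) ?_ hQ.Q_two.1
  · gcongr
    exact le_abs_self _
  · refine Summable.of_norm_bounded hQ.Q_two.1 fun y => ?_
    rw [norm_mul, Real.norm_eq_abs, Real.norm_eq_abs, abs_of_nonneg (sq_nonneg (enormZ y))]

lemma enormR_e1R (hd : 1 ≤ d) {t : ℝ} (ht : 0 ≤ t) : enormR (e1R d t) = t := by
  obtain ⟨n, rfl⟩ : ∃ n, d = n + 1 := ⟨d - 1, by omega⟩
  have h : ∀ i : Fin (n + 1), e1R (n + 1) t i = if i = 0 then t else 0 := fun i => by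
    simp only [e1R, Fin.ext_iff, Fin.val_zero]
  simp only [enormR, h, ite_pow]
  simp [Real.sqrt_sq ht]

/-- The infrared bound gives a lower bound on the variance. -/
lemma KernelBounds.le_sigmaSq (hd : 1 ≤ d) (hQ : KernelBounds M K θ J g) (hJ : ZdSymmetric J)
    (hθ : 0 < θ) (hθ1 : θ ≤ 1) : 2 * K * d ≤ sigmaSq J := by
  have hd0 : (0 : ℝ) < d := by exact_mod_cast hd
  have key : ∀ ε : ℝ, 0 < ε → ε ≤ π → K ≤ sigmaSq J / d / 2 + M * ε ^ θ := fun ε hε hεπ => by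
    have hn := enormR_e1R hd hε.le
    have h1 := hQ.infrared (e1R d ε) ((mem_torus_iff).2 fun i => by
      rw [e1R]; split_ifs
      · rwa [abs_of_pos hε]
      · simpa using Real.pi_pos.le)
    have h2 := (Complex.abs_re_le_norm _).trans
      (hQ.norm_fourierZ_sub_sub_le hJ hθ hθ1 (e1R d ε))
    rw [Complex.sub_re, Complex.ofReal_re] at h2
    have h3 := (abs_le.1 h2).2
    rw [hn] at h1 h3
    rw [Real.rpow_add hε, Real.rpow_two] at h3
    have h4 : ε ^ 2 * K ≤ ε ^ 2 * (sigmaSq J / d / 2 + M * ε ^ θ) := by linarith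
    exact le_of_mul_le_mul_left h4 (by positivity)
  have hlim : Tendsto (fun ε : ℝ => sigmaSq J / d / 2 + M * ε ^ θ) (𝓝[>] 0)
      (𝓝 (sigmaSq J / d / 2 + M * 0)) := by
    have : Tendsto (fun ε : ℝ => ε ^ θ) (𝓝[>] 0) (𝓝 0) := by
      have := (Real.continuousAt_rpow_const 0 θ (Or.inr hθ.le)).tendsto
      rw [Real.zero_rpow hθ.ne'] at this
      exact this.mono_left nhdsWithin_le_nhds
    exact (this.const_mul M).const_add _
  have h5 : K ≤ sigmaSq J / d / 2 + M * 0 := by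
    refine ge_of_tendsto hlim ?_
    filter_upwards [Ioc_mem_nhdsGT Real.pi_pos] with ε hε using key ε hε.1 hε.2
  rw [mul_zero, add_zero, div_div, le_div_iff₀ (by positivity)] at h5
  linarith

end Variance

section OmegaGeometry

variable {S : (Fin d → ℤ) → ℝ}

lemma Omega_flip (hS : AssumptionOmega S) {μ : Fin d → ℝ} (hμ : μ ∈ Omega S)
    (ε : Fin d → Bool) : (fun i => if ε i then -(μ i) else μ i) ∈ Omega S := by
  rw [mem_Omega_iff hS.nonneg] at hμ ⊢
  refine ((flipEquiv ε).summable_iff.2 hμ).congr fun y => ?_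
  have h3 : S (flipEquiv ε y) = S y := hS.symm.2 _ y
  rw [Function.comp_apply, tilt, tilt, h3]
  congr 2
  refine Finset.sum_congr rfl fun i _ => ?_
  change μ i * ((if ε i then -(y i) else y i : ℤ) : ℝ) = (if ε i then -(μ i) else μ i) * (y i : ℝ)
  by_cases h : ε i <;> simp [h]

lemma Omega_perm (hS : AssumptionOmega S) {μ : Fin d → ℝ} (hμ : μ ∈ Omega S)
    (σ : Equiv.Perm (Fin d)) : (fun i => μ (σ i)) ∈ Omega S := by
  rw [mem_Omega_iff hS.nonneg] at hμ ⊢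
  refine ((permEquiv σ.symm).summable_iff.2 hμ).congr fun y => ?_
  have h3 : S (permEquiv σ.symm y) = S y := hS.symm.1 _ y
  rw [Function.comp_apply, tilt, tilt, h3]
  congr 2
  rw [rdotZ, rdotZ, ← Equiv.sum_comp σ]
  simp [permEquiv]

lemma convex_Omega (hS : ∀ x, 0 ≤ S x) : Convex ℝ (Omega S) := by
  intro μ hμ ν hν a b ha hb hab
  rw [mem_Omega_iff hS] at hμ hν ⊢
  refine Summable.of_nonneg_of_le (fun x => mul_nonneg (hS x) (Real.exp_pos _).le) (fun x => ?_)
    ((hμ.mul_left a).add (hν.mul_left b))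
  have h := convexOn_exp.2 (Set.mem_univ (rdotZ μ x)) (Set.mem_univ (rdotZ ν x)) ha hb hab
  simp only [smul_eq_mul] at h
  have h2 : rdotZ (a • μ + b • ν) x = a * rdotZ μ x + b * rdotZ ν x := by
    simp only [rdotZ, Finset.mul_sum, ← Finset.sum_add_distrib, Pi.add_apply, Pi.smul_apply,
      smul_eq_mul]
    exact Finset.sum_congr rfl fun i _ => by ring
  rw [tilt, tilt, tilt, h2]
  calc _ ≤ S x * (a * Real.exp (rdotZ μ x) + b * Real.exp (rdotZ ν x)) := by
        gcongr
        exact hS x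
    _ = _ := by ring

lemma smul_mem_Omega (hS : AssumptionOmega S) {μ : Fin d → ℝ} (hμ : μ ∈ Omega S) {c : ℝ}
    (hc : 0 ≤ c) (hc1 : c ≤ 1) : c • μ ∈ Omega S :=
  (convex_Omega hS.nonneg).smul_mem_of_zero_mem hS.zero_mem hμ ⟨hc, hc1⟩

lemma e1R_smul (a t : ℝ) : e1R d (a * t) = a • e1R d t := by
  funext i
  simp [e1R]

lemma bddAbove_mass_set (hS : AssumptionOmega S) :
    BddAbove {t : ℝ | 0 ≤ t ∧ chi S (e1R d t) < ⊤} := by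
  obtain ⟨a, ha, hna⟩ := hS.exists_not_mem
  refine ⟨a, fun t ht => ?_⟩
  by_contra! hlt
  refine hna ?_
  have ht0 : 0 < t := ha.trans hlt
  have := smul_mem_Omega hS (μ := e1R d t) ht.2 (c := a / t) (by positivity)
    ((div_le_one ht0).2 hlt.le)
  rwa [← e1R_smul, div_mul_cancel₀ _ ht0.ne'] at this

lemma abs_coord_le_mass_of_mem (hS : AssumptionOmega S) {μ : Fin d → ℝ} (hμ : μ ∈ Omega S)
    (i : Fin d) : |μ i| ≤ mass S := by
  refine le_csSup (bddAbove_mass_set hS) ⟨abs_nonneg _, ?_⟩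
  obtain ⟨n, rfl⟩ : ∃ n, d = n + 1 := ⟨d - 1, by have := i.pos; omega⟩
  change e1R (n + 1) |μ i| ∈ Omega S
  have h1 := convex_Omega hS.nonneg hμ (Omega_flip hS hμ fun j => decide (j ≠ i))
    (by norm_num : (0 : ℝ) ≤ 1 / 2) (by norm_num : (0 : ℝ) ≤ 1 / 2) (by norm_num)
  have h2 := Omega_perm hS h1 (Equiv.swap i 0)
  have h3 := Omega_flip hS h2 fun _ => decide (μ i < 0)
  convert h3 using 1
  funext j
  by_cases hj : j = 0
  · subst hj
    by_cases hneg : μ i < 0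
    · simp [e1R, hneg, abs_of_neg hneg]; ring
    · simp [e1R, hneg, abs_of_nonneg (not_lt.1 hneg)]; ring
  · have hj2 : Equiv.swap i 0 j ≠ i := fun h => hj <| by
      rw [← Equiv.swap_apply_left i 0] at h
      have := congrArg (Equiv.swap i 0) h
      simpa using this
    have hj3 : (j : ℕ) ≠ 0 := fun h => hj (Fin.ext h)
    simp [e1R, hj2, hj3]

lemma abs_coord_le_mass (hS : AssumptionOmega S) {μ : Fin d → ℝ} (hμ : μ ∈ closure (Omega S))
    (i : Fin d) : |μ i| ≤ mass S := by
  refine closure_minimal (t := {μ : Fin d → ℝ | |μ i| ≤ mass S})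
    (fun μ hμ => abs_coord_le_mass_of_mem hS hμ i) ?_ hμ
  exact isClosed_le (by fun_prop) continuous_const

lemma mass_nonneg (S : (Fin d → ℤ) → ℝ) : 0 ≤ mass S := Real.sSup_nonneg fun _ ht => ht.1

lemma enormR_le_mass (hS : AssumptionOmega S) {μ : Fin d → ℝ} (hμ : μ ∈ closure (Omega S)) :
    enormR μ ≤ √d * mass S := by
  rw [enormR, ← Real.sqrt_sq (mass_nonneg S), ← Real.sqrt_mul (by positivity)]
  refine Real.sqrt_le_sqrt ?_
  calc ∑ i, μ i ^ 2 ≤ ∑ _i : Fin d, mass S ^ 2 := Finset.sum_le_sum fun i _ => by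
        rw [← sq_abs]
        gcongr
        exact abs_coord_le_mass hS hμ i
    _ = _ := by simp

lemma exists_pos_smul_mem_Omega (hS : AssumptionOmega S) (v : Fin d → ℝ) {c : ℝ}
    (hc : c • v ∈ Omega S) : ∃ c' > c, c' • v ∈ Omega S := by
  have hcont : ContinuousAt (fun t : ℝ => t • v) c := by fun_prop
  have := hcont.eventually (hS.open_Omega.mem_nhds hc)
  have h2 : ∀ᶠ t in 𝓝[>] c, t • v ∈ Omega S := this.filter_mono nhdsWithin_le_nhds
  obtain ⟨c', h3, h4⟩ := (h2.and self_mem_nhdsWithin).exists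
  exact ⟨c', h4, h3⟩

lemma mass_pos (hS : AssumptionOmega S) : 0 < mass S := by
  have h0 : (0 : ℝ) • e1R d 1 ∈ Omega S := by rw [zero_smul]; exact hS.zero_mem
  obtain ⟨c, hc, hc2⟩ := exists_pos_smul_mem_Omega hS _ h0
  rw [← e1R_smul, mul_one] at hc2
  exact lt_of_lt_of_le hc (le_csSup (bddAbove_mass_set hS) ⟨le_of_lt hc, hc2⟩)

lemma mass_mul_normS (hS : AssumptionOmega S) (x : Fin d → ℤ) :
    mass S * normS S (toR x) = sSup ((fun μ => rdotZ μ x) '' closure (Omega S)) := by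
  rw [normS, mul_div_cancel₀ _ (mass_pos hS).ne']
  rfl

lemma bddAbove_rdotZ_image (hS : AssumptionOmega S) (x : Fin d → ℤ) :
    BddAbove ((fun μ => rdotZ μ x) '' closure (Omega S)) := by
  refine ⟨√d * mass S * enormZ x, ?_⟩
  rintro _ ⟨μ, hμ, rfl⟩
  refine (le_abs_self _).trans ((abs_rdotZ_le μ x).trans ?_)
  exact mul_le_mul_of_nonneg_right (enormR_le_mass hS hμ) (enormZ_nonneg x)

/-- The extremal multiple of a nonzero vector in the domain of finite susceptibility. -/
lemma exists_extremal_smul (hS : AssumptionOmega S) {v : Fin d → ℝ} (hv : v ≠ 0) :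
    ∃ ρ : ℝ, 0 < ρ ∧ ρ • v ∉ Omega S ∧ ∀ c, 0 ≤ c → c < ρ → c • v ∈ Omega S := by
  let T : Set ℝ := {c | 0 ≤ c ∧ c • v ∈ Omega S}
  have hbdd : BddAbove T := by
    obtain ⟨i, hi⟩ := Function.ne_iff.1 hv
    have hi' : 0 < |v i| := abs_pos.2 hi
    refine ⟨mass S / |v i|, fun c hc => ?_⟩
    have := abs_coord_le_mass_of_mem hS hc.2 i
    rw [Pi.smul_apply, smul_eq_mul, abs_mul, abs_of_nonneg hc.1] at this
    rwa [le_div_iff₀ hi']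
  have h0 : (0 : ℝ) • v ∈ Omega S := by rw [zero_smul]; exact hS.zero_mem
  have hstep : ∀ c ∈ T, c < sSup T := fun c hc => by
    obtain ⟨c', h1, h2⟩ := exists_pos_smul_mem_Omega hS v hc.2
    exact lt_of_lt_of_le h1 (le_csSup hbdd ⟨hc.1.trans (le_of_lt h1), h2⟩)
  have hpos : 0 < sSup T := hstep 0 ⟨le_rfl, h0⟩
  refine ⟨sSup T, hpos, fun h => lt_irrefl _ (hstep _ ⟨hpos.le, h⟩), fun c hc hlt => ?_⟩
  obtain ⟨b, hb, hcb⟩ := exists_lt_of_lt_csSup (show T.Nonempty from ⟨0, le_rfl, h0⟩) hlt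
  have hb0 : 0 < b := hc.trans_lt hcb
  have := smul_mem_Omega hS hb.2 (c := c / b) (by positivity) ((div_le_one hb0).2 hcb.le)
  rwa [smul_smul, div_mul_cancel₀ _ hb0.ne'] at this

end OmegaGeometry

section MassGap

variable {M K ζ : ℝ} {S J h : (Fin d → ℤ) → ℝ}

lemma AssumptionJ.theta_pos (hJ : AssumptionJ S J h M K ζ) : 0 < min ζ 1 :=
  lt_min hJ.zeta_pos one_pos

lemma AssumptionJ.kernelBounds_zero (hd : 1 ≤ d) (hS : AssumptionOmega S)
    (hJ : AssumptionJ S J h M K ζ) : KernelBounds M K (min ζ 1) J h := by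
  simpa only [tilt_zero] using hJ.kernelBounds hd (subset_closure hS.zero_mem)

lemma AssumptionJ.abs_tiltSum_sub_sub_le (hd : 1 ≤ d) (hS : AssumptionOmega S)
    (hJ : AssumptionJ S J h M K ζ) {μ : Fin d → ℝ} (hμ : μ ∈ closure (Omega S)) :
    |tiltSum J μ - tiltSum J 0 - enormR μ ^ 2 * (sigmaSq J / d) / 2| ≤
      M * enormR μ ^ (2 + min ζ 1) :=
  (hJ.kernelBounds_zero hd hS).abs_tiltSum_sub_sub_le hJ.J_symm hJ.theta_pos (min_le_right _ _)
    (hJ.kernelBounds hd hμ)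

lemma AssumptionJ.le_one_sub_tiltSum (hd : 1 ≤ d) (hS : AssumptionOmega S)
    (hJ : AssumptionJ S J h M K ζ) {μ : Fin d → ℝ} (hμ : μ ∈ closure (Omega S)) :
    enormR μ ^ 2 * (sigmaSq J / d) / 2 - M * enormR μ ^ (2 + min ζ 1) ≤ 1 - tiltSum J 0 := by
  have hθ := hJ.theta_pos
  refine closure_minimal (t := {μ : Fin d → ℝ | enormR μ ^ 2 * (sigmaSq J / d) / 2 -
    M * enormR μ ^ (2 + min ζ 1) ≤ 1 - tiltSum J 0}) (fun ν hν => ?_) ?_ hμ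
  · have h1 := (abs_le.1 (hJ.abs_tiltSum_sub_sub_le hd hS (subset_closure hν))).1
    have h2 := (hJ.tiltSum_pos hd hS hν).2
    change enormR ν ^ 2 * (sigmaSq J / d) / 2 - M * enormR ν ^ (2 + min ζ 1) ≤ 1 - tiltSum J 0
    linarith
  · have hc := continuous_enormR (d := d)
    refine isClosed_le ?_ continuous_const
    exact (((hc.pow 2).mul_const _).div_const _).sub
      ((hc.rpow_const fun _ => Or.inr (by linarith)).const_mul M)

/-- In each direction the mass gap is controlled by the extremal tilt. -/
lemma AssumptionJ.exists_one_sub_tiltSum_le (hd : 1 ≤ d) (hS : AssumptionOmega S)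
    (hJ : AssumptionJ S J h M K ζ) {x : Fin d → ℤ} (hx : x ≠ 0) :
    ∃ μ ∈ closure (Omega S), enormR μ * enormZ x = rdotZ μ x ∧
      1 - tiltSum J 0 ≤ enormR μ ^ 2 * (sigmaSq J / d) / 2 + M * enormR μ ^ (2 + min ζ 1) := by
  have hθ := hJ.theta_pos
  have hv : toR x ≠ 0 := fun h0 => hx <| by
    funext i
    have := congrFun h0 i
    simpa [toR] using this
  obtain ⟨ρ, hρ, hnot, hlt⟩ := exists_extremal_smul hS hv
  have hcont : Continuous fun c : ℝ => c • toR x := by fun_prop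
  have hmem : ∀ᶠ c in 𝓝[<] ρ, c • toR x ∈ Omega S := by
    filter_upwards [Ioo_mem_nhdsLT hρ] with c hc using hlt c hc.1.le hc.2
  have hcl : ρ • toR x ∈ closure (Omega S) :=
    mem_closure_of_tendsto (hcont.continuousAt.tendsto.mono_left nhdsWithin_le_nhds) hmem
  refine ⟨ρ • toR x, hcl, ?_, ?_⟩
  · rw [enormR_smul hρ.le, enormR_toR, rdotZ_smul_left, rdotZ_toR_self]
    ring
  by_contra! hgap
  let F : ℝ → ℝ := fun c => enormR (c • toR x) ^ 2 * (sigmaSq J / d) / 2 +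
    M * enormR (c • toR x) ^ (2 + min ζ 1)
  have hF : Continuous F := by
    have hc := continuous_enormR.comp hcont
    exact (((hc.pow 2).mul_const _).div_const _).add
      ((hc.rpow_const fun _ => Or.inr (by linarith)).const_mul M)
  obtain ⟨b, hb1, hb2⟩ := exists_between hgap
  have hFb : ∀ᶠ c in 𝓝[<] ρ, F c < b :=
    (hF.continuousAt.tendsto.mono_left nhdsWithin_le_nhds).eventually_lt_const hb1
  set η := 1 - tiltSum J 0 - b with hη
  have hη0 : 0 < η := by linarith
  refine hnot ((mem_Omega_iff hS.nonneg).2 ?_)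
  have hnn : ∀ c : ℝ, ∀ y, 0 ≤ tilt S (c • toR x) y := fun c y =>
    mul_nonneg (hS.nonneg y) (Real.exp_pos _).le
  refine summable_of_sum_le (hnn ρ) (c := M / η) fun A => ?_
  have hlim : Tendsto (fun c : ℝ => ∑ y ∈ A, tilt S (c • toR x) y) (𝓝[<] ρ)
      (𝓝 (∑ y ∈ A, tilt S (ρ • toR x) y)) := by
    refine Tendsto.mono_left (Continuous.tendsto ?_ ρ) nhdsWithin_le_nhds
    refine continuous_finsetSum _ fun y _ => ?_
    exact continuous_const.mul (Real.continuous_exp.comp ((continuous_rdotZ_left y).comp hcont))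
  refine le_of_tendsto hlim ?_
  filter_upwards [hmem, hFb] with c hc hcb
  have h1 := (abs_le.1 (hJ.abs_tiltSum_sub_sub_le hd hS (subset_closure hc))).2
  have h2 := (hJ.tiltSum_pos hd hS hc).1
  have h3 := hJ.tiltSum_mul hd hS hc
  have hQ := hJ.kernelBounds hd (subset_closure hc)
  have h4 : tiltSum h (c • toR x) ≤ M :=
    (hQ.g_one.1.of_abs.tsum_le_tsum (fun y => le_abs_self _) hQ.g_one.1).trans hQ.g_one.2
  have h5 : η ≤ 1 - tiltSum J (c • toR x) := by
    simp only [F] at hcb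
    linarith
  have h6 : ∑ y ∈ A, tilt S (c • toR x) y ≤ tiltSum S (c • toR x) :=
    ((mem_Omega_iff hS.nonneg).1 hc).sum_le_tsum A fun y _ => hnn c y
  refine h6.trans ((le_div_iff₀ hη0).2 ?_)
  calc _ ≤ tiltSum S (c • toR x) * (1 - tiltSum J (c • toR x)) := by gcongr
    _ ≤ M := h3.trans_le h4

/-- Two-sided bounds on the diffusively rescaled mass gap. -/
lemma AssumptionJ.rescaled_mass_gap_bounds (hd : 1 ≤ d) (hS : AssumptionOmega S)
    (hJ : AssumptionJ S J h M K ζ) {x : Fin d → ℤ} (hx : x ≠ 0) :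
    (mass S * normS S (toR x)) ^ 2 *
        (1 / 2 - M / (2 * K) * (√d * mass S) ^ min ζ 1) ≤
      d * enormZ x ^ 2 / sigmaSq J * (1 - tiltSum J 0) ∧
    d * enormZ x ^ 2 / sigmaSq J * (1 - tiltSum J 0) ≤
      (mass S * normS S (toR x)) ^ 2 *
        (1 / 2 + M / (2 * K) * (√d * mass S) ^ min ζ 1) := by
  have hd0 : (0 : ℝ) < d := by exact_mod_cast hd
  have hθ := hJ.theta_pos
  have hK := hJ.K_pos
  have hM := hJ.M_pos
  have hσK := (hJ.kernelBounds_zero hd hS).le_sigmaSq hd hJ.J_symm hθ (min_le_right _ _)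
  have hσ : 0 < sigmaSq J := lt_of_lt_of_le (by positivity) hσK
  have hr := enormZ_pos hx
  have hκ := (hJ.tiltSum_pos hd hS hS.zero_mem).2
  rw [mass_mul_normS hS]
  set a := sSup ((fun μ => rdotZ μ x) '' closure (Omega S)) with ha
  set r := enormZ x
  set q := d * r ^ 2 / sigmaSq J * (1 - tiltSum J 0) with hq
  set e := M / (2 * K) * (√d * mass S) ^ min ζ 1 with he
  have hq0 : 0 < q := by positivity
  have hbdd := bddAbove_rdotZ_image hS x
  have hle : ∀ μ ∈ closure (Omega S), rdotZ μ x ≤ a := fun μ hμ =>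
    le_csSup hbdd (Set.mem_image_of_mem _ hμ)
  have ha0 : 0 ≤ a := by
    have := hle 0 (subset_closure hS.zero_mem)
    rwa [rdotZ_zero_left] at this
  have herr : ∀ μ ∈ closure (Omega S), d * r ^ 2 / sigmaSq J * (M * enormR μ ^ (2 + min ζ 1)) ≤
      (enormR μ * r) ^ 2 * e := fun μ hμ => by
    have hn := enormR_nonneg μ
    have h1 : enormR μ ^ min ζ 1 ≤ (√d * mass S) ^ min ζ 1 :=
      Real.rpow_le_rpow hn (enormR_le_mass hS hμ) hθ.le
    have h2 : d / sigmaSq J ≤ 1 / (2 * K) := by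
      rw [div_le_div_iff₀ hσ (by positivity)]
      linarith
    rw [Real.rpow_add' hn (by linarith), Real.rpow_two]
    calc d * r ^ 2 / sigmaSq J * (M * (enormR μ ^ 2 * enormR μ ^ min ζ 1))
        = (enormR μ * r) ^ 2 * (M * (d / sigmaSq J) * enormR μ ^ min ζ 1) := by ring
      _ ≤ (enormR μ * r) ^ 2 * (M * (1 / (2 * K)) * (√d * mass S) ^ min ζ 1) := by gcongr
      _ = _ := by rw [he]; ring
  have hmain : ∀ μ : Fin d → ℝ, d * r ^ 2 / sigmaSq J * (enormR μ ^ 2 * (sigmaSq J / d) / 2) =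
      (enormR μ * r) ^ 2 * (1 / 2) := fun μ => by field_simp
  have hl0 : 0 ≤ d * r ^ 2 / sigmaSq J := by positivity
  constructor
  · rcases le_or_gt (1 / 2 - e) 0 with hc | hc
    · exact (mul_nonpos_of_nonneg_of_nonpos (sq_nonneg a) hc).trans hq0.le
    have hlow : ∀ μ ∈ closure (Omega S), rdotZ μ x ^ 2 * (1 / 2 - e) ≤ q := fun μ hμ => by
      have h1 := mul_le_mul_of_nonneg_left (hJ.le_one_sub_tiltSum hd hS hμ) hl0
      rw [mul_sub, hmain] at h1
      have h2 := herr μ hμ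
      have h3 : rdotZ μ x ^ 2 ≤ (enormR μ * r) ^ 2 := by
        rw [← sq_abs]
        exact pow_le_pow_left₀ (abs_nonneg _) (abs_rdotZ_le μ x) 2
      have h4 := mul_le_mul_of_nonneg_right h3 hc.le
      linarith
    have hsup : a ≤ √(q / (1 / 2 - e)) := by
      refine csSup_le ⟨_, Set.mem_image_of_mem _ (subset_closure hS.zero_mem)⟩ ?_
      rintro _ ⟨μ, hμ, rfl⟩
      refine Real.le_sqrt_of_sq_le ?_
      rw [le_div_iff₀ hc]
      exact hlow μ hμ
    have h5 := (Real.le_sqrt ha0 (by positivity)).1 hsup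
    rwa [le_div_iff₀ hc] at h5
  · obtain ⟨μ, hμ, heq, hup⟩ := hJ.exists_one_sub_tiltSum_le hd hS hx
    have h1 := mul_le_mul_of_nonneg_left hup hl0
    rw [mul_add, hmain] at h1
    have h2 := herr μ hμ
    have h3 : (enormR μ * r) ^ 2 ≤ a ^ 2 := by
      rw [heq]
      refine pow_le_pow_left₀ ?_ (hle μ hμ) 2
      rw [← heq]
      exact mul_nonneg (enormR_nonneg μ) hr.le
    have he0 : 0 ≤ e := by
      have := mass_nonneg S
      positivity
    have h4 := mul_le_mul_of_nonneg_right h3 (show 0 ≤ 1 / 2 + e by positivity)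
    linarith

end MassGap

section LocalLimit

variable {M K θ : ℝ} {J h : (Fin d → ℤ) → ℝ}

lemma norm_exp_neg_sub_exp_neg_le {c : ℝ} {z w : ℂ} (hz : c ≤ z.re) (hw : c ≤ w.re) :
    ‖Complex.exp (-z) - Complex.exp (-w)‖ ≤ Real.exp (-c) * ‖z - w‖ := by
  refine (convex_halfSpace_re_ge c).norm_image_sub_le_of_norm_hasDerivWithin_le
    (f := fun u : ℂ => Complex.exp (-u)) (f' := fun u => -Complex.exp (-u)) (fun u _ => ?_)
    (fun u hu => ?_) hw hz
  · have := ((hasDerivAt_id u).neg.cexp).hasDerivWithinAt (s := {u : ℂ | c ≤ u.re})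
    simpa using this
  · rw [norm_neg, Complex.norm_exp, Complex.neg_re]
    exact Real.exp_le_exp.2 (neg_le_neg hu)

lemma norm_exp_I_mul_sub_one_le (hθ : 0 < θ) (hθ1 : θ ≤ 1) (u : ℝ) :
    ‖Complex.exp (-Complex.I * u) - 1‖ ≤ 2 * |u| ^ θ := by
  rcases le_total |u| 1 with hu | hu
  · have h1 := Real.norm_exp_I_mul_ofReal_sub_one_le (x := -u)
    have h2 : |u| ^ (1 : ℝ) ≤ |u| ^ θ :=
      Real.rpow_le_rpow_of_exponent_ge' (abs_nonneg _) hu hθ.le hθ1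
    rw [Real.rpow_one] at h2
    rw [show -Complex.I * (u : ℂ) = Complex.I * ((-u : ℝ) : ℂ) by push_cast; ring]
    rw [norm_neg, Real.norm_eq_abs] at h1
    linarith [abs_nonneg u]
  · have h1 : ‖Complex.exp (-Complex.I * u) - 1‖ ≤ 1 + 1 := by
      refine (norm_sub_le _ _).trans_eq ?_
      rw [show -Complex.I * (u : ℂ) = ((-u : ℝ) : ℂ) * Complex.I by push_cast; ring,
        Complex.norm_exp_ofReal_mul_I, norm_one]
    have h2 := Real.one_le_rpow hu hθ.le
    linarith

lemma KernelBounds.norm_fourierZ_sub_h0_le (hQ : KernelBounds M K θ J h) (hθ : 0 < θ)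
    (hθ1 : θ ≤ 1) (k : Fin d → ℝ) :
    ‖fourierZ h k - (h0 h : ℂ)‖ ≤ 2 * M * enormR k ^ θ := by
  have h1 : ((h0 h : ℝ) : ℂ) = ∑' y, (h y : ℂ) := Complex.ofReal_tsum _
  have hs : Summable fun y => (h y : ℂ) := by
    refine Summable.of_norm_bounded hQ.g_one.1 fun y => ?_
    rw [Complex.norm_real, Real.norm_eq_abs]
  rw [h1, fourierZ, ← (summable_fourierZ hQ.g_one.1 k).tsum_sub hs]
  have hb := tsum_of_norm_bounded (f := fun y => (h y : ℂ) *
    Complex.exp (-Complex.I * (rdotZ k y : ℂ)) - h y)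
    (hQ.g_theta.1.mul_left (2 * enormR k ^ θ)).hasSum fun y => by
      rw [show (h y : ℂ) * Complex.exp (-Complex.I * (rdotZ k y : ℂ)) - h y =
        (h y : ℂ) * (Complex.exp (-Complex.I * (rdotZ k y : ℂ)) - 1) by ring, norm_mul,
        Complex.norm_real, Real.norm_eq_abs]
      calc _ ≤ |h y| * (2 * (enormR k ^ θ * enormZ y ^ θ)) := by
            gcongr
            exact (norm_exp_I_mul_sub_one_le hθ hθ1 _).trans
              (mul_le_mul_of_nonneg_left (abs_rdotZ_rpow_le hθ.le k y) two_pos.le)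
        _ = _ := by ring
  refine hb.trans ?_
  rw [tsum_mul_left]
  calc _ ≤ 2 * enormR k ^ θ * M := by
        gcongr
        · exact mul_nonneg two_pos.le (Real.rpow_nonneg (enormR_nonneg k) _)
        · exact hQ.g_theta.2
    _ = _ := by ring

lemma KernelBounds.abs_h0_le (hQ : KernelBounds M K θ J h) : |h0 h| ≤ M := by
  refine le_trans ?_ hQ.g_one.2
  have := norm_tsum_le_tsum_norm (f := h) (by simpa only [Real.norm_eq_abs] using hQ.g_one.1)
  simpa only [Real.norm_eq_abs, h0] using this

lemma rpow_mul_exp_neg_le {v e : ℝ} (hv : 0 ≤ v) (he0 : 0 ≤ e) (he : e ≤ 2) :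
    v ^ e * Real.exp (-v) ≤ 8 * Real.exp (-v / 2) := by
  have h1 : v ^ e ≤ 1 + v ^ 2 := by
    rcases le_total v 1 with hv1 | hv1
    · have := Real.rpow_le_one hv hv1 he0
      nlinarith [sq_nonneg v]
    · have := Real.rpow_le_rpow_of_exponent_le hv1 he
      rw [Real.rpow_two] at this
      linarith
  have h2 := Real.quadratic_le_exp_of_nonneg (show 0 ≤ v / 2 by positivity)
  have h3 : v ^ e ≤ 8 * Real.exp (v / 2) := by nlinarith
  calc _ ≤ 8 * Real.exp (v / 2) * Real.exp (-v) := by gcongr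
    _ = _ := by rw [mul_assoc, ← Real.exp_add]; congr 2; ring

lemma rpow_norm_mul_gauss_le {a e : ℝ} (ha : 0 < a) (he0 : 0 ≤ e) (he : e ≤ 4)
    (k : Fin d → ℝ) :
    enormR k ^ e * Real.exp (-a * enormR k ^ 2) ≤
      8 * a ^ (-(e / 2)) * Real.exp (-(a / 2) * enormR k ^ 2) := by
  have hk := enormR_nonneg k
  have h1 := rpow_mul_exp_neg_le (v := a * enormR k ^ 2) (by positivity)
    (show 0 ≤ e / 2 by positivity) (by linarith)
  have h2 : (a * enormR k ^ 2) ^ (e / 2) = a ^ (e / 2) * enormR k ^ e := by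
    rw [Real.mul_rpow ha.le (by positivity), ← Real.rpow_natCast, ← Real.rpow_mul hk]
    congr 2; push_cast; ring
  rw [h2] at h1
  rw [Real.rpow_neg ha.le, mul_comm 8, mul_assoc, ← div_eq_inv_mul, le_div_iff₀ (by positivity)]
  calc _ = a ^ (e / 2) * enormR k ^ e * Real.exp (-(a * enormR k ^ 2)) := by
        rw [neg_mul]; ring
    _ ≤ _ := h1
    _ = _ := by congr 2; ring

lemma integral_character_mul_gauss {b : ℝ} (hb : 0 < b) (x : Fin d → ℤ) :
    ∫ k : Fin d → ℝ, Complex.exp (Complex.I * (rdotZ k x : ℂ)) *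
        (Real.exp (-b * enormR k ^ 2) : ℂ) =
      ((√(π / b) ^ d * Real.exp (-(enormZ x ^ 2 / (4 * b))) : ℝ) : ℂ) := by
  have h := GaussianFourier.integral_cexp_neg_mul_sum_add (b := (b : ℂ)) (by simpa using hb)
    fun i : Fin d => Complex.I * (x i : ℂ)
  have h1 : ∀ k : Fin d → ℝ, Complex.exp (Complex.I * (rdotZ k x : ℂ)) *
      (Real.exp (-b * enormR k ^ 2) : ℂ) =
      Complex.exp (-b * ∑ i, (k i : ℂ) ^ 2 + ∑ i, Complex.I * (x i : ℂ) * k i) := fun k => by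
    rw [Complex.ofReal_exp, ← Complex.exp_add, enormR_sq, rdotZ]
    push_cast
    rw [Finset.mul_sum, add_comm]
    congr 2
    exact Finset.sum_congr rfl fun i _ => by ring
  simp only [h1]
  rw [h, Fintype.card_fin]
  push_cast
  congr 1
  · rw [← Complex.ofReal_div, ← Complex.ofReal_natCast, ← Complex.ofReal_ofNat,
      ← Complex.ofReal_div, ← Complex.ofReal_cpow (by positivity), ← Complex.ofReal_pow]
    congr 1
    rw [Real.sqrt_eq_rpow, ← Real.rpow_natCast, ← Real.rpow_mul (by positivity)]
    congr 1; ring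
  · congr 1
    rw [← Complex.ofReal_pow, enormZ_sq]
    push_cast
    rw [← neg_div, ← Finset.sum_neg_distrib]
    congr 1
    exact Finset.sum_congr rfl fun i _ => by rw [mul_pow, Complex.I_sq]; ring

end LocalLimit

section LocalLimitTheorem

variable {M K θ : ℝ} {J h : (Fin d → ℤ) → ℝ}

lemma one_le_enormR_of_notMem_torus {k : Fin d → ℝ} (hk : k ∉ torus d) : 1 ≤ enormR k := by
  rw [mem_torus_iff, not_forall] at hk
  obtain ⟨i, hi⟩ := hk
  have h1 : |k i| ≤ enormR k :=
    Real.abs_le_sqrt (Finset.single_le_sum (f := fun i => k i ^ 2) (fun j _ => sq_nonneg _)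
      (Finset.mem_univ i))
  linarith [Real.pi_gt_three, not_le.1 hi]

/-- Pointwise comparison of the kernel's characteristic function with a Gaussian. -/
lemma KernelBounds.norm_sub_gauss_le (hd : 1 ≤ d) (hQ : KernelBounds M K θ J h)
    (hJ : ZdSymmetric J) (hK : 0 < K) (hθ : 0 < θ) (hθ1 : θ ≤ 1) {t : ℝ} (ht : 0 < t)
    (k : Fin d → ℝ) :
    ‖(torus d).indicator (fun k => fourierZ h k *
        Complex.exp (-(t : ℂ) * (fourierZ J 0 - fourierZ J k))) k -
      (h0 h : ℂ) * (Real.exp (-(t * sigmaSq J / (2 * d)) * enormR k ^ 2) : ℂ)‖ ≤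
      (16 * M + 8 * M ^ 2 / K) * (K * t) ^ (-(θ / 2)) *
        Real.exp (-(K * t / 2) * enormR k ^ 2) := by
  have hM := hQ.M_nonneg
  have hd0 : (0 : ℝ) < d := by exact_mod_cast hd
  have hσ := hQ.le_sigmaSq hd hJ hθ hθ1
  have hk := enormR_nonneg k
  have ha : 0 < K * t := by positivity
  set b := t * sigmaSq J / (2 * d) with hb
  have hab : K * t ≤ b := by
    rw [hb, le_div_iff₀ (by positivity)]
    nlinarith
  have hbE : Real.exp (-b * enormR k ^ 2) ≤ Real.exp (-(K * t) * enormR k ^ 2) :=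
    Real.exp_le_exp.2 (by nlinarith [sq_nonneg (enormR k)])
  have h1 := rpow_norm_mul_gauss_le ha hθ.le (by linarith) k
  have h2 := rpow_norm_mul_gauss_le (e := 2 + θ) ha (by linarith) (by linarith) k
  set E := Real.exp (-(K * t / 2) * enormR k ^ 2)
  set G := Real.exp (-(K * t) * enormR k ^ 2)
  set p := (K * t) ^ (-(θ / 2))
  have hp : 0 ≤ p := Real.rpow_nonneg ha.le _
  have hpp : (K * t) ^ (-((2 + θ) / 2)) = (K * t)⁻¹ * p := by
    rw [show -((2 + θ) / 2) = -1 + -(θ / 2) by ring, Real.rpow_add ha, Real.rpow_neg_one]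
  have hE0 : 0 ≤ E := (Real.exp_pos _).le
  have hG0 : 0 ≤ G := (Real.exp_pos _).le
  by_cases hkT : k ∈ torus d
  · rw [Set.indicator_of_mem hkT]
    have h3 := hQ.norm_fourierZ_sub_h0_le hθ hθ1 k
    have h4 := hQ.norm_exp_le ht.le hkT
    have h5 : ‖Complex.exp (-(t : ℂ) * (fourierZ J 0 - fourierZ J k)) -
        (Real.exp (-b * enormR k ^ 2) : ℂ)‖ ≤ G * (t * (M * enormR k ^ (2 + θ))) := by
      have h6 := norm_exp_neg_sub_exp_neg_le (c := K * t * enormR k ^ 2)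
        (z := (t : ℂ) * (fourierZ J 0 - fourierZ J k)) (w := ((b * enormR k ^ 2 : ℝ) : ℂ)) (by
          rw [Complex.re_ofReal_mul]
          have := mul_le_mul_of_nonneg_left (hQ.infrared k hkT) ht.le
          linarith) (by
          rw [Complex.ofReal_re]
          gcongr)
      rw [show -((t : ℂ) * (fourierZ J 0 - fourierZ J k)) =
        -(t : ℂ) * (fourierZ J 0 - fourierZ J k) by ring, ← Complex.ofReal_neg (b * enormR k ^ 2),
        ← Complex.ofReal_exp, ← neg_mul, ← neg_mul] at h6
      refine h6.trans (mul_le_mul_of_nonneg_left ?_ hG0)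
      have h7 : (t : ℂ) * (fourierZ J 0 - fourierZ J k) - ((b * enormR k ^ 2 : ℝ) : ℂ) =
          (t : ℂ) * (fourierZ J 0 - fourierZ J k -
            ((enormR k ^ 2 * (sigmaSq J / d) / 2 : ℝ) : ℂ)) := by
        rw [hb]; push_cast; ring
      rw [h7, norm_mul, Complex.norm_real, Real.norm_eq_abs, abs_of_pos ht]
      exact mul_le_mul_of_nonneg_left (hQ.norm_fourierZ_sub_sub_le hJ hθ hθ1 k) ht.le
    have h8 : ‖(h0 h : ℂ)‖ ≤ M := by
      rw [Complex.norm_real, Real.norm_eq_abs]; exact hQ.abs_h0_le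
    set e1 := Complex.exp (-(t : ℂ) * (fourierZ J 0 - fourierZ J k))
    set e2 : ℂ := (Real.exp (-b * enormR k ^ 2) : ℂ)
    calc ‖fourierZ h k * e1 - h0 h * e2‖
        = ‖(fourierZ h k - h0 h) * e1 + h0 h * (e1 - e2)‖ := by congr 1; ring
      _ ≤ ‖fourierZ h k - h0 h‖ * ‖e1‖ + ‖(h0 h : ℂ)‖ * ‖e1 - e2‖ := by
          refine (norm_add_le _ _).trans_eq ?_
          rw [norm_mul, norm_mul]
      _ ≤ 2 * M * enormR k ^ θ * G + M * (G * (t * (M * enormR k ^ (2 + θ)))) := by gcongr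
      _ = 2 * M * (enormR k ^ θ * G) + M ^ 2 * t * (enormR k ^ (2 + θ) * G) := by ring
      _ ≤ 2 * M * (8 * p * E) + M ^ 2 * t * (8 * ((K * t)⁻¹ * p) * E) := by
          rw [← hpp]
          gcongr
      _ = _ := by field_simp; ring
  · rw [Set.indicator_of_notMem hkT, zero_sub, norm_neg, norm_mul, Complex.norm_real,
      Complex.norm_real, Real.norm_eq_abs, Real.norm_eq_abs, Real.abs_exp]
    have h3 : 1 ≤ enormR k ^ θ := Real.one_le_rpow (one_le_enormR_of_notMem_torus hkT) hθ.le
    calc |h0 h| * Real.exp (-b * enormR k ^ 2) ≤ M * G := by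
          gcongr
          exact hQ.abs_h0_le
      _ ≤ M * (enormR k ^ θ * G) := by
          gcongr
          exact le_mul_of_one_le_left hG0 h3
      _ ≤ M * (8 * p * E) := by gcongr
      _ ≤ _ := by
          have h4 : 0 ≤ 8 * M ^ 2 / K * p * E := by positivity
          have h5 : 0 ≤ M * p * E := by positivity
          linarith

/-- Local central limit theorem with an error bound uniform in the starting kernel. -/
lemma KernelBounds.norm_It_sub_le (hd : 1 ≤ d) (hQ : KernelBounds M K θ J h)
    (hJ : ZdSymmetric J) (hK : 0 < K) (hθ : 0 < θ) (hθ1 : θ ≤ 1) {t : ℝ} (ht : 0 < t)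
    (x : Fin d → ℤ) :
    ‖It J h t x - ((h0 h * (((2 * π) ^ d)⁻¹ * (√(π / (t * sigmaSq J / (2 * d))) ^ d *
        Real.exp (-(enormZ x ^ 2 / (4 * (t * sigmaSq J / (2 * d))))))) : ℝ) : ℂ)‖ ≤
      (16 * M + 8 * M ^ 2 / K) * (K * t) ^ (-(θ / 2)) * √(π / (K * t / 2)) ^ d := by
  have hM := hQ.M_nonneg
  have hd0 : (0 : ℝ) < d := by exact_mod_cast hd
  have hσ : 0 < sigmaSq J := lt_of_lt_of_le (by positivity) (hQ.le_sigmaSq hd hJ hθ hθ1)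
  set b := t * sigmaSq J / (2 * d) with hb
  have hb0 : 0 < b := by positivity
  have ha : 0 < K * t / 2 := by positivity
  have cJ := continuous_fourierZ hQ.Q_one.1
  have ch := continuous_fourierZ hQ.g_one.1
  have cx := continuous_rdotZ_left x
  set Φ : (Fin d → ℝ) → ℂ := fun k => fourierZ h k *
    Complex.exp (-(t : ℂ) * (fourierZ J 0 - fourierZ J k)) with hΦ
  have hΦc : Continuous fun k => Complex.exp (Complex.I * (rdotZ k x : ℂ)) * Φ k := by
    fun_prop
  have hi1 : Integrable fun k => (torus d).indicator
      (fun k => Complex.exp (Complex.I * (rdotZ k x : ℂ)) * Φ k) k :=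
    (integrableOn_torus_of_continuous hΦc).integrable_indicator (measurableSet_torus d)
  have hi2 : Integrable fun k : Fin d → ℝ => (h0 h : ℂ) *
      (Complex.exp (Complex.I * (rdotZ k x : ℂ)) * (Real.exp (-b * enormR k ^ 2) : ℂ)) := by
    refine Integrable.const_mul ?_ _
    refine (integrable_gauss hb0).mono' (Continuous.aestronglyMeasurable ?_)
      (Eventually.of_forall fun k => ?_)
    · have := continuous_gauss (d := d) b
      fun_prop
    · rw [norm_mul, norm_character_pos, one_mul, Complex.norm_real, Real.norm_eq_abs,
        Real.abs_exp]
  have heq : It J h t x - ((h0 h * (((2 * π) ^ d)⁻¹ * (√(π / b) ^ d *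
      Real.exp (-(enormZ x ^ 2 / (4 * b))))) : ℝ) : ℂ) = (((2 * π) ^ d : ℝ) : ℂ)⁻¹ *
      ∫ k : Fin d → ℝ, ((torus d).indicator
        (fun k => Complex.exp (Complex.I * (rdotZ k x : ℂ)) * Φ k) k -
        (h0 h : ℂ) * (Complex.exp (Complex.I * (rdotZ k x : ℂ)) *
          (Real.exp (-b * enormR k ^ 2) : ℂ))) := by
    rw [integral_sub hi1 hi2, integral_indicator (measurableSet_torus d), integral_const_mul,
      integral_character_mul_gauss hb0, It_eq_fcoef, fcoef, mul_sub]
    push_cast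
    ring
  have h2π : 1 ≤ (2 * π) ^ d := one_le_pow₀ (by linarith [Real.pi_gt_three])
  have hnn : 0 ≤ (16 * M + 8 * M ^ 2 / K) * (K * t) ^ (-(θ / 2)) := by positivity
  rw [heq, norm_mul, norm_inv, Complex.norm_real, Real.norm_eq_abs, abs_of_nonneg (by positivity)]
  refine (mul_le_of_le_one_left (norm_nonneg _) (inv_le_one_of_one_le₀ h2π)).trans ?_
  rw [← integral_gauss, ← integral_const_mul]
  refine norm_integral_le_of_norm_le ((integrable_gauss ha).const_mul _)
    (Eventually.of_forall fun k => ?_)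
  have h3 : (torus d).indicator (fun k => Complex.exp (Complex.I * (rdotZ k x : ℂ)) * Φ k) k -
      (h0 h : ℂ) * (Complex.exp (Complex.I * (rdotZ k x : ℂ)) *
        (Real.exp (-b * enormR k ^ 2) : ℂ)) = Complex.exp (Complex.I * (rdotZ k x : ℂ)) *
      ((torus d).indicator Φ k - (h0 h : ℂ) * (Real.exp (-b * enormR k ^ 2) : ℂ)) := by
    by_cases hkT : k ∈ torus d
    · rw [Set.indicator_of_mem hkT, Set.indicator_of_mem hkT]; ring
    · rw [Set.indicator_of_notMem hkT, Set.indicator_of_notMem hkT]; ring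
  rw [h3, norm_mul, norm_character_pos, one_mul]
  exact hQ.norm_sub_gauss_le hd hJ hK hθ hθ1 ht k

end LocalLimitTheorem

section Rescaled

variable {M K ζ θ : ℝ} {S J h : (Fin d → ℤ) → ℝ}

/-- The standard heat kernel at unit distance from the origin. -/
def heatUnit (d : ℕ) (τ : ℝ) : ℝ :=
  1 / (2 * π * τ) ^ ((d : ℝ) / 2) * Real.exp (-(1 / (2 * τ)))

lemma massiveG_e1R (hd : 1 ≤ d) (s : ℝ) :
    massiveG d s (e1R d 1) =
      ∫ τ in Set.Ioi (0 : ℝ), heatUnit d τ * Real.exp (-(s ^ 2 / 2 * τ)) := by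
  rw [massiveG, enormR_e1R hd one_pos.le]
  refine integral_congr_ae (Eventually.of_forall fun τ => ?_)
  simp only [heatUnit]
  congr 2
  · congr 1; ring
  · ring

lemma heatUnit_nonneg {τ : ℝ} (hτ : 0 ≤ τ) : 0 ≤ heatUnit d τ := by
  unfold heatUnit; positivity

lemma heatUnit_le_rpow {τ : ℝ} (hτ : 0 < τ) : heatUnit d τ ≤ τ ^ (-((d : ℝ) / 2)) := by
  have h1 : Real.exp (-(1 / (2 * τ))) ≤ 1 := Real.exp_le_one_iff.2 (by
    have : 0 < 1 / (2 * τ) := by positivity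
    linarith)
  have h2 : τ ^ ((d : ℝ) / 2) ≤ (2 * π * τ) ^ ((d : ℝ) / 2) := by
    gcongr
    nlinarith [Real.pi_gt_three]
  rw [Real.rpow_neg hτ.le, heatUnit, one_div]
  refine (mul_le_of_le_one_right (by positivity) h1).trans ?_
  gcongr

lemma heatUnit_le_factorial {τ : ℝ} (hτ : 0 < τ) : heatUnit d τ ≤ d.factorial := by
  set u := 1 / (2 * τ) with hu
  have hu0 : 0 < u := by positivity
  have hfac : (1 : ℝ) ≤ d.factorial := by exact_mod_cast d.factorial_pos
  have h1 : 1 / (2 * π * τ) ^ ((d : ℝ) / 2) ≤ u ^ ((d : ℝ) / 2) := by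
    rw [hu, Real.div_rpow one_pos.le (by positivity), Real.one_rpow]
    gcongr
    nlinarith [Real.pi_gt_three]
  have h2 : u ^ ((d : ℝ) / 2) ≤ d.factorial * Real.exp u := by
    rcases le_total u 1 with h | h
    · refine (Real.rpow_le_one hu0.le h (by positivity)).trans ?_
      nlinarith [Real.one_le_exp hu0.le]
    · have h3 : u ^ ((d : ℝ) / 2) ≤ u ^ d := by
        rw [← Real.rpow_natCast]
        exact Real.rpow_le_rpow_of_exponent_le h (half_le_self (by positivity))
      have h4 := Real.pow_div_factorial_le_exp u hu0.le d
      rw [div_le_iff₀ (by positivity)] at h4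
      linarith
  rw [heatUnit]
  calc _ ≤ d.factorial * Real.exp u * Real.exp (-u) := by
        gcongr
        exact h1.trans h2
    _ = _ := by rw [mul_assoc, ← Real.exp_add, add_neg_cancel, Real.exp_zero, mul_one]

lemma sqrt_pow_eq_rpow {u : ℝ} (hu : 0 ≤ u) : √u ^ d = u ^ ((d : ℝ) / 2) := by
  rw [Real.sqrt_eq_rpow, ← Real.rpow_natCast, ← Real.rpow_mul hu]
  congr 1; ring

lemma scaled_heat_eq {r τ : ℝ} (hr : 0 < r) (hτ : 0 < τ) :
    r ^ d * (((2 * π) ^ d)⁻¹ * (√(π / (r ^ 2 * τ / 2)) ^ d *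
      Real.exp (-(r ^ 2 / (4 * (r ^ 2 * τ / 2)))))) = heatUnit d τ := by
  have h1 : r ^ 2 / (4 * (r ^ 2 * τ / 2)) = 1 / (2 * τ) := by field_simp; norm_num
  have h2 : √(π / (r ^ 2 * τ / 2)) = 2 * π / r * √(1 / (2 * π * τ)) := by
    rw [← Real.sqrt_sq (show 0 ≤ 2 * π / r by positivity), ← Real.sqrt_mul (by positivity)]
    congr 1
    field_simp
  rw [h1, h2, mul_pow (2 * π / r), div_pow, sqrt_pow_eq_rpow (by positivity), heatUnit,
    Real.div_rpow one_pos.le (by positivity), Real.one_rpow]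
  field_simp

/-- The rescaled local limit theorem. -/
lemma KernelBounds.norm_scaled_It_sub_le (hd : 1 ≤ d) (hQ : KernelBounds M K θ J h)
    (hJ : ZdSymmetric J) (hM : 0 < M) (hK : 0 < K) (hθ : 0 < θ) (hθ1 : θ ≤ 1) {x : Fin d → ℤ}
    (hx : x ≠ 0) {τ : ℝ} (hτ : 0 < τ) :
    ‖((enormZ x ^ d : ℝ) : ℂ) * It J h (d * enormZ x ^ 2 / sigmaSq J * τ) x -
      ((h0 h * heatUnit d τ : ℝ) : ℂ)‖ ≤
      (16 * M + 8 * M ^ 2 / K) * (K * d * τ / M) ^ (-(θ / 2)) * √(2 * π / (K * d * τ / M)) ^ d *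
        enormZ x ^ (-θ) := by
  have hd0 : (0 : ℝ) < d := by exact_mod_cast hd
  have hσ : 0 < sigmaSq J := lt_of_lt_of_le (by positivity) (hQ.le_sigmaSq hd hJ hθ hθ1)
  have hσM := hQ.sigmaSq_le
  have hr := enormZ_pos hx
  set r := enormZ x
  set w := K * d * τ / M with hw
  have hw0 : 0 < w := by positivity
  have ht : 0 < d * r ^ 2 / sigmaSq J * τ := by positivity
  have h1 := hQ.norm_It_sub_le hd hJ hK hθ hθ1 ht x
  set t := d * r ^ 2 / sigmaSq J * τ with htdef
  have hb : t * sigmaSq J / (2 * d) = r ^ 2 * τ / 2 := by rw [htdef]; field_simp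
  have htw : r ^ 2 * w ≤ K * t := by
    rw [hw, htdef]
    calc r ^ 2 * (K * d * τ / M) = K * (d * r ^ 2 / M * τ) := by ring
      _ ≤ _ := by gcongr
  rw [hb] at h1
  rw [← scaled_heat_eq hr hτ, mul_left_comm, Complex.ofReal_mul, ← mul_sub, norm_mul,
    Complex.norm_real, Real.norm_eq_abs, abs_of_nonneg (by positivity)]
  have h2 : (K * t) ^ (-(θ / 2)) ≤ w ^ (-(θ / 2)) * r ^ (-θ) := by
    have h3 : (r ^ 2) ^ (-(θ / 2)) = r ^ (-θ) := by
      rw [← Real.rpow_natCast, ← Real.rpow_mul hr.le]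
      congr 1; push_cast; ring
    rw [← h3, ← Real.mul_rpow hw0.le (by positivity), mul_comm w]
    exact Real.rpow_le_rpow_of_nonpos (by positivity) htw (by linarith)
  have h4 : √(π / (K * t / 2)) ≤ √(2 * π / w) / r := by
    rw [le_div_iff₀ hr]
    conv_lhs => rw [← Real.sqrt_sq hr.le, ← Real.sqrt_mul (by positivity)]
    refine Real.sqrt_le_sqrt ?_
    rw [div_div_eq_mul_div, div_mul_eq_mul_div, div_le_div_iff₀ (by positivity) hw0]
    nlinarith [Real.pi_pos]
  calc _ ≤ r ^ d * ((16 * M + 8 * M ^ 2 / K) * (K * t) ^ (-(θ / 2)) * √(π / (K * t / 2)) ^ d) := by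
        gcongr
    _ ≤ r ^ d * ((16 * M + 8 * M ^ 2 / K) * (w ^ (-(θ / 2)) * r ^ (-θ)) *
          (√(2 * π / w) / r) ^ d) := by gcongr
    _ = _ := by rw [div_pow]; field_simp

lemma KernelBounds.norm_scaled_It_le_rpow (hd : 1 ≤ d) (hQ : KernelBounds M K θ J h)
    (hJ : ZdSymmetric J) (hM : 0 < M) (hK : 0 < K) (hθ : 0 < θ) (hθ1 : θ ≤ 1) {x : Fin d → ℤ}
    (hx : x ≠ 0) {τ : ℝ} (hτ : 0 < τ) :
    ‖((enormZ x ^ d : ℝ) : ℂ) * It J h (d * enormZ x ^ 2 / sigmaSq J * τ) x‖ ≤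
      M * (K * d / M) ^ (-((d : ℝ) / 2)) * τ ^ (-((d : ℝ) / 2)) := by
  have hd0 : (0 : ℝ) < d := by exact_mod_cast hd
  have hσ : 0 < sigmaSq J := lt_of_lt_of_le (by positivity) (hQ.le_sigmaSq hd hJ hθ hθ1)
  have hσM := hQ.sigmaSq_le
  have hr := enormZ_pos hx
  set r := enormZ x
  have ht : 0 < d * r ^ 2 / sigmaSq J * τ := by positivity
  set t := d * r ^ 2 / sigmaSq J * τ with htdef
  have htw : r ^ 2 * (K * d / M * τ) ≤ K * t := by
    rw [htdef]
    calc r ^ 2 * (K * d / M * τ) = K * (d * r ^ 2 / M * τ) := by ring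
      _ ≤ _ := by gcongr
  rw [norm_mul, Complex.norm_real, Real.norm_eq_abs, abs_of_nonneg (by positivity)]
  have h1 : gaussAvg d (K * t) ≤ (r ^ d)⁻¹ * (K * d / M * τ) ^ (-((d : ℝ) / 2)) := by
    have h3 : (r ^ 2) ^ (-((d : ℝ) / 2)) = (r ^ d)⁻¹ := by
      rw [← Real.rpow_natCast, ← Real.rpow_mul hr.le, ← Real.rpow_natCast, ← Real.rpow_neg hr.le]
      congr 1; push_cast; ring
    rw [← h3, ← Real.mul_rpow (by positivity) (by positivity)]
    exact (gaussAvg_le (by positivity)).trans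
      (Real.rpow_le_rpow_of_nonpos (by positivity) htw (by linarith))
  calc _ ≤ r ^ d * (M * ((r ^ d)⁻¹ * (K * d / M * τ) ^ (-((d : ℝ) / 2)))) := by
        gcongr
        exact (hQ.norm_It_le ht.le x).trans (mul_le_mul_of_nonneg_left h1 hM.le)
    _ = M * (K * d / M * τ) ^ (-((d : ℝ) / 2)) := by field_simp
    _ = _ := by rw [Real.mul_rpow (by positivity) hτ.le, mul_assoc]

/-- The short-time bound on the rescaled heat kernel. -/
lemma exists_norm_scaled_It_le (hd : 1 ≤ d) (hM : 0 < M) (hK : 0 < K) (hθ : 0 < θ)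
    (hθ1 : θ ≤ 1) : ∃ C, 0 ≤ C ∧ ∀ J h : (Fin d → ℤ) → ℝ, KernelBounds M K θ J h →
      ZdSymmetric J → ∀ x ≠ 0, ∀ τ, 0 < τ → τ ≤ 2 * K →
      ‖((enormZ x ^ d : ℝ) : ℂ) * It J h (d * enormZ x ^ 2 / sigmaSq J * τ) x‖ ≤
        C * τ ^ (-(1 / 2) : ℝ) := by
  have hd0 : (0 : ℝ) < d := by exact_mod_cast hd
  obtain ⟨C, hC, hmain⟩ := exists_norm_It_le (θ := θ) hd hM.le hK
  refine ⟨C * √(M / d), by positivity, fun J h hQ hJ x hx τ hτ hτK => ?_⟩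
  have hσK := hQ.le_sigmaSq hd hJ hθ hθ1
  have hσ : 0 < sigmaSq J := lt_of_lt_of_le (by positivity) hσK
  have hσM := hQ.sigmaSq_le
  have hr := enormZ_pos hx
  have ht : 0 < d * enormZ x ^ 2 / sigmaSq J * τ := by positivity
  have htle : d * enormZ x ^ 2 / sigmaSq J * τ ≤ enormZ x ^ 2 := by
    rw [div_mul_eq_mul_div, div_le_iff₀ hσ, mul_comm (d : ℝ), mul_assoc]
    gcongr
    nlinarith
  have h1 := hmain J h hQ hJ.map_neg x hx _ ht htle
  rw [norm_mul, Complex.norm_real, Real.norm_eq_abs, abs_of_nonneg (by positivity)]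
  refine h1.trans ?_
  rw [mul_assoc]
  gcongr
  rw [Real.rpow_neg hτ.le, ← Real.sqrt_eq_rpow, ← Real.sqrt_inv, ← Real.sqrt_mul (by positivity)]
  refine Real.le_sqrt_of_sq_le ?_
  rw [div_pow, Real.sq_sqrt ht.le]
  calc _ = sigmaSq J / d * τ⁻¹ := by field_simp
    _ ≤ _ := by gcongr

end Rescaled

section Convergence

variable {M K ζ θ : ℝ}

lemma integrableOn_rpow_mul_exp {a c β : ℝ} (ha : a ≤ 0) (hc : 0 < c) (hβ : 0 ≤ β)
    (h : -1 ≤ a → 0 < β) :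
    IntegrableOn (fun τ : ℝ => τ ^ a * Real.exp (-(β * τ))) (Set.Ioi c) := by
  have hcont : ContinuousOn (fun τ : ℝ => τ ^ a * Real.exp (-(β * τ))) (Set.Ioi c) := by
    refine ContinuousOn.mul (fun τ hτ => ?_) (by fun_prop)
    exact (Real.continuousAt_rpow_const τ a (Or.inl (hc.trans hτ).ne')).continuousWithinAt
  have hm := hcont.aestronglyMeasurable (μ := volume) measurableSet_Ioi
  rcases lt_or_ge a (-1) with h1 | h1
  · refine (integrableOn_Ioi_rpow_of_lt h1 hc).mono' hm ?_
    filter_upwards [ae_restrict_mem measurableSet_Ioi] with τ hτ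
    have hτ0 : 0 < τ := hc.trans hτ
    rw [Real.norm_eq_abs, abs_of_nonneg (by positivity)]
    refine mul_le_of_le_one_right (by positivity) (Real.exp_le_one_iff.2 ?_)
    have := mul_nonneg hβ hτ0.le
    linarith
  · refine ((exp_neg_integrableOn_Ioi c (h h1)).const_mul (c ^ a)).mono' hm ?_
    filter_upwards [ae_restrict_mem measurableSet_Ioi] with τ hτ
    have hτ0 : 0 < τ := hc.trans hτ
    rw [Real.norm_eq_abs, abs_of_nonneg (by positivity), neg_mul]
    exact mul_le_mul_of_nonneg_right (Real.rpow_le_rpow_of_nonpos hc (le_of_lt hτ) ha)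
      (Real.exp_pos _).le

/-- An integrable majorant for the rescaled heat kernels. -/
lemma exists_integrable_majorant (hd : 1 ≤ d) (hM : 0 < M) (hK : 0 < K) (hθ : 0 < θ)
    (hθ1 : θ ≤ 1) {β : ℝ} (hβ : 0 ≤ β) (hβd : d ≤ 2 → 0 < β) :
    ∃ F : ℝ → ℝ, IntegrableOn F (Set.Ioi 0) ∧ ∀ q, β ≤ q → ∀ τ, 0 < τ →
      Real.exp (-(q * τ)) * heatUnit d τ ≤ F τ ∧
      ∀ J h : (Fin d → ℤ) → ℝ, KernelBounds M K θ J h → ZdSymmetric J → ∀ x ≠ 0,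
        Real.exp (-(q * τ)) *
          ‖((enormZ x ^ d : ℝ) : ℂ) * It J h (d * enormZ x ^ 2 / sigmaSq J * τ) x‖ ≤ F τ := by
  obtain ⟨C, hC, hshort⟩ := exists_norm_scaled_It_le (θ := θ) hd hM hK hθ hθ1
  set B := M * (K * d / M) ^ (-((d : ℝ) / 2)) with hB
  have hB0 : 0 ≤ B := by positivity
  let F₁ : ℝ → ℝ := fun τ => C * τ ^ (-(1 / 2) : ℝ) + d.factorial
  let F₂ : ℝ → ℝ := fun τ => (B + 1) * (τ ^ (-((d : ℝ) / 2)) * Real.exp (-(β * τ)))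
  have hF₁ : IntegrableOn F₁ (Set.Ioc 0 (2 * K)) := by
    refine Integrable.add (Integrable.const_mul ?_ _) (integrable_const _)
    exact (intervalIntegral.intervalIntegrable_rpow' (by norm_num)).1
  have hF₂ : IntegrableOn F₂ (Set.Ioi (2 * K)) := by
    refine Integrable.const_mul (integrableOn_rpow_mul_exp ?_ (by positivity) hβ fun h => ?_) _
    · have : (0 : ℝ) ≤ d / 2 := by positivity
      linarith
    · refine hβd ?_
      have : (d : ℝ) ≤ 2 := by linarith
      exact_mod_cast this
  refine ⟨(Set.Ioc 0 (2 * K)).piecewise F₁ F₂, ?_, fun q hq τ hτ => ?_⟩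
  · rw [← Set.Ioc_union_Ioi_eq_Ioi (show (0 : ℝ) ≤ 2 * K by positivity)]
    refine IntegrableOn.union ?_ ?_
    · exact hF₁.congr_fun (fun τ hτ => (Set.piecewise_eq_of_mem _ _ _ hτ).symm) measurableSet_Ioc
    · exact hF₂.congr_fun (fun τ hτ => (Set.piecewise_eq_of_notMem _ _ _ fun h =>
        not_lt.2 h.2 hτ).symm) measurableSet_Ioi
  · have hq0 : 0 ≤ q := hβ.trans hq
    have hexp : Real.exp (-(q * τ)) ≤ Real.exp (-(β * τ)) := by gcongr
    have hexp1 : Real.exp (-(q * τ)) ≤ 1 := Real.exp_le_one_iff.2 (by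
      have := mul_nonneg hq0 hτ.le
      linarith)
    have hh := heatUnit_nonneg (d := d) hτ.le
    rcases le_or_gt τ (2 * K) with h | h
    · rw [Set.piecewise_eq_of_mem _ _ _ (show τ ∈ Set.Ioc 0 (2 * K) from ⟨hτ, h⟩)]
      have hC' : 0 ≤ C * τ ^ (-(1 / 2) : ℝ) := by positivity
      have hf : (0 : ℝ) ≤ d.factorial := by positivity
      refine ⟨(mul_le_of_le_one_left hh hexp1).trans ?_, fun J h' hQ hJ x hx =>
        (mul_le_of_le_one_left (norm_nonneg _) hexp1).trans ?_⟩
      · have := heatUnit_le_factorial (d := d) hτ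
        simp only [F₁]
        linarith
      · have := hshort J h' hQ hJ x hx τ hτ h
        simp only [F₁]
        linarith
    · rw [Set.piecewise_eq_of_notMem _ _ _
        (show τ ∉ Set.Ioc 0 (2 * K) from fun h' => not_lt.2 h'.2 h)]
      simp only [F₂]
      have hp : 0 ≤ τ ^ (-((d : ℝ) / 2)) := by positivity
      refine ⟨?_, fun J h' hQ hJ x hx => ?_⟩
      · have := heatUnit_le_rpow (d := d) hτ
        calc _ ≤ Real.exp (-(β * τ)) * τ ^ (-((d : ℝ) / 2)) := by gcongr
          _ = 1 * (τ ^ (-((d : ℝ) / 2)) * Real.exp (-(β * τ))) := by ring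
          _ ≤ _ := by gcongr; linarith
      · have := hQ.norm_scaled_It_le_rpow hd hJ hM hK hθ hθ1 hx hτ
        calc _ ≤ Real.exp (-(β * τ)) * (B * τ ^ (-((d : ℝ) / 2))) := by gcongr
          _ = B * (τ ^ (-((d : ℝ) / 2)) * Real.exp (-(β * τ))) := by ring
          _ ≤ _ := by gcongr; linarith

lemma tendsto_rescaled_mass_gap (hd : 1 ≤ d) {S J h : ℕ → (Fin d → ℤ) → ℝ}
    {x : ℕ → Fin d → ℤ} {s : ℝ} (hS : ∀ n, AssumptionOmega (S n))
    (hJ : ∀ n, AssumptionJ (S n) (J n) (h n) M K ζ) (hx : ∀ n, x n ≠ 0)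
    (hmass : Tendsto (fun n => mass (S n)) atTop (𝓝 0))
    (hmx : Tendsto (fun n => mass (S n) * normS (S n) (toR (x n))) atTop (𝓝 s)) :
    Tendsto (fun n => d * enormZ (x n) ^ 2 / sigmaSq (J n) * (1 - tiltSum (J n) 0)) atTop
      (𝓝 (s ^ 2 / 2)) := by
  have hθ := (hJ 0).theta_pos
  have he : Tendsto (fun n => M / (2 * K) * (√d * mass (S n)) ^ min ζ 1) atTop (𝓝 0) := by
    have h1 := (hmass.const_mul √d).rpow_const (p := min ζ 1) (Or.inr hθ.le)
    rw [mul_zero, Real.zero_rpow hθ.ne'] at h1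
    simpa using h1.const_mul (M / (2 * K))
  refine tendsto_of_tendsto_of_tendsto_of_le_of_le
    (g := fun n => (mass (S n) * normS (S n) (toR (x n))) ^ 2 *
      (1 / 2 - M / (2 * K) * (√d * mass (S n)) ^ min ζ 1))
    (h := fun n => (mass (S n) * normS (S n) (toR (x n))) ^ 2 *
      (1 / 2 + M / (2 * K) * (√d * mass (S n)) ^ min ζ 1)) ?_ ?_
    (fun n => ((hJ n).rescaled_mass_gap_bounds hd (hS n) (hx n)).1)
    (fun n => ((hJ n).rescaled_mass_gap_bounds hd (hS n) (hx n)).2)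
  · have := (hmx.pow 2).mul (he.const_sub (1 / 2))
    rwa [sub_zero, mul_one_div] at this
  · have := (hmx.pow 2).mul (he.const_add (1 / 2))
    rwa [add_zero, mul_one_div] at this

lemma tendsto_exp_mul_sub {r q H : ℕ → ℝ} {I : ℕ → ℂ} {g β C M τ : ℝ}
    (hθ : 0 < θ) (hr : Tendsto r atTop atTop) (hq0 : ∀ n, 0 ≤ q n)
    (hq : Tendsto q atTop (𝓝 β)) (hH : ∀ n, |H n| ≤ M) (hτ : 0 ≤ τ)
    (hI : ∀ n, ‖I n - ((H n * g : ℝ) : ℂ)‖ ≤ C * r n ^ (-θ)) :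
    Tendsto (fun n => (Real.exp (-(q n * τ)) : ℂ) * I n -
      ((H n * (g * Real.exp (-(β * τ))) : ℝ) : ℂ)) atTop (𝓝 0) := by
  have h1 : Tendsto (fun n => C * r n ^ (-θ)) atTop (𝓝 0) := by
    simpa using ((tendsto_rpow_neg_atTop hθ).comp hr).const_mul C
  have h2 : Tendsto (fun n => M * |g| * |Real.exp (-(q n * τ)) - Real.exp (-(β * τ))|) atTop
      (𝓝 0) := by
    have h3 : Tendsto (fun n => Real.exp (-(q n * τ))) atTop (𝓝 (Real.exp (-(β * τ)))) :=
      (Real.continuous_exp.tendsto _).comp (hq.mul_const τ).neg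
    simpa using ((h3.sub_const (Real.exp (-(β * τ)))).abs).const_mul (M * |g|)
  refine squeeze_zero_norm (fun n => ?_) (by simpa using h1.add h2)
  have heq : (Real.exp (-(q n * τ)) : ℂ) * I n - ((H n * (g * Real.exp (-(β * τ))) : ℝ) : ℂ) =
      (Real.exp (-(q n * τ)) : ℂ) * (I n - ((H n * g : ℝ) : ℂ)) +
        ((H n * g * (Real.exp (-(q n * τ)) - Real.exp (-(β * τ))) : ℝ) : ℂ) := by
    push_cast; ring
  rw [heq]
  refine (norm_add_le _ _).trans ?_
  rw [norm_mul, Complex.norm_real, Complex.norm_real, Real.norm_eq_abs, Real.norm_eq_abs,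
    Real.abs_exp, abs_mul, abs_mul]
  have hexp1 : Real.exp (-(q n * τ)) ≤ 1 := Real.exp_le_one_iff.2 (by
    have := mul_nonneg (hq0 n) hτ
    linarith)
  refine add_le_add ((mul_le_of_le_one_left (norm_nonneg _) hexp1).trans (hI n)) ?_
  exact mul_le_mul_of_nonneg_right (mul_le_mul_of_nonneg_right (hH n) (abs_nonneg _))
    (abs_nonneg _)

/-- Critical decay along a sequence of kernels satisfying the assumptions uniformly. -/
lemma tendsto_critical_decay (hd : 1 ≤ d) {S J h : ℕ → (Fin d → ℤ) → ℝ}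
    {x : ℕ → Fin d → ℤ} {s : ℝ} (hS : ∀ n, AssumptionOmega (S n))
    (hJ : ∀ n, AssumptionJ (S n) (J n) (h n) M K ζ) (hx : ∀ n, x n ≠ 0)
    (hmass : Tendsto (fun n => mass (S n)) atTop (𝓝 0))
    (hxnorm : Tendsto (fun n => enormZ (x n)) atTop atTop)
    (hmx : Tendsto (fun n => mass (S n) * normS (S n) (toR (x n))) atTop (𝓝 s))
    (hs : 0 ≤ s) (hs2 : d ≤ 2 → 0 < s) :
    Tendsto (fun n => S n (x n) * sigmaSq (J n) * enormZ (x n) ^ ((d : ℝ) - 2) / (d : ℝ) -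
      massiveG d s (e1R d 1) * h0 (h n)) atTop (𝓝 0) := by
  have hM := (hJ 0).M_pos
  have hK := (hJ 0).K_pos
  have hθ := (hJ 0).theta_pos
  have hθ1 : min ζ 1 ≤ 1 := min_le_right _ _
  have hd0 : (0 : ℝ) < d := by exact_mod_cast hd
  have hQ := fun n => (hJ n).kernelBounds_zero hd (hS n)
  have hσ : ∀ n, 0 < sigmaSq (J n) := fun n =>
    lt_of_lt_of_le (by positivity) ((hQ n).le_sigmaSq hd (hJ n).J_symm hθ hθ1)
  have hrep := fun n => (hJ n).integral_It_scaled hd (hS n) (hx n) (hσ n)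
  have hq := tendsto_rescaled_mass_gap hd hS hJ hx hmass hmx
  have hq0 : ∀ n, 0 ≤ d * enormZ (x n) ^ 2 / sigmaSq (J n) * (1 - tiltSum (J n) 0) := fun n => by
    have h1 := ((hJ n).tiltSum_pos hd (hS n) (hS n).zero_mem).2
    have h2 := hσ n
    positivity
  set q : ℕ → ℝ := fun n => d * enormZ (x n) ^ 2 / sigmaSq (J n) * (1 - tiltSum (J n) 0) with hqdef
  have hβ : ∀ᶠ n in atTop, s ^ 2 / 4 ≤ q n := by
    rcases hs.eq_or_lt with h | h
    · filter_upwards with n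
      rw [← h]
      simpa using hq0 n
    · filter_upwards [hq.eventually_const_lt (show s ^ 2 / 4 < s ^ 2 / 2 by
        have := pow_pos h 2
        linarith)] with n hn using hn.le
  obtain ⟨F, hF, hdom⟩ := exists_integrable_majorant (d := d) (θ := min ζ 1) hd hM hK hθ hθ1
    (show 0 ≤ s ^ 2 / 4 by positivity) fun h => by
      have := hs2 h
      positivity
  have hs4 : s ^ 2 / 4 ≤ s ^ 2 / 2 := by linarith [sq_nonneg s]
  let G : ℝ → ℝ := fun τ => heatUnit d τ * Real.exp (-(s ^ 2 / 2 * τ))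
  have hGnn : ∀ τ ∈ Set.Ioi (0 : ℝ), 0 ≤ G τ := fun τ hτ =>
    mul_nonneg (heatUnit_nonneg (le_of_lt hτ)) (Real.exp_pos _).le
  have hGF : ∀ τ ∈ Set.Ioi (0 : ℝ), G τ ≤ F τ := fun τ hτ => by
    have := (hdom _ hs4 τ hτ).1
    rwa [mul_comm] at this
  have hGi : IntegrableOn G (Set.Ioi 0) := by
    refine hF.mono' ?_ ?_
    · refine Measurable.aestronglyMeasurable ?_
      simp only [G, heatUnit]
      fun_prop
    · filter_upwards [ae_restrict_mem measurableSet_Ioi] with τ hτ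
      rw [Real.norm_eq_abs, abs_of_nonneg (hGnn τ hτ)]
      exact hGF τ hτ
  let f : ℕ → ℝ → ℂ := fun n τ => (Real.exp (-(q n * τ)) : ℂ) *
    ((enormZ (x n) ^ d : ℝ) * It (J n) (h n) (d * enormZ (x n) ^ 2 / sigmaSq (J n) * τ) (x n))
  have hGc : ∀ n, IntegrableOn (fun τ => ((h0 (h n) * G τ : ℝ) : ℂ)) (Set.Ioi 0) := fun n =>
    (hGi.const_mul _).ofReal
  have hfi : ∀ n, IntegrableOn (f n) (Set.Ioi 0) := fun n => (hrep n).1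
  have hint : ∀ n, ∫ τ in Set.Ioi (0 : ℝ), (f n τ - ((h0 (h n) * G τ : ℝ) : ℂ)) =
      ((S n (x n) * sigmaSq (J n) * enormZ (x n) ^ ((d : ℝ) - 2) / d -
        massiveG d s (e1R d 1) * h0 (h n) : ℝ) : ℂ) := fun n => by
    rw [integral_sub (hfi n) (hGc n), integral_complex_ofReal, integral_const_mul,
      massiveG_e1R hd, mul_comm (h0 (h n)), Complex.ofReal_sub]
    congr 1
    exact (hrep n).2
  have hlim : Tendsto (fun n => ∫ τ in Set.Ioi (0 : ℝ), (f n τ - ((h0 (h n) * G τ : ℝ) : ℂ)))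
      atTop (𝓝 (∫ _τ in Set.Ioi (0 : ℝ), (0 : ℂ))) := by
    refine tendsto_integral_filter_of_dominated_convergence (fun τ => F τ + M * F τ)
      (Eventually.of_forall fun n => ((hfi n).sub (hGc n)).aestronglyMeasurable) ?_
      (hF.add (hF.const_mul M)) ?_
    · filter_upwards [hβ] with n hn
      filter_upwards [ae_restrict_mem measurableSet_Ioi] with τ hτ
      refine (norm_sub_le _ _).trans (add_le_add ?_ ?_)
      · have := (hdom _ hn τ hτ).2 (J n) (h n) (hQ n) (hJ n).J_symm (x n) (hx n)
        rwa [norm_mul, Complex.norm_real, Real.norm_eq_abs, Real.abs_exp]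
      · rw [Complex.norm_real, Real.norm_eq_abs, abs_mul, abs_of_nonneg (hGnn τ hτ)]
        exact mul_le_mul (hQ n).abs_h0_le (hGF τ hτ) (hGnn τ hτ) hM.le
    · filter_upwards [ae_restrict_mem measurableSet_Ioi] with τ hτ
      exact tendsto_exp_mul_sub hθ hxnorm hq0 hq (fun n => (hQ n).abs_h0_le) (le_of_lt hτ)
        fun n => (hQ n).norm_scaled_It_sub_le hd (hJ n).J_symm hM hK hθ hθ1 (hx n) hτ
  simp only [hint, integral_zero] at hlim
  have hre := (Complex.continuous_re.tendsto _).comp hlim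
  simpa only [Function.comp_def, Complex.ofReal_re, Complex.zero_re] using hre

end Convergence

theorem statement10 (d : ℕ) (hd : 1 ≤ d) (δ zc M K ζ : ℝ)
    (S J h : ℝ → (Fin d → ℤ) → ℝ)
    (hfam : CriticalFamily d δ zc M K ζ S J h)
    (s : ℝ) (hs : 0 ≤ s) (hs2 : d ≤ 2 → 0 < s)
    (z : ℕ → ℝ) (x : ℕ → Fin d → ℤ)
    (hz : ∀ n, z n ∈ Set.Ico (zc - δ) zc)
    (hz' : Tendsto z atTop (𝓝 zc))
    (hx : ∀ n, x n ≠ 0)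
    (hxnorm : Tendsto (fun n => enormZ (x n)) atTop atTop)
    (hmx : Tendsto (fun n => mass (S (z n)) * normS (S (z n)) (toR (x n))) atTop (𝓝 s)) :
    Tendsto (fun n =>
        S (z n) (x n) * sigmaSq (J (z n)) * enormZ (x n) ^ ((d : ℝ) - 2) / (d : ℝ) -
          massiveG d s (e1R d 1) * h0 (h (z n))) atTop (𝓝 0) := by
  refine tendsto_critical_decay hd (S := fun n => S (z n)) (J := fun n => J (z n))
    (h := fun n => h (z n)) (fun n => hfam.assumOmega _ (hz n)) (fun n => hfam.assumJ _ (hz n))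
    hx ?_ hxnorm hmx hs hs2
  exact hfam.mass_tendsto.comp
    (tendsto_nhdsWithin_iff.2 ⟨hz', Eventually.of_forall fun n => (hz n).2⟩)

end OZpaper
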